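/- arXiv:2204.12455 — 3 statements merged into one kernel-verified Lean document; each statement's English description precedes it below -/
import Mathlib

section
/- For all positive integers t and g there is a constant C = C(t, g) such that the following holds: every finite simple graph G with maximum degree Δ ≥ 4 whose average degree is at least C·log₂ log₂ Δ contains a subgraph with average degree at least t and girth at least g. -/
variable {V : Type*}

/-- `G` is a bipartite graph with parts `A` and `B`: the parts are disjoint, cover all
vertices, and every edge goes between `A` and `B`. -/
def BipartiteWith (G : SimpleGraph V) (A B : Set V) : Prop :=
  Disjoint A B ∧ A ∪ B = Set.univ ∧
    ∀ ⦃u v : V⦄, G.Adj u v → (u ∈ A ∧ v ∈ B) ∨ (u ∈ B ∧ v ∈ A)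

/-- `G` contains no complete bipartite subgraph `K_{k,k}`. -/
def KkkFree (G : SimpleGraph V) (k : ℕ) : Prop :=
  ¬ ∃ (S T : Finset V), Disjoint S T ∧ S.card = k ∧ T.card = k ∧
      ∀ u ∈ S, ∀ v ∈ T, G.Adj u v

/-- The number of edges of `G`. -/
noncomputable def edgeCount (G : SimpleGraph V) : ℕ := G.edgeSet.ncard

/-- The degree of `v` in `G`. -/
noncomputable def deg (G : SimpleGraph V) (v : V) : ℕ := (G.neighborSet v).ncard

/-- The codegree of `u` and `u'` in `G`: the number of their common neighbours. -/
noncomputable def codeg (G : SimpleGraph V) (u u' : V) : ℕ :=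
  (G.neighborSet u ∩ G.neighborSet u').ncard

/-- The average degree of `G`, as a real number. -/
noncomputable def avgDeg [Fintype V] (G : SimpleGraph V) : ℝ :=
  2 * (edgeCount G : ℝ) / (Fintype.card V : ℝ)

/-- The number of edges of a subgraph. -/
noncomputable def subEdgeCount {G : SimpleGraph V} (H : G.Subgraph) : ℕ := H.edgeSet.ncard

/-- The degree of a vertex in a subgraph. -/
noncomputable def subDeg {G : SimpleGraph V} (H : G.Subgraph) (v : V) : ℕ :=
  (H.neighborSet v).ncard

/-- The average degree of a subgraph. -/
noncomputable def subAvgDeg {G : SimpleGraph V} (H : G.Subgraph) : ℝ :=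
  2 * (subEdgeCount H : ℝ) / (H.verts.ncard : ℝ)

/-- A subgraph `H` is `K`-almost-regular: its maximum degree is at most `K` times its
minimum degree. -/
def SubAlmostRegular {G : SimpleGraph V} (H : G.Subgraph) (K : ℝ) : Prop :=
  ∀ v ∈ H.verts, ∀ w ∈ H.verts, (subDeg H v : ℝ) ≤ K * (subDeg H w : ℝ)

/-- `G` has a nonempty `k`-regular subgraph. -/
def HasRegularSubgraph (G : SimpleGraph V) (k : ℕ) : Prop :=
  ∃ H : G.Subgraph, H.verts.Nonempty ∧ ∀ v ∈ H.verts, subDeg H v = k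

/-- `G` has a nonempty `K`-almost-regular subgraph with average degree at least `c`. -/
def HasAlmostRegularSubgraph (G : SimpleGraph V) (K : ℝ) (c : ℝ) : Prop :=
  ∃ H : G.Subgraph, H.verts.Nonempty ∧ SubAlmostRegular H K ∧ c ≤ subAvgDeg H

/-- `G` is `(L, d)`-almost-biregular with parts `A` and `B`. -/
def IsAlmostBiregular (G : SimpleGraph V) (A B : Set V) (L : ℝ) (d : ℕ) : Prop :=
  BipartiteWith G A B ∧ A.Nonempty ∧
    (∀ v ∈ B, deg G v = d) ∧
    (d : ℝ) ≤ (edgeCount G : ℝ) / (A.ncard : ℝ) ∧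
    ∀ u ∈ A, (deg G u : ℝ) ≤ L * ((edgeCount G : ℝ) / (A.ncard : ℝ))

/-- A subgraph `H` of `G` is `(L, d)`-almost-biregular with parts `A` and `B`. -/
def SubIsAlmostBiregular {G : SimpleGraph V} (H : G.Subgraph) (A B : Set V)
    (L : ℝ) (d : ℕ) : Prop :=
  Disjoint A B ∧ A ∪ B = H.verts ∧
    (∀ ⦃u v : V⦄, H.Adj u v → (u ∈ A ∧ v ∈ B) ∨ (u ∈ B ∧ v ∈ A)) ∧
    A.Nonempty ∧
    (∀ v ∈ B, subDeg H v = d) ∧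
    (d : ℝ) ≤ (subEdgeCount H : ℝ) / (A.ncard : ℝ) ∧
    ∀ u ∈ A, (subDeg H u : ℝ) ≤ L * ((subEdgeCount H : ℝ) / (A.ncard : ℝ))

/-- A multilinear polynomial on the cube `[0, 1]^ι` is at most its value at some vertex. -/
theorem exists_finset_multilinear_le {ι κ : Type*} [Fintype ι] [DecidableEq ι]
    (J : Finset κ) (c : κ → ℝ) (R : κ → Finset ι) (p : ι → ℝ)
    (hp : ∀ i, 0 ≤ p i ∧ p i ≤ 1) :
    ∃ S : Finset ι, ∑ j ∈ J, c j * ∏ i ∈ R j, p i ≤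
      ∑ j ∈ J, c j * (if R j ⊆ S then 1 else 0) := by
  have key : ∀ U : Finset ι, ∃ p' : ι → ℝ, (∀ i, 0 ≤ p' i ∧ p' i ≤ 1) ∧
      (∀ i ∈ U, p' i = 0 ∨ p' i = 1) ∧
      ∑ j ∈ J, c j * ∏ i ∈ R j, p i ≤ ∑ j ∈ J, c j * ∏ i ∈ R j, p' i := by
    intro U
    induction U using Finset.induction_on with
    | empty => exact ⟨p, hp, by simp, le_rfl⟩
    | insert a U ha ih =>
      obtain ⟨p', h01, hU, hle⟩ := ih
      have split : ∑ j ∈ J, c j * ∏ i ∈ R j, p' i =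
          (1 - p' a) * ∑ j ∈ J, c j * ∏ i ∈ R j, Function.update p' a 0 i +
            p' a * ∑ j ∈ J, c j * ∏ i ∈ R j, Function.update p' a 1 i := by
        rw [Finset.mul_sum, Finset.mul_sum, ← Finset.sum_add_distrib]
        refine Finset.sum_congr rfl fun j _ => ?_
        by_cases haj : a ∈ R j
        · rw [Finset.prod_update_of_mem haj, Finset.prod_update_of_mem haj,
            ← Finset.mul_prod_erase _ _ haj, Finset.erase_eq]
          ring
        · rw [Finset.prod_update_of_notMem haj, Finset.prod_update_of_notMem haj]
          ring
      have good : ∀ x : ℝ, (x = 0 ∨ x = 1) →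
          (∀ i, 0 ≤ Function.update p' a x i ∧ Function.update p' a x i ≤ 1) ∧
          (∀ i ∈ insert a U, Function.update p' a x i = 0 ∨ Function.update p' a x i = 1) := by
        intro x hx
        constructor
        · intro i
          by_cases hi : i = a
          · subst hi
            rcases hx with rfl | rfl <;> simp
          · simpa [Function.update_of_ne hi] using h01 i
        · intro i hiU
          by_cases hi : i = a
          · subst hi
            simpa using hx
          · rw [Function.update_of_ne hi]
            exact hU i ((Finset.mem_insert.mp hiU).resolve_left hi)
      rcases le_total (∑ j ∈ J, c j * ∏ i ∈ R j, Function.update p' a 0 i)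
        (∑ j ∈ J, c j * ∏ i ∈ R j, Function.update p' a 1 i) with h | h
      · refine ⟨_, (good 1 (Or.inr rfl)).1, (good 1 (Or.inr rfl)).2, hle.trans ?_⟩
        rw [split]
        nlinarith [h01 a]
      · refine ⟨_, (good 0 (Or.inl rfl)).1, (good 0 (Or.inl rfl)).2, hle.trans ?_⟩
        rw [split]
        nlinarith [h01 a]
  obtain ⟨p', -, hU, hle⟩ := key Finset.univ
  refine ⟨Finset.univ.filter fun i => p' i = 1, hle.trans_eq ?_⟩
  refine Finset.sum_congr rfl fun j _ => ?_
  congr 1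
  split_ifs with h
  · exact Finset.prod_eq_one fun i hi => by simpa using h hi
  · obtain ⟨i, hi, hi'⟩ := Finset.not_subset.mp h
    exact Finset.prod_eq_zero hi ((hU i (Finset.mem_univ i)).resolve_right (by simpa using hi'))

/-- The pair `c = (v, u)` lists the vertices of an alternating cycle
`v 0, u 0, v 1, u 1, …, v j, u j` of length `2 * (j + 1)`, with `u i ∈ B` joined to
`v i` and `v (i + 1)` through `F`; for `j = 0` the cycle degenerates to a single edge. -/
def IsAltCycle {V : Type*} (B : Finset V) (F : V → Finset V) (j : ℕ)
    (c : (Fin (j + 1) → V) × (Fin (j + 1) → V)) : Prop :=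
  Function.Injective c.1 ∧ Function.Injective c.2 ∧
    ∀ i, c.2 i ∈ B ∧ c.1 i ∈ F (c.2 i) ∧ c.1 (i + 1) ∈ F (c.2 i)

open Classical in
/-- The number of alternating walks with `2 * j` steps that start in `A`. -/
theorem card_altPath_le {V : Type*} [Fintype V] (A B : Finset V) (F : V → Finset V) (M T : ℕ)
    (hM : ∀ v ∈ A, (B.filter fun u => v ∈ F u).card ≤ M) (hT : ∀ u ∈ B, (F u).card ≤ T)
    (hF : ∀ u ∈ B, F u ⊆ A) (j : ℕ) :
    (Finset.univ.filter fun c : (Fin (j + 1) → V) × (Fin j → V) =>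
      c.1 0 ∈ A ∧ ∀ i : Fin j, c.2 i ∈ B ∧ c.1 i.castSucc ∈ F (c.2 i) ∧
        c.1 i.succ ∈ F (c.2 i)).card ≤ A.card * (M * T) ^ j := by
  induction j with
  | zero =>
    rw [pow_zero, mul_one]
    refine Finset.card_le_card_of_injOn (fun c => c.1 0) ?_ ?_
    · intro c hc
      simpa using hc
    · intro c _ c' _ h
      refine Prod.ext (funext fun i => ?_) (funext fun i => i.elim0)
      obtain rfl : i = 0 := Fin.ext (by omega)
      exact h
  | succ j ih =>
    set S := (Finset.univ.filter fun c : (Fin (j + 1 + 1) → V) × (Fin (j + 1) → V) =>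
      c.1 0 ∈ A ∧ ∀ i : Fin (j + 1), c.2 i ∈ B ∧ c.1 i.castSucc ∈ F (c.2 i) ∧
        c.1 i.succ ∈ F (c.2 i)) with hS
    let f : (Fin (j + 1 + 1) → V) × (Fin (j + 1) → V) → (Fin (j + 1) → V) × (Fin j → V) :=
      fun c => (fun i => c.1 i.castSucc, fun i => c.2 i.castSucc)
    have h1 : S.card ≤ (M * T) * (S.image f).card := by
      refine Finset.card_le_mul_card_image S _ fun b hb => ?_
      obtain ⟨c₀, hc₀, rfl⟩ := Finset.mem_image.mp hb
      simp only [hS, Finset.mem_filter, Finset.mem_univ, true_and] at hc₀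
      set x := c₀.1 (Fin.last j).castSucc with hx
      have hxA : x ∈ A := hF _ (hc₀.2 (Fin.last j)).1 (hc₀.2 (Fin.last j)).2.1
      have h2 : ((B.filter fun u => x ∈ F u).sigma fun u => F u).card ≤ M * T := by
        rw [Finset.card_sigma]
        refine (Finset.sum_le_card_nsmul _ _ T fun u hu =>
          hT u (Finset.mem_filter.mp hu).1).trans ?_
        rw [smul_eq_mul]
        exact Nat.mul_le_mul_right _ (hM x hxA)
      refine le_trans (Finset.card_le_card_of_injOn
        (fun c => (⟨c.2 (Fin.last j), c.1 (Fin.last (j + 1))⟩ : Σ _ : V, V)) ?_ ?_) h2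
      · intro c hc
        simp only [hS, Finset.coe_filter, Finset.mem_filter, Finset.mem_univ, true_and,
          Set.mem_ofPred_eq] at hc
        have hxe : c.1 (Fin.last j).castSucc = x := congrFun (congrArg Prod.fst hc.2) (Fin.last j)
        have := hc.1.2 (Fin.last j)
        rw [hxe, Fin.succ_last] at this
        simp [this]
      · intro c hc c' hc' h
        simp only [hS, Finset.coe_filter, Finset.mem_filter, Finset.mem_univ, true_and,
          Set.mem_ofPred_eq] at hc hc'
        have he := hc.2.trans hc'.2.symm
        simp only [Sigma.mk.injEq, heq_eq_eq] at h
        refine Prod.ext (funext fun i => ?_) (funext fun i => ?_)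
        · refine Fin.lastCases h.2 (fun i => ?_) i
          exact congrFun (congrArg Prod.fst he) i
        · refine Fin.lastCases h.1 (fun i => ?_) i
          exact congrFun (congrArg Prod.snd he) i
    have h3 : (S.image f).card ≤ A.card * (M * T) ^ j := by
      refine (Finset.card_le_card ?_).trans ih
      intro b hb
      obtain ⟨c, hc, rfl⟩ := Finset.mem_image.mp hb
      simp only [hS, Finset.mem_filter, Finset.mem_univ, true_and] at hc
      simp only [Finset.mem_filter, Finset.mem_univ, true_and, f]
      exact ⟨hc.1, fun i => hc.2 i.castSucc⟩
    calc S.card ≤ (M * T) * (S.image f).card := h1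
      _ ≤ (M * T) * (A.card * (M * T) ^ j) := Nat.mul_le_mul_left _ h3
      _ = A.card * (M * T) ^ (j + 1) := by ring

open Classical in
theorem card_altCycle_le {V : Type*} [Fintype V] (A B : Finset V) (F : V → Finset V)
    (M T Γ : ℕ)
    (hM : ∀ v ∈ A, (B.filter fun u => v ∈ F u).card ≤ M) (hT : ∀ u ∈ B, (F u).card ≤ T)
    (hΓ : ∀ v ∈ A, ∀ w ∈ A, v ≠ w → (B.filter fun u => v ∈ F u ∧ w ∈ F u).card ≤ Γ)
    (hF : ∀ u ∈ B, F u ⊆ A) (j : ℕ) (hj : 1 ≤ j) :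
    (Finset.univ.filter (IsAltCycle B F j)).card ≤ A.card * (M * T) ^ j * Γ := by
  set S := Finset.univ.filter (IsAltCycle B F j) with hS
  let f : (Fin (j + 1) → V) × (Fin (j + 1) → V) → (Fin (j + 1) → V) × (Fin j → V) :=
    fun c => (c.1, fun i => c.2 i.castSucc)
  have h1 : S.card ≤ Γ * (S.image f).card := by
    refine Finset.card_le_mul_card_image S _ fun b hb => ?_
    obtain ⟨c₀, hc₀, rfl⟩ := Finset.mem_image.mp hb
    simp only [hS, Finset.mem_filter, Finset.mem_univ, true_and] at hc₀
    have hlast := hc₀.2.2 (Fin.last j)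
    have hne : c₀.1 (Fin.last j) ≠ c₀.1 (Fin.last j + 1) := by
      intro h
      have := hc₀.1 h
      rw [Fin.last_add_one, Fin.ext_iff] at this
      simp at this
      omega
    refine le_trans (Finset.card_le_card_of_injOn (fun c => c.2 (Fin.last j)) ?_ ?_)
      (hΓ _ (hF _ hlast.1 hlast.2.1) _ (hF _ hlast.1 hlast.2.2) hne)
    · intro c hc
      simp only [hS, Finset.coe_filter, Finset.mem_filter, Finset.mem_univ, true_and,
          Set.mem_ofPred_eq] at hc
      have h1 : c.1 = c₀.1 := (congrArg Prod.fst hc.2 : (f c).1 = (f c₀).1)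
      have := hc.1.2.2 (Fin.last j)
      rw [h1] at this
      simpa using this
    · intro c hc c' hc' h
      simp only [hS, Finset.coe_filter, Finset.mem_filter, Finset.mem_univ, true_and,
          Set.mem_ofPred_eq] at hc hc'
      have he := hc.2.trans hc'.2.symm
      refine Prod.ext (congrArg Prod.fst he : (f c).1 = (f c').1) (funext fun i => ?_)
      refine Fin.lastCases h (fun i => ?_) i
      exact congrFun (congrArg Prod.snd he) i
  have h3 : (S.image f).card ≤ A.card * (M * T) ^ j := by
    refine (Finset.card_le_card ?_).trans (card_altPath_le A B F M T hM hT hF j)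
    intro b hb
    obtain ⟨c, hc, rfl⟩ := Finset.mem_image.mp hb
    simp only [hS, Finset.mem_filter, Finset.mem_univ, true_and] at hc
    simp only [Finset.mem_filter, Finset.mem_univ, true_and, f]
    refine ⟨hF _ (hc.2.2 0).1 (hc.2.2 0).2.1, fun i => ?_⟩
    have := hc.2.2 i.castSucc
    rwa [Fin.coeSucc_eq_succ] at this
  calc S.card ≤ Γ * (S.image f).card := h1
    _ ≤ Γ * (A.card * (M * T) ^ j) := Nat.mul_le_mul_left _ h3
    _ = A.card * (M * T) ^ j * Γ := by ring

/-- A cycle in a bipartite graph (with colour class `s`) alternates between the two classes. -/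
theorem exists_alternating_of_isCycle {W : Type*} (K : SimpleGraph W) (s : W → Prop)
    (hs : ∀ x y, K.Adj x y → (s x ↔ ¬ s y)) {a : W} (c : K.Walk a a) (hc : c.IsCycle) :
    ∃ j : ℕ, 1 ≤ j ∧ c.length = 2 * (j + 1) ∧ ∃ v u : Fin (j + 1) → W,
      Function.Injective v ∧ Function.Injective u ∧
      ∀ i, s (v i) ∧ ¬ s (u i) ∧ K.Adj (u i) (v i) ∧ K.Adj (u i) (v (i + 1)) := by
  have hpar : ∀ i, i ≤ c.length → (s (c.getVert i) ↔ (s a ↔ Even i)) := by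
    intro i
    induction i with
    | zero => simp
    | succ i ih =>
      intro hi
      have h1 := hs _ _ (c.adj_getVert_succ (i := i) (by omega))
      have h2 := ih (by omega)
      rw [Nat.even_add_one]
      tauto
  have heven : Even c.length := by
    have := hpar c.length le_rfl
    rw [c.getVert_length] at this
    tauto
  have h3 := hc.three_le_length
  obtain ⟨n, hn⟩ := heven
  obtain ⟨j, rfl⟩ : ∃ j, n = j + 1 := ⟨n - 1, by omega⟩
  refine ⟨j, by omega, by omega, ?_⟩
  by_cases hsa : s a
  · have hnext : ∀ i : Fin (j + 1),
        c.getVert (2 * ((i + 1 : Fin (j + 1)) : ℕ)) = c.getVert (2 * (i : ℕ) + 2) := by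
      intro i
      refine Fin.lastCases ?_ (fun i => ?_) i
      · rw [Fin.last_add_one]
        have : 2 * ((Fin.last j : Fin (j + 1)) : ℕ) + 2 = c.length := by simp; omega
        rw [this, c.getVert_length]
        simp
      · rw [Fin.coeSucc_eq_succ]
        congr 1
    refine ⟨fun i => c.getVert (2 * i), fun i => c.getVert (2 * i + 1), ?_, ?_, fun i => ?_⟩
    · intro x y hxy
      have := hc.getVert_injOn' (by rw [Set.mem_ofPred_eq]; omega)
        (by rw [Set.mem_ofPred_eq]; omega) hxy
      exact Fin.ext (by omega)
    · intro x y hxy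
      have := hc.getVert_injOn' (by rw [Set.mem_ofPred_eq]; omega)
        (by rw [Set.mem_ofPred_eq]; omega) hxy
      exact Fin.ext (by omega)
    · have hi := i.2
      refine ⟨?_, ?_, ?_, ?_⟩
      · rw [hpar _ (by omega)]
        simp [hsa]
      · rw [hpar _ (by omega)]
        simp [hsa]
      · exact (c.adj_getVert_succ (by omega)).symm
      · simp only [hnext]
        exact c.adj_getVert_succ (by omega)
  · have hnext : ∀ i : Fin (j + 1),
        K.Adj (c.getVert (2 * (i : ℕ) + 2)) (c.getVert (2 * ((i + 1 : Fin (j + 1)) : ℕ) + 1)) := by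
      intro i
      refine Fin.lastCases ?_ (fun i => ?_) i
      · rw [Fin.last_add_one]
        have : 2 * ((Fin.last j : Fin (j + 1)) : ℕ) + 2 = c.length := by simp; omega
        rw [this, c.getVert_length]
        simpa using c.adj_getVert_succ (i := 0) (by omega)
      · rw [Fin.coeSucc_eq_succ]
        have hi := i.2
        have : 2 * (i.succ : ℕ) + 1 = (2 * (i.castSucc : ℕ) + 2) + 1 := by simp; ring
        rw [this]
        exact c.adj_getVert_succ (by simp; omega)
    refine ⟨fun i => c.getVert (2 * i + 1), fun i => c.getVert (2 * i + 2), ?_, ?_, fun i => ?_⟩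
    · intro x y hxy
      have := hc.getVert_injOn (by rw [Set.mem_ofPred_eq]; omega)
        (by rw [Set.mem_ofPred_eq]; omega) hxy
      exact Fin.ext (by omega)
    · intro x y hxy
      have := hc.getVert_injOn (by rw [Set.mem_ofPred_eq]; omega)
        (by rw [Set.mem_ofPred_eq]; omega) hxy
      exact Fin.ext (by omega)
    · have hi := i.2
      refine ⟨?_, ?_, ?_, hnext i⟩
      · rw [hpar _ (by omega)]
        simp [hsa]
      · rw [hpar _ (by omega)]
        simp [hsa, Nat.even_add]
      · exact (c.adj_getVert_succ (by omega)).symm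

open Classical in
theorem exists_subgraph_of_no_altCycle {V : Type*} [Fintype V] (G : SimpleGraph V) (t g : ℕ)
    (A B : Finset V) (hAB : Disjoint A B) (hA : A.Nonempty) (E : Finset (V × V))
    (hE : ∀ e ∈ E, e.1 ∈ B ∧ e.2 ∈ A ∧ G.Adj e.1 e.2)
    (hcard : t * (A.card + B.card) ≤ E.card)
    (hcyc : ∀ j : ℕ, 1 ≤ j → j ≤ g → ∀ v u : Fin (j + 1) → V, Function.Injective v →
      Function.Injective u → ¬ ∀ i, (u i, v i) ∈ E ∧ (u i, v (i + 1)) ∈ E) :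
    ∃ H : G.Subgraph, (t : ℝ) ≤ subAvgDeg H ∧ (g : ℕ∞) ≤ H.coe.egirth := by
  let H : G.Subgraph :=
    { verts := ↑(A ∪ B)
      Adj := fun x y => (x, y) ∈ E ∨ (y, x) ∈ E
      adj_sub := by
        rintro x y (h | h)
        · exact (hE _ h).2.2
        · exact (hE _ h).2.2.symm
      edge_vert := by
        rintro x y (h | h)
        · simp [(hE _ h).1]
        · simp [(hE _ h).2.1]
      symm := ⟨fun x y h => h.symm⟩ }
  have hd : ∀ x, x ∈ A → x ∉ B := fun x hx hx' => Finset.disjoint_left.mp hAB hx hx'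
  refine ⟨H, ?_, ?_⟩
  · have hv : H.verts.ncard = A.card + B.card := by
      change ((A ∪ B : Finset V) : Set V).ncard = _
      rw [Set.ncard_coe_finset, Finset.card_union_of_disjoint hAB]
    have he : E.card ≤ subEdgeCount H := by
      rw [subEdgeCount, ← Set.ncard_coe_finset E]
      refine Set.ncard_le_ncard_of_injOn (fun e => s(e.1, e.2)) ?_ ?_ (Set.toFinite _)
      · intro e he
        rw [SimpleGraph.Subgraph.mem_edgeSet]
        exact Or.inl he
      · intro e he e' he' h
        rcases Sym2.eq_iff.mp h with h | h
        · exact Prod.ext h.1 h.2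
        · have h1 := (hE _ he).1
          rw [h.1] at h1
          exact absurd h1 (hd _ (hE _ he').2.1)
    have hpos : (0 : ℝ) < (H.verts.ncard : ℝ) := by
      rw [hv]
      have := hA.card_pos
      exact_mod_cast (by omega : 0 < A.card + B.card)
    rw [subAvgDeg, le_div_iff₀ hpos, hv]
    have : ((t * (A.card + B.card) : ℕ) : ℝ) ≤ subEdgeCount H := by exact_mod_cast hcard.trans he
    push_cast at this ⊢
    have h0 : (0 : ℝ) ≤ subEdgeCount H := Nat.cast_nonneg _
    linarith
  · rw [SimpleGraph.le_egirth]
    intro a w hw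
    by_contra hlt
    have hlt : w.length < g := by
      rw [not_le] at hlt
      exact_mod_cast hlt
    have hs : ∀ x y : H.verts, H.coe.Adj x y → ((x : V) ∈ A ↔ ¬ (y : V) ∈ A) := by
      rintro ⟨x, hx⟩ ⟨y, hy⟩ h
      have h : (x, y) ∈ E ∨ (y, x) ∈ E := h
      have hx := hd x
      have hy := hd y
      rcases h with h | h
      · have := hE _ h
        simp only at this
        tauto
      · have := hE _ h
        simp only at this
        tauto
    obtain ⟨j, hj, hlen, v, u, hv, hu, hc⟩ :=
      exists_alternating_of_isCycle H.coe (fun x => (x : V) ∈ A) hs w hw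
    refine hcyc j hj (by omega) (fun i => v i) (fun i => u i)
      (Subtype.val_injective.comp hv) (Subtype.val_injective.comp hu) fun i => ?_
    obtain ⟨-, h2, h3, h4⟩ := hc i
    have h3 : ((u i : V), (v i : V)) ∈ E ∨ ((v i : V), (u i : V)) ∈ E := h3
    have h4 : ((u i : V), (v (i + 1) : V)) ∈ E ∨ ((v (i + 1) : V), (u i : V)) ∈ E := h4
    exact ⟨h3.resolve_right fun h => h2 (hE _ h).2.1, h4.resolve_right fun h => h2 (hE _ h).2.1⟩

/-- A pair of vertex sequences of a common positive length, as for an alternating cycle. -/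
abbrev AltSeq (V : Type*) := Σ j : ℕ, (Fin (j + 1) → V) × (Fin (j + 1) → V)

open Classical in
/-- Keep each vertex of `B` with probability `q` and each edge with probability `p`, then delete
an edge from each surviving short cycle. -/
theorem exists_subgraph_of_sampling {V : Type*} [Fintype V] (G : SimpleGraph V) (t g : ℕ)
    (A B : Finset V) (hAB : Disjoint A B) (hA : A.Nonempty) (F : V → Finset V)
    (hF : ∀ u ∈ B, F u ⊆ A) (hadj : ∀ u ∈ B, ∀ v ∈ F u, G.Adj u v) (M T Γ : ℕ)
    (hM : ∀ v ∈ A, (B.filter fun u => v ∈ F u).card ≤ M) (hT : ∀ u ∈ B, (F u).card ≤ T)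
    (hΓ : ∀ v ∈ A, ∀ w ∈ A, v ≠ w → (B.filter fun u => v ∈ F u ∧ w ∈ F u).card ≤ Γ)
    (q p : ℝ) (hq : 0 ≤ q ∧ q ≤ 1) (hp : 0 ≤ p ∧ p ≤ 1)
    (hmain : t * (A.card + q * B.card) +
      ∑ j ∈ Finset.Icc 1 g, A.card * ((M : ℝ) * T) ^ j * Γ * (q ^ (j + 1) * p ^ (2 * (j + 1))) ≤
      p * q * ∑ u ∈ B, ((F u).card : ℝ)) :
    ∃ H : G.Subgraph, (t : ℝ) ≤ subAvgDeg H ∧ (g : ℕ∞) ≤ H.coe.egirth := by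
  let cycles : Finset (AltSeq V) :=
    (Finset.Icc 1 g).sigma fun j => Finset.univ.filter (IsAltCycle B F j)
  let edges : Finset (V × V) := (B ×ˢ A).filter fun e => e.2 ∈ F e.1
  let req : AltSeq V → Finset (V ⊕ V × V) := fun c =>
    Finset.univ.image (fun i => Sum.inl (c.2.2 i)) ∪
      (Finset.univ.image (fun i => Sum.inr (c.2.2 i, c.2.1 i)) ∪
        Finset.univ.image (fun i => Sum.inr (c.2.2 i, c.2.1 (i + 1))))
  let R : (V × V) ⊕ (V ⊕ AltSeq V) → Finset (V ⊕ V × V) :=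
    Sum.elim (fun e => {Sum.inl e.1, Sum.inr e}) (Sum.elim (fun u => {Sum.inl u}) req)
  let wt : (V × V) ⊕ (V ⊕ AltSeq V) → ℝ :=
    Sum.elim (fun _ => 1) (Sum.elim (fun _ => -t) (fun _ => -1))
  let P : V ⊕ V × V → ℝ := Sum.elim (fun _ => q) (fun _ => p)
  obtain ⟨S, hS⟩ := exists_finset_multilinear_le (edges.disjSum (B.disjSum cycles)) wt R P
    (by rintro (i | i) <;> simp [P, hq, hp])
  have hprod : ∀ c ∈ cycles, ∏ i ∈ req c, P i = q ^ (c.1 + 1) * p ^ (2 * (c.1 + 1)) := by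
    rintro ⟨j, v, u⟩ hc
    simp only [cycles, Finset.mem_sigma, Finset.mem_Icc, Finset.mem_filter, Finset.mem_univ,
      true_and] at hc
    obtain ⟨⟨hj, -⟩, hv, hu, -⟩ := hc
    simp only at hv hu
    simp only [req]
    rw [Finset.prod_union, Finset.prod_union, Finset.prod_image, Finset.prod_image,
      Finset.prod_image]
    · simp only [P, Sum.elim_inl, Sum.elim_inr, Finset.prod_const, Finset.card_univ,
        Fintype.card_fin]
      ring
    · intro i _ i' _ h
      simp only [Sum.inr.injEq, Prod.mk.injEq] at h
      exact hu h.1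
    · intro i _ i' _ h
      simp only [Sum.inr.injEq, Prod.mk.injEq] at h
      exact hu h.1
    · intro i _ i' _ h
      simp only [Sum.inl.injEq] at h
      exact hu h
    · rw [Finset.disjoint_left]
      intro x hx hx'
      obtain ⟨i, -, rfl⟩ := Finset.mem_image.mp hx
      obtain ⟨i', -, h⟩ := Finset.mem_image.mp hx'
      simp only [Sum.inr.injEq, Prod.mk.injEq] at h
      obtain rfl := hu h.1
      have h2 := hv h.2
      have : (1 : Fin (j + 1)) = 0 := by simpa using h2
      rw [Fin.one_eq_zero_iff] at this
      omega
    · rw [Finset.disjoint_left]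
      intro x hx hx'
      obtain ⟨i, -, rfl⟩ := Finset.mem_image.mp hx
      simp at hx'
  have hedges : (edges.card : ℝ) = ∑ u ∈ B, ((F u).card : ℝ) := by
    have : edges.card = ∑ u ∈ B, (F u).card := by
      rw [← Finset.card_sigma]
      refine Finset.card_bij' (fun e _ => (⟨e.1, e.2⟩ : Σ _ : V, V)) (fun e _ => (e.1, e.2))
        ?_ ?_ ?_ ?_
      · intro e he
        simp only [edges, Finset.mem_filter, Finset.mem_product] at he
        simp [he]
      · intro e he
        simp only [Finset.mem_sigma] at he
        simp [edges, he, hF _ he.1 he.2]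
      · simp
      · simp
    exact_mod_cast this
  have hcycles : ∑ c ∈ cycles, q ^ (c.1 + 1) * p ^ (2 * (c.1 + 1)) ≤
      ∑ j ∈ Finset.Icc 1 g, A.card * ((M : ℝ) * T) ^ j * Γ * (q ^ (j + 1) * p ^ (2 * (j + 1))) := by
    simp only [cycles, Finset.sum_sigma, Finset.sum_const, nsmul_eq_mul]
    refine Finset.sum_le_sum fun j hj => ?_
    have hc := card_altCycle_le A B F M T Γ hM hT hΓ hF j (Finset.mem_Icc.mp hj).1
    have hc' : ((Finset.univ.filter (IsAltCycle B F j)).card : ℝ) ≤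
        A.card * ((M : ℝ) * T) ^ j * Γ := by exact_mod_cast hc
    have hq0 := hq.1
    have hp0 := hp.1
    exact mul_le_mul_of_nonneg_right hc' (by positivity)
  have hlow : ∑ x ∈ edges.disjSum (B.disjSum cycles), wt x * ∏ i ∈ R x, P i =
      p * q * edges.card - t * (q * B.card) -
        ∑ c ∈ cycles, q ^ (c.1 + 1) * p ^ (2 * (c.1 + 1)) := by
    rw [Finset.sum_disjSum, Finset.sum_disjSum]
    have h1 : ∀ e ∈ edges, wt (Sum.inl e) * ∏ i ∈ R (Sum.inl e), P i = p * q := by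
      intro e _
      simp [wt, R, P, mul_comm]
    have h2 : ∀ u ∈ B, wt (Sum.inr (Sum.inl u)) * ∏ i ∈ R (Sum.inr (Sum.inl u)), P i =
        -(t * q) := by
      intro u _
      simp [wt, R, P]
    have h3 : ∀ c ∈ cycles, wt (Sum.inr (Sum.inr c)) * ∏ i ∈ R (Sum.inr (Sum.inr c)), P i =
        -(q ^ (c.1 + 1) * p ^ (2 * (c.1 + 1))) := by
      intro c hc
      simp only [wt, R, Sum.elim_inr]
      rw [hprod c hc]
      ring
    have h3' := (Finset.sum_congr rfl h3).trans
      (Finset.sum_neg_distrib fun c : AltSeq V => q ^ (c.1 + 1) * p ^ (2 * (c.1 + 1)))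
    rw [Finset.sum_congr rfl h1, Finset.sum_congr rfl h2, h3', Finset.sum_const, Finset.sum_const,
      nsmul_eq_mul, nsmul_eq_mul]
    ring
  set E₁ := edges.filter fun e => Sum.inl e.1 ∈ S ∧ Sum.inr e ∈ S with hE₁
  set B₁ := B.filter fun u => Sum.inl u ∈ S with hB₁
  set C₁ := cycles.filter fun c => req c ⊆ S with hC₁
  have hup : ∑ x ∈ edges.disjSum (B.disjSum cycles), wt x * (if R x ⊆ S then 1 else 0) =
      (E₁.card : ℝ) - t * B₁.card - C₁.card := by
    rw [Finset.sum_disjSum, Finset.sum_disjSum]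
    have h1 : ∑ e ∈ edges, wt (Sum.inl e) * (if R (Sum.inl e) ⊆ S then 1 else 0) = E₁.card := by
      rw [hE₁, Finset.card_filter, Nat.cast_sum]
      refine Finset.sum_congr rfl fun e _ => ?_
      simp only [wt, R, Sum.elim_inl, one_mul, Nat.cast_ite, Nat.cast_one, Nat.cast_zero]
      congr 1
      simp [Finset.insert_subset_iff]
    have h2 : ∑ u ∈ B, wt (Sum.inr (Sum.inl u)) * (if R (Sum.inr (Sum.inl u)) ⊆ S then 1 else 0) =
        -t * B₁.card := by
      rw [hB₁, Finset.card_filter, Nat.cast_sum, Finset.mul_sum]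
      refine Finset.sum_congr rfl fun u _ => ?_
      simp only [wt, R, Sum.elim_inl, Sum.elim_inr, Nat.cast_ite, Nat.cast_one, Nat.cast_zero]
      congr 2
      simp
    have h3 : ∑ c ∈ cycles, wt (Sum.inr (Sum.inr c)) *
        (if R (Sum.inr (Sum.inr c)) ⊆ S then 1 else 0) = -C₁.card := by
      rw [hC₁, Finset.card_filter, Nat.cast_sum, ← Finset.sum_neg_distrib]
      refine Finset.sum_congr rfl fun c _ => ?_
      simp only [wt, R, Sum.elim_inr, Nat.cast_ite, Nat.cast_one, Nat.cast_zero, neg_mul, one_mul]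
      congr 2
    rw [h1, h2, h3]
    ring
  have hnet : (t : ℝ) * (A.card + B₁.card) ≤ (E₁.card : ℝ) - C₁.card := by
    rw [hlow, hup, hedges] at hS
    linarith
  let hit : AltSeq V → V × V := fun c => (c.2.2 0, c.2.1 0)
  refine exists_subgraph_of_no_altCycle G t g A B₁
    (Finset.disjoint_of_subset_right (Finset.filter_subset _ _) hAB) hA (E₁ \ C₁.image hit)
    ?_ ?_ ?_
  · intro e he
    simp only [hE₁, hB₁, edges, Finset.mem_sdiff, Finset.mem_filter, Finset.mem_product] at he ⊢
    exact ⟨⟨he.1.1.1.1, he.1.2.1⟩, he.1.1.1.2, hadj _ he.1.1.1.1 _ he.1.1.2⟩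
  · have h1 := Finset.le_card_sdiff (C₁.image hit) E₁
    have h2 : (C₁.image hit).card ≤ C₁.card := Finset.card_image_le
    have h3 : t * (A.card + B₁.card) + C₁.card ≤ E₁.card := by
      have : (t : ℝ) * (A.card + B₁.card) + C₁.card ≤ (E₁.card : ℝ) := by linarith
      exact_mod_cast this
    omega
  · intro j hj hjg v u hv hu hall
    have hmem : ∀ i, (u i ∈ B ∧ v i ∈ F (u i) ∧ v (i + 1) ∈ F (u i)) ∧ Sum.inl (u i) ∈ S ∧
        Sum.inr (u i, v i) ∈ S ∧ Sum.inr (u i, v (i + 1)) ∈ S := by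
      intro i
      have := hall i
      simp only [hE₁, edges, Finset.mem_sdiff, Finset.mem_filter, Finset.mem_product] at this
      tauto
    have hc : (⟨j, v, u⟩ : AltSeq V) ∈ C₁ := by
      simp only [hC₁, cycles, Finset.mem_filter, Finset.mem_sigma, Finset.mem_Icc,
        Finset.mem_univ, true_and]
      refine ⟨⟨⟨hj, hjg⟩, hv, hu, fun i => (hmem i).1⟩, ?_⟩
      intro x hx
      simp only [req, Finset.mem_union, Finset.mem_image, Finset.mem_univ, true_and] at hx
      rcases hx with ⟨i, rfl⟩ | ⟨i, rfl⟩ | ⟨i, rfl⟩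
      · exact (hmem i).2.1
      · exact (hmem i).2.2.1
      · exact (hmem i).2.2.2
    exact (Finset.mem_sdiff.mp (hall 0).1).2 (Finset.mem_image.mpr ⟨_, hc, rfl⟩)

open Classical in
/-- The case where the degrees in `A` are at most a small power of `T` above their average. -/
theorem exists_subgraph_of_dense {V : Type*} [Fintype V] (G : SimpleGraph V) (t g : ℕ)
    (A B : Finset V) (hAB : Disjoint A B) (hA : A.Nonempty) (F : V → Finset V)
    (hF : ∀ u ∈ B, F u ⊆ A) (hadj : ∀ u ∈ B, ∀ v ∈ F u, G.Adj u v) (M T : ℕ)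
    (hM : ∀ v ∈ A, (B.filter fun u => v ∈ F u).card ≤ M) (hT : ∀ u ∈ B, (F u).card ≤ T)
    (z D c : ℝ) (hz : 1 ≤ z) (hzT : z ^ (4 * (g + 1)) = T) (hTM : T ≤ 2 * M)
    (hAD : A.card * D ≤ ∑ u ∈ B, ((F u).card : ℝ)) (hMD : M ≤ D * z)
    (hc : 0 < c) (he : c * T * B.card ≤ ∑ u ∈ B, ((F u).card : ℝ))
    (hbig : t / c + 2 * (t + g) * z ≤ z ^ 2) :
    ∃ H : G.Subgraph, (t : ℝ) ≤ subAvgDeg H ∧ (g : ℕ∞) ≤ H.coe.egirth := by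
  have hT1 : (1 : ℝ) ≤ T := hzT ▸ one_le_pow₀ hz
  have hTM' : (T : ℝ) ≤ 2 * M := by exact_mod_cast hTM
  have hM0 : (0 : ℝ) < M := by linarith
  have hz2 : z ^ 2 ≤ T := hzT ▸ pow_le_pow_right₀ hz (by omega)
  have hT0 : (0 : ℝ) < T := by linarith
  refine exists_subgraph_of_sampling G t g A B hAB hA F hF hadj M T M hM hT ?_
    (T / (2 * M)) (z ^ 2 / T) ⟨by positivity, by rw [div_le_one (by positivity)]; exact hTM'⟩
    ⟨by positivity, by rw [div_le_one hT0]; exact hz2⟩ ?_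
  · intro v hv w _ _
    refine le_trans (Finset.card_le_card ?_) (hM v hv)
    exact fun u hu => by
      simp only [Finset.mem_filter] at hu ⊢
      exact ⟨hu.1, hu.2.1⟩
  set e := ∑ u ∈ B, ((F u).card : ℝ) with he_def
  have hcyc : ∑ j ∈ Finset.Icc 1 g, (A.card : ℝ) * ((M : ℝ) * T) ^ j * M *
      ((T / (2 * M)) ^ (j + 1) * (z ^ 2 / T) ^ (2 * (j + 1))) ≤ (g : ℝ) * A.card := by
    have : ∀ j ∈ Finset.Icc 1 g, (A.card : ℝ) * ((M : ℝ) * T) ^ j * M *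
      ((T / (2 * M)) ^ (j + 1) * (z ^ 2 / T) ^ (2 * (j + 1))) ≤ A.card := by
      intro j hj
      have h1 : ((M : ℝ) * T) ^ j * M * ((T / (2 * M)) ^ (j + 1) * (z ^ 2 / T) ^ (2 * (j + 1))) =
          (z ^ 4 / 2) ^ (j + 1) / T := by
        have : ((M : ℝ) * T) ^ j * M = ((M : ℝ) * T) ^ (j + 1) / T := by
          rw [eq_div_iff hT0.ne']; ring
        rw [this, pow_mul, ← mul_pow, div_mul_eq_mul_div, ← mul_pow]
        congr 2
        field_simp
      have h2 : (z ^ 4 / 2) ^ (j + 1) ≤ T := by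
        rw [← hzT, pow_mul]
        calc (z ^ 4 / 2) ^ (j + 1) ≤ (z ^ 4) ^ (j + 1) := by
              gcongr
              exact div_le_self (by positivity) (by norm_num)
          _ ≤ (z ^ 4) ^ (g + 1) :=
              pow_le_pow_right₀ (one_le_pow₀ hz) (by have := (Finset.mem_Icc.mp hj).2; omega)
      calc _ = (A.card : ℝ) * ((z ^ 4 / 2) ^ (j + 1) / T) := by rw [← h1]; ring
        _ ≤ A.card * 1 := by
            gcongr
            rwa [div_le_one hT0]
        _ = A.card := mul_one _
    refine (Finset.sum_le_sum this).trans ?_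
    simp
  have hA' : (A.card : ℝ) ≤ e * z / M := by
    rw [le_div_iff₀ hM0]
    calc (A.card : ℝ) * M ≤ A.card * (D * z) := by gcongr
      _ = (A.card * D) * z := by ring
      _ ≤ e * z := by gcongr
  have hB' : t * (T / (2 * M) * B.card) ≤ t * e / (2 * M * c) := by
    rw [le_div_iff₀ (by positivity)]
    calc (t : ℝ) * (T / (2 * M) * B.card) * (2 * M * c) = t * (c * T * B.card) := by
          field_simp
      _ ≤ t * e := by gcongr
  have he0 : 0 ≤ e := Finset.sum_nonneg fun _ _ => by positivity
  have hM2 : (0 : ℝ) < 2 * M := by positivity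
  clear_value e
  calc _ ≤ (t : ℝ) * (A.card + T / (2 * M) * B.card) + g * A.card := by gcongr
    _ = (t + g) * A.card + t * (T / (2 * M) * B.card) := by ring
    _ ≤ (t + g) * (e * z / M) + t * e / (2 * M * c) := by gcongr
    _ = e / (2 * M) * (t / c + 2 * (t + g) * z) := by
        field_simp
        ring
    _ ≤ e / (2 * M) * z ^ 2 := by gcongr
    _ = z ^ 2 / T * (T / (2 * M)) * e := by field_simp

open Classical in
theorem exists_subgraph_of_complete_bipartite {V : Type*} [Fintype V] (G : SimpleGraph V)
    (t g : ℕ) (ht : 0 < t) (S T : Finset V) (hST : Disjoint S T)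
    (hS : S.card = (3 * t + 2 * g) ^ (4 * (g + 1)))
    (hT : T.card = (3 * t + 2 * g) ^ (4 * (g + 1))) (hadj : ∀ u ∈ S, ∀ v ∈ T, G.Adj u v) :
    ∃ H : G.Subgraph, (t : ℝ) ≤ subAvgDeg H ∧ (g : ℕ∞) ≤ H.coe.egirth := by
  have hk : 0 < (3 * t + 2 * g) ^ (4 * (g + 1)) := by positivity
  have ht' : (1 : ℝ) ≤ t := by exact_mod_cast ht
  have hz : (1 : ℝ) ≤ 3 * t + 2 * g := by
    have : (0 : ℝ) ≤ g := by positivity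
    linarith
  set k := (3 * t + 2 * g) ^ (4 * (g + 1)) with hkdef
  refine exists_subgraph_of_dense G t g T S hST.symm (Finset.card_pos.mp (by omega)) (fun _ => T)
    (fun _ _ => subset_rfl) hadj k k ?_ (fun _ _ => hT.le) (3 * t + 2 * g) k 1 hz ?_ (by omega)
    ?_ ?_ one_pos ?_ ?_
  · intro v _
    exact (Finset.card_filter_le _ _).trans hS.le
  · rw [hkdef]; push_cast; ring
  · simp [hS, hT]
  · nlinarith
  · simp [hS, hT]
  · have : (0 : ℝ) ≤ g := by positivity
    nlinarith

open Classical in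
theorem exists_subgraph_of_sparse_of_codegree_le {V : Type*} [Fintype V] (G : SimpleGraph V)
    (t g m : ℕ) (ht : 0 < t) (hm : 3 ≤ m)
    (A B : Finset V) (hAB : Disjoint A B) (hA : A.Nonempty) (F : V → Finset V)
    (hF : ∀ u ∈ B, F u ⊆ A) (hadj : ∀ u ∈ B, ∀ v ∈ F u, G.Adj u v) (M Γ : ℕ)
    (hM : ∀ v ∈ A, (B.filter fun u => v ∈ F u).card ≤ M) (hT : ∀ u ∈ B, (F u).card = 2 * t)
    (hΓ : ∀ v ∈ A, ∀ w ∈ A, v ≠ w → (B.filter fun u => v ∈ F u ∧ w ∈ F u).card ≤ Γ)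
    (y : ℝ) (hy : 4 ≤ y) (hyg : 4 * g * (8 * t) ^ g ≤ y)
    (hcard : A.card * y ^ m ≤ 2 * y ^ 2 * B.card) (hMy : M ≤ y ^ (m + 1))
    (hΓy : Γ * y ^ (3 * g + 3) ≤ y ^ m) :
    ∃ H : G.Subgraph, (t : ℝ) ≤ subAvgDeg H ∧ (g : ℕ∞) ≤ H.coe.egirth := by
  have hy0 : 0 < y := by linarith
  have hA0 : (0 : ℝ) < A.card := by exact_mod_cast hA.card_pos
  have hB0 : (0 : ℝ) < B.card := by
    by_contra h
    have h0 : (B.card : ℝ) = 0 := le_antisymm (not_lt.mp h) (by positivity)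
    rw [h0, mul_zero] at hcard
    have : 0 < A.card * y ^ m := by positivity
    linarith
  have ht1 : (1 : ℝ) ≤ t := by exact_mod_cast ht
  set q : ℝ := 2 * A.card / B.card with hq
  have hq0 : 0 ≤ q := by positivity
  have hqx : q * y ^ m ≤ 4 * y ^ 2 := by
    rw [hq, div_mul_eq_mul_div, div_le_iff₀ hB0]
    linarith
  have hq1 : q ≤ 1 := by
    have h1 : 4 * y ^ 2 ≤ y ^ m := calc
      4 * y ^ 2 ≤ y * y ^ 2 := by gcongr
      _ = y ^ 3 := by ring
      _ ≤ y ^ m := pow_le_pow_right₀ (by linarith) hm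
    by_contra h
    have h2 : 1 * y ^ m < q * y ^ m := by
      gcongr
      exact not_le.mp h
    linarith
  have hqB : q * B.card = 2 * A.card := by
    rw [hq]; field_simp
  refine exists_subgraph_of_sampling G t g A B hAB hA F hF hadj M (2 * t) Γ hM
    (fun u hu => (hT u hu).le) hΓ q 1 ⟨hq0, hq1⟩ ⟨zero_le_one, le_rfl⟩ ?_
  have hMq : M * q ≤ 4 * y ^ 3 := calc
    (M : ℝ) * q ≤ y ^ (m + 1) * q := by gcongr
    _ = y * (q * y ^ m) := by ring
    _ ≤ y * (4 * y ^ 2) := by gcongr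
    _ = 4 * y ^ 3 := by ring
  have hΓq : Γ * q * y ^ (3 * g + 1) ≤ 4 := by
    have : Γ * q * y ^ (3 * g + 1) * y ^ 2 ≤ 4 * y ^ 2 := calc
      Γ * q * y ^ (3 * g + 1) * y ^ 2 = q * (Γ * y ^ (3 * g + 3)) := by ring
      _ ≤ q * y ^ m := by gcongr
      _ ≤ 4 * y ^ 2 := hqx
    exact le_of_mul_le_mul_right this (by positivity)
  have hterm : ∀ j ∈ Finset.Icc 1 g, (A.card : ℝ) * ((M : ℝ) * (2 * t : ℕ)) ^ j * Γ *
      (q ^ (j + 1) * 1 ^ (2 * (j + 1))) ≤ A.card * (4 * (8 * t) ^ g / y) := by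
    intro j hj
    have h1 : ((M : ℝ) * (2 * t : ℕ)) ^ j * Γ * (q ^ (j + 1) * 1 ^ (2 * (j + 1))) =
        (M * q * (2 * t)) ^ j * (Γ * q) := by
      push_cast
      rw [one_pow, mul_one, mul_pow, mul_pow, mul_pow]
      ring
    have h2 : (M * q * (2 * t)) ^ j ≤ (8 * t * y ^ 3) ^ g := calc
      (M * q * (2 * t)) ^ j ≤ (4 * y ^ 3 * (2 * t)) ^ j := by gcongr
      _ = (8 * t * y ^ 3) ^ j := by congr 1; ring
      _ ≤ (8 * t * y ^ 3) ^ g := by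
        refine pow_le_pow_right₀ ?_ (Finset.mem_Icc.mp hj).2
        have : 1 ≤ y ^ 3 := one_le_pow₀ (by linarith)
        nlinarith
    have h3 : (M * q * (2 * t)) ^ j * (Γ * q) ≤ 4 * (8 * t) ^ g / y := by
      rw [le_div_iff₀ hy0]
      calc (M * q * (2 * t)) ^ j * (Γ * q) * y ≤ (8 * t * y ^ 3) ^ g * (Γ * q) * y := by gcongr
        _ = (8 * t) ^ g * (Γ * q * y ^ (3 * g + 1)) := by
            rw [mul_pow, ← pow_mul, pow_succ]; ring
        _ ≤ (8 * t) ^ g * 4 := by gcongr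
        _ = _ := by ring
    calc _ = (A.card : ℝ) * ((M * q * (2 * t)) ^ j * (Γ * q)) := by rw [← h1]; ring
      _ ≤ _ := by gcongr
  have hsum : ∑ j ∈ Finset.Icc 1 g, (A.card : ℝ) * ((M : ℝ) * (2 * t : ℕ)) ^ j * Γ *
      (q ^ (j + 1) * 1 ^ (2 * (j + 1))) ≤ A.card := by
    refine (Finset.sum_le_sum hterm).trans ?_
    simp only [Finset.sum_const, Nat.card_Icc, Nat.add_sub_cancel, nsmul_eq_mul]
    calc (g : ℝ) * (A.card * (4 * (8 * t) ^ g / y)) = A.card * (4 * g * (8 * t) ^ g / y) := by ring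
      _ ≤ A.card * 1 := by
          gcongr
          rwa [div_le_one hy0]
      _ = A.card := mul_one _
  have he : ∑ u ∈ B, ((F u).card : ℝ) = B.card * (2 * t) := by
    rw [Finset.sum_congr rfl fun u hu => by rw [hT u hu], Finset.sum_const, nsmul_eq_mul]
    push_cast
    ring
  rw [he]
  have : 1 * q * (B.card * (2 * t)) = 4 * t * A.card := by
    linear_combination 2 * t * hqB
  rw [this, hqB]
  nlinarith

theorem exists_independent_subset {α : Type*} (r : α → α → Prop) [DecidableRel r]
    (hr : ∀ v w, r v w → r w v) (k n : ℕ) (X : Finset α) (hX : n * k ≤ X.card) (hk : 0 < k)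
    (hdeg : ∀ v ∈ X, (X.filter (r v)).card < k) :
    ∃ Y ⊆ X, Y.card = n ∧ ∀ v ∈ Y, ∀ w ∈ Y, v ≠ w → ¬ r v w := by
  classical
  induction n generalizing X with
  | zero => exact ⟨∅, by simp, by simp, by simp⟩
  | succ n ih =>
    obtain ⟨x, hx⟩ : X.Nonempty := by
      rw [← Finset.card_pos]
      exact lt_of_lt_of_le (by positivity) hX
    set Z := (X.erase x).filter fun w => ¬ r x w with hZ
    have hZX : Z ⊆ X := (Finset.filter_subset _ _).trans (Finset.erase_subset _ _)
    have hcover : X ⊆ insert x (X.filter (r x)) ∪ Z := by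
      intro w hw
      simp only [hZ, Finset.mem_union, Finset.mem_insert, Finset.mem_filter, Finset.mem_erase]
      tauto
    have hZcard : n * k ≤ Z.card := by
      have h1 := (Finset.card_le_card hcover).trans (Finset.card_union_le _ _)
      have h2 := Finset.card_insert_le x (X.filter (r x))
      have h3 := hdeg x hx
      rw [add_mul] at hX
      omega
    obtain ⟨Y, hYZ, hY, hind⟩ := ih Z hZcard fun v hv =>
      lt_of_le_of_lt (Finset.card_le_card (Finset.filter_subset_filter _ hZX)) (hdeg v (hZX hv))
    have hxY : x ∉ Y := fun h => by simpa [hZ] using hYZ h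
    have hxr : ∀ w ∈ Y, ¬ r x w := fun w hw => (Finset.mem_filter.mp (hYZ hw)).2
    refine ⟨insert x Y, Finset.insert_subset hx (hYZ.trans hZX), ?_, ?_⟩
    · rw [Finset.card_insert_of_notMem hxY, hY]
    · intro v hv w hw hvw
      rcases Finset.mem_insert.mp hv with hvx | hvY <;>
        rcases Finset.mem_insert.mp hw with hwx | hwY
      · exact absurd (hvx.trans hwx.symm) hvw
      · exact hvx ▸ hxr w hwY
      · exact fun h => hxr v hvY (hwx ▸ hr v w h)
      · exact hind v hvY w hwY hvw

open Classical in
theorem sum_card_filter_mem_eq {V : Type*} (A B : Finset V) (F : V → Finset V)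
    (hF : ∀ u ∈ B, F u ⊆ A) :
    ∑ v ∈ A, (B.filter fun u => v ∈ F u).card = ∑ u ∈ B, (F u).card := by
  simp only [Finset.card_filter]
  rw [Finset.sum_comm]
  refine Finset.sum_congr rfl fun u hu => ?_
  rw [← Finset.card_filter]
  congr 1
  ext v
  simp only [Finset.mem_filter]
  exact ⟨fun h => h.2, fun h => ⟨hF u hu h, h⟩⟩

open Classical in
theorem card_filter_exists_le_of_kkkFree {V : Type*} (G : SimpleGraph V) {k : ℕ}
    (hfree : KkkFree G k) (A B : Finset V) (hAB : Disjoint A B) (F : V → Finset V)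
    (hF : ∀ u ∈ B, F u ⊆ A) (hadj : ∀ u ∈ B, ∀ v ∈ F u, G.Adj u v) (r : V → V → Prop) (h : ℝ)
    (hr : ∀ v ∈ A, ((A.filter (r v)).card : ℝ) ≤ h) :
    ((B.filter fun u => ∃ v ∈ F u, k ≤ ((F u).filter (r v)).card).card : ℝ) ≤
      A.card * (h ^ k * k) := by
  set bad := B.filter fun u => ∃ v ∈ F u, k ≤ ((F u).filter (r v)).card with hbad
  have hbadsub : bad ⊆ A.biUnion fun v => ((A.filter (r v)).powersetCard k).biUnion fun W =>
      B.filter fun u => W ⊆ F u := by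
    intro u hu
    obtain ⟨huB, v, hv, hc⟩ := Finset.mem_filter.mp hu
    obtain ⟨W, hW, hWk⟩ := Finset.exists_subset_card_eq hc
    simp only [Finset.mem_biUnion]
    refine ⟨v, hF u huB hv, W, ?_, ?_⟩
    · rw [Finset.mem_powersetCard]
      exact ⟨hW.trans (Finset.filter_subset_filter _ (hF u huB)), hWk⟩
    · exact Finset.mem_filter.mpr ⟨huB, hW.trans (Finset.filter_subset _ _)⟩
  have hfew : ∀ W : Finset V, W ⊆ A → W.card = k → (B.filter fun u => W ⊆ F u).card ≤ k := by
    intro W hWA hW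
    by_contra h
    obtain ⟨U, hU, hUk⟩ := Finset.exists_subset_card_eq (not_le.mp h).le
    refine hfree ⟨U, W, ?_, hUk, hW, ?_⟩
    · refine Finset.disjoint_of_subset_left (fun u hu => (Finset.mem_filter.mp (hU hu)).1)
        (Finset.disjoint_of_subset_right hWA hAB.symm)
    · intro u hu w hw
      have := Finset.mem_filter.mp (hU hu)
      exact hadj u this.1 w (this.2 hw)
  have h1 : (bad.card : ℝ) ≤ ∑ v ∈ A, ((A.filter (r v)).card : ℝ) ^ k * k := by
    have : bad.card ≤ ∑ v ∈ A, (A.filter (r v)).card ^ k * k := by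
      refine (Finset.card_le_card hbadsub).trans (Finset.card_biUnion_le.trans ?_)
      refine Finset.sum_le_sum fun v _ => Finset.card_biUnion_le.trans ?_
      calc _ ≤ ((A.filter (r v)).powersetCard k).card * k := by
            refine Finset.sum_le_card_nsmul _ _ _ fun W hW => ?_
            rw [Finset.mem_powersetCard] at hW
            exact hfew W (hW.1.trans (Finset.filter_subset _ _)) hW.2
        _ ≤ _ := by
            rw [Finset.card_powersetCard]
            exact Nat.mul_le_mul_right _ (Nat.choose_le_pow _ _)
    exact_mod_cast this
  refine h1.trans ?_
  rw [← nsmul_eq_mul]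
  refine Finset.sum_le_card_nsmul _ _ _ fun v hv => ?_
  have := hr v hv
  gcongr

open Classical in
theorem card_filter_mul_le {V : Type*} (A B : Finset V) (F : V → Finset V)
    (hF : ∀ u ∈ B, F u ⊆ A) (M d : ℕ) (hM : ∀ v ∈ A, (B.filter fun u => v ∈ F u).card ≤ M)
    (hd : ∀ u ∈ B, (F u).card ≤ d) (r : V → V → Prop) (a b : ℝ) (hb : 0 ≤ b)
    (hr : ∀ v w, r v w → a ≤ (B.filter fun u => v ∈ F u ∧ w ∈ F u).card * b) (v : V)
    (hv : v ∈ A) : ((A.filter (r v)).card : ℝ) * a ≤ M * d * b := by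
  have h1 : ∑ w ∈ A, (B.filter fun u => v ∈ F u ∧ w ∈ F u).card ≤ M * d := by
    have : ∑ w ∈ A, (B.filter fun u => v ∈ F u ∧ w ∈ F u).card =
        ∑ u ∈ B.filter fun u => v ∈ F u, (F u).card := by
      rw [← sum_card_filter_mem_eq A _ F fun u hu => hF u (Finset.mem_filter.mp hu).1]
      refine Finset.sum_congr rfl fun w _ => ?_
      rw [Finset.filter_filter]
    rw [this]
    refine (Finset.sum_le_card_nsmul _ _ d fun u hu => hd u (Finset.mem_filter.mp hu).1).trans ?_
    rw [smul_eq_mul]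
    exact Nat.mul_le_mul_right _ (hM v hv)
  calc ((A.filter (r v)).card : ℝ) * a = ∑ w ∈ A.filter (r v), a := by simp
    _ ≤ ∑ w ∈ A.filter (r v), (B.filter fun u => v ∈ F u ∧ w ∈ F u).card * b :=
        Finset.sum_le_sum fun w hw => hr v w (Finset.mem_filter.mp hw).2
    _ ≤ ∑ w ∈ A, (B.filter fun u => v ∈ F u ∧ w ∈ F u).card * b :=
        Finset.sum_le_sum_of_subset_of_nonneg (Finset.filter_subset _ _)
          fun _ _ _ => by positivity
    _ = (∑ w ∈ A, (B.filter fun u => v ∈ F u ∧ w ∈ F u).card : ℕ) * b := by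
        rw [← Finset.sum_mul]; push_cast; rfl
    _ ≤ (M * d : ℕ) * b := by gcongr
    _ = M * d * b := by push_cast; rfl

theorem two_mul_le_of_pow_bounds {y a b c d k x Y : ℝ} {n : ℕ} (hy : 4 ≤ y)
    (hk : 2 * k * d ^ n ≤ y) (hb : b ≤ a * ((d * x) ^ n * k)) (hY : Y = x ^ n * y ^ 4)
    (ha : a * Y ≤ 2 * y * c) (hc : 0 ≤ c) (haY : 0 ≤ a * Y) : 2 * b ≤ c := by
  have hy0 : 0 < y := by linarith
  have h2y : 2 ≤ y ^ 2 := by nlinarith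
  have : 2 * b * y ^ 4 ≤ c * y ^ 4 := by
    calc 2 * b * y ^ 4 ≤ 2 * (a * ((d * x) ^ n * k)) * y ^ 4 := by gcongr
      _ = (2 * k * d ^ n) * (a * Y) := by rw [hY, mul_pow]; ring
      _ ≤ y * (2 * y * c) := by gcongr
      _ = 2 * (c * y ^ 2) := by ring
      _ ≤ y ^ 2 * (c * y ^ 2) := by gcongr
      _ = _ := by ring
  exact le_of_mul_le_mul_right this (by positivity)

open Classical in
/-- The case where the degrees in `A` are a large power of those in `B`. -/
theorem exists_subgraph_of_sparse {V : Type*} [Fintype V] (G : SimpleGraph V)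
    (t g k m d : ℕ) (ht : 0 < t) (hk : 0 < k) (hd : d = 2 * t * k)
    (hm : m = 4 + (3 * g + 4) * k) (hfree : KkkFree G k)
    (A B : Finset V) (hAB : Disjoint A B) (hA : A.Nonempty) (F : V → Finset V)
    (hF : ∀ u ∈ B, F u ⊆ A) (hadj : ∀ u ∈ B, ∀ v ∈ F u, G.Adj u v) (M T : ℕ)
    (hM : ∀ v ∈ A, (B.filter fun u => v ∈ F u).card ≤ M) (hT : ∀ u ∈ B, (F u).card ≤ T)
    (y : ℝ) (hy : 4 ≤ y) (hyg : 4 * g * (8 * t) ^ g ≤ y) (hyd : 2 * k * d ^ k ≤ y) (hTy : T ≤ y)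
    (hdeg : ∀ v ∈ A, y ^ m ≤ ((B.filter fun u => v ∈ F u).card : ℝ))
    (hMy : M ≤ y ^ (m + 1)) (hsum : 2 * d * B.card ≤ ∑ u ∈ B, (F u).card) :
    ∃ H : G.Subgraph, (t : ℝ) ≤ subAvgDeg H ∧ (g : ℕ∞) ≤ H.coe.egirth := by
  have hy0 : 0 < y := by linarith
  set B₁ := B.filter fun u => d ≤ (F u).card with hB₁
  have hB₁B : B₁ ⊆ B := Finset.filter_subset _ _
  have hF₁ : ∀ u, ∃ X : Finset V, X ⊆ F u ∧ (u ∈ B₁ → X.card = d) := by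
    intro u
    by_cases hu : u ∈ B₁
    · obtain ⟨X, hX, hc⟩ := Finset.exists_subset_card_eq (Finset.mem_filter.mp hu).2
      exact ⟨X, hX, fun _ => hc⟩
    · exact ⟨∅, by simp, fun h => absurd h hu⟩
  choose F₁ hF₁F hF₁d using hF₁
  have hF₁A : ∀ u ∈ B₁, F₁ u ⊆ A := fun u hu => (hF₁F u).trans (hF u (hB₁B hu))
  have hcardB₁ : (A.card : ℝ) * y ^ m ≤ 2 * y * B₁.card := by
    have h1 : ∑ u ∈ B, (F u).card ≤ T * B₁.card + d * B.card := by
      rw [← Finset.sum_filter_add_sum_filter_not B fun u => d ≤ (F u).card]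
      refine add_le_add ?_ ?_
      · rw [mul_comm]
        exact Finset.sum_le_card_nsmul _ _ _ fun u hu => hT u (hB₁B hu)
      · calc _ ≤ (B.filter fun u => ¬ d ≤ (F u).card).card * d :=
              Finset.sum_le_card_nsmul _ _ _ fun u hu =>
                (not_le.mp (Finset.mem_filter.mp hu).2).le
          _ ≤ d * B.card := by
              rw [mul_comm]
              exact Nat.mul_le_mul_left _ (Finset.card_filter_le _ _)
    have h2 : ∑ u ∈ B, (F u).card ≤ 2 * T * B₁.card := by nlinarith
    calc (A.card : ℝ) * y ^ m = ∑ v ∈ A, y ^ m := by simp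
      _ ≤ ∑ v ∈ A, ((B.filter fun u => v ∈ F u).card : ℝ) := Finset.sum_le_sum hdeg
      _ = (∑ u ∈ B, (F u).card : ℕ) := by
          rw [← sum_card_filter_mem_eq A B F hF]
          push_cast
          rfl
      _ ≤ (2 * T * B₁.card : ℕ) := by exact_mod_cast h2
      _ ≤ 2 * y * B₁.card := by
          push_cast
          gcongr
  have hM₁ : ∀ v ∈ A, (B₁.filter fun u => v ∈ F₁ u).card ≤ M := fun v hv =>
    le_trans (Finset.card_le_card fun u hu => by
      simp only [Finset.mem_filter] at hu ⊢
      exact ⟨hB₁B hu.1, hF₁F u hu.2⟩) (hM v hv)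
  set co : V → V → ℕ := fun v w => (B₁.filter fun u => v ∈ F₁ u ∧ w ∈ F₁ u).card with hco
  have hcosymm : ∀ v w, co v w = co w v := by
    intro v w
    simp only [hco]
    congr 1
    ext u
    simp only [Finset.mem_filter]
    tauto
  set heavy : V → V → Prop := fun v w => y ^ m < co v w * y ^ (3 * g + 3) with hheavy
  have hheavysymm : ∀ v w, heavy v w → heavy w v := by
    intro v w h
    simp only [hheavy] at h ⊢
    rwa [hcosymm]
  have hH : ∀ v ∈ A, ((A.filter (heavy v)).card : ℝ) ≤ d * y ^ (3 * g + 4) := by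
    intro v hv
    have h2 := card_filter_mul_le A B₁ F₁ hF₁A M d hM₁ (fun u hu => (hF₁d u hu).le) heavy
      (y ^ m) (y ^ (3 * g + 3)) (by positivity) (fun v w h => h.le) v hv
    have h4 : ((A.filter (heavy v)).card : ℝ) * y ^ m ≤ d * y ^ (3 * g + 4) * y ^ m := by
      calc _ ≤ M * d * y ^ (3 * g + 3) := h2
        _ ≤ y ^ (m + 1) * d * y ^ (3 * g + 3) := by gcongr
        _ = _ := by ring
    exact le_of_mul_le_mul_right h4 (by positivity)
  set bad := B₁.filter fun u => ∃ v ∈ F₁ u, k ≤ ((F₁ u).filter (heavy v)).card with hbad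
  have hbadcard : (bad.card : ℝ) ≤ A.card * ((d * y ^ (3 * g + 4)) ^ k * k) :=
    card_filter_exists_le_of_kkkFree G hfree A B₁ (Finset.disjoint_of_subset_right hB₁B hAB) F₁ hF₁A
      (fun u hu v hv => hadj u (hB₁B hu) v (hF₁F u hv)) heavy _ hH
  have hbadhalf : 2 * (bad.card : ℝ) ≤ B₁.card := by
    have hym : y ^ m = (y ^ (3 * g + 4)) ^ k * y ^ 4 := by
      rw [hm, pow_add, pow_mul, mul_comm]
    exact two_mul_le_of_pow_bounds hy hyd hbadcard hym hcardB₁ (Nat.cast_nonneg _)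
      (mul_nonneg (Nat.cast_nonneg _) (by positivity))
  set B₂ := B₁ \ bad with hB₂
  have hB₂B₁ : B₂ ⊆ B₁ := Finset.sdiff_subset
  have hB₂card : (B₁.card : ℝ) ≤ 2 * B₂.card := by
    have : B₂.card + bad.card = B₁.card :=
      Finset.card_sdiff_add_card_eq_card (Finset.filter_subset _ _)
    have : (B₂.card : ℝ) + bad.card = B₁.card := by exact_mod_cast this
    linarith
  have hF₂ : ∀ u, ∃ Y ⊆ F₁ u, u ∈ B₂ →
      Y.card = 2 * t ∧ ∀ v ∈ Y, ∀ w ∈ Y, v ≠ w → ¬ heavy v w := by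
    intro u
    by_cases hu : u ∈ B₂
    · obtain ⟨hu₁, hub⟩ := Finset.mem_sdiff.mp hu
      obtain ⟨Y, hY, hc⟩ := exists_independent_subset heavy hheavysymm k (2 * t) (F₁ u)
        (by rw [hF₁d u hu₁, hd]) hk fun v hv => by
          by_contra h
          exact hub (Finset.mem_filter.mpr ⟨hu₁, v, hv, not_lt.mp h⟩)
      exact ⟨Y, hY, fun _ => hc⟩
    · exact ⟨∅, by simp, fun h => absurd h hu⟩
  choose F₂ hF₂F₁ hF₂ using hF₂
  have hmono : ∀ v w, (B₂.filter fun u => v ∈ F₂ u ∧ w ∈ F₂ u).card ≤ co v w := fun v w =>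
    Finset.card_le_card fun u hu => by
      simp only [Finset.mem_filter] at hu ⊢
      exact ⟨hB₂B₁ hu.1, hF₂F₁ u hu.2.1, hF₂F₁ u hu.2.2⟩
  refine exists_subgraph_of_sparse_of_codegree_le G t g m ht (by omega) A B₂
    (Finset.disjoint_of_subset_right (hB₂B₁.trans hB₁B) hAB) hA F₂
    (fun u hu => (hF₂F₁ u).trans (hF₁A u (hB₂B₁ hu)))
    (fun u hu v hv => hadj u (hB₁B (hB₂B₁ hu)) v (hF₁F u (hF₂F₁ u hv))) M
    ⌊y ^ m / y ^ (3 * g + 3)⌋₊ (fun v hv => ?_) (fun u hu => (hF₂ u hu).1) (fun v _ w _ hvw => ?_)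
    y hy hyg ?_ hMy ?_
  · refine le_trans (Finset.card_le_card fun u hu => ?_) (hM₁ v hv)
    simp only [Finset.mem_filter] at hu ⊢
    exact ⟨hB₂B₁ hu.1, hF₂F₁ u hu.2⟩
  · rcases Finset.eq_empty_or_nonempty (B₂.filter fun u => v ∈ F₂ u ∧ w ∈ F₂ u) with h | ⟨u, hu⟩
    · rw [h]; simp
    · obtain ⟨hu₂, hv, hw⟩ := Finset.mem_filter.mp hu
      have h := (hF₂ u hu₂).2 v hv w hw hvw
      refine (hmono v w).trans (Nat.le_floor ?_)
      rw [le_div_iff₀ (by positivity)]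
      exact not_lt.mp h
  · have hB₂0 : (0 : ℝ) ≤ B₂.card := Nat.cast_nonneg _
    generalize (B₂.card : ℝ) = b at hB₂0 hB₂card ⊢
    calc (A.card : ℝ) * y ^ m ≤ 2 * y * B₁.card := hcardB₁
      _ ≤ 2 * y * (2 * b) := by gcongr
      _ = 2 * (y * 2) * b := by ring
      _ ≤ 2 * (y * y) * b := by gcongr; linarith
      _ = _ := by ring
  · rw [← le_div_iff₀ (by positivity)]
    exact Nat.floor_le (by positivity)

open Classical in
theorem card_filter_adj_eq {V : Type*} [Fintype V] (G : SimpleGraph V) :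
    (Finset.univ.filter fun e : V × V => G.Adj e.1 e.2).card = 2 * edgeCount G := by
  rw [edgeCount, ← SimpleGraph.coe_edgeFinset, Set.ncard_coe_finset,
    ← G.sum_degrees_eq_twice_card_edges, ← Finset.univ_product_univ, Finset.card_filter,
    Finset.sum_product]
  refine Finset.sum_congr rfl fun v _ => ?_
  rw [← Finset.card_filter, ← SimpleGraph.card_neighborFinset_eq_degree]
  congr 1
  ext w
  simp

open Classical in
theorem exists_cut {V : Type*} [Fintype V] (E : Finset (V × V)) (hE : ∀ e ∈ E, e.1 ≠ e.2) :
    ∃ S : Finset V, E.card ≤ 4 * (E.filter fun e => e.1 ∈ S ∧ e.2 ∉ S).card := by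
  obtain ⟨S, hS⟩ := exists_finset_multilinear_le (E.disjSum E)
    (Sum.elim (fun _ => (1 : ℝ)) fun _ => -1) (Sum.elim (fun e => {e.1}) fun e => {e.1, e.2})
    (fun _ : V => 1 / 2) (fun _ => by norm_num)
  refine ⟨S, ?_⟩
  rw [Finset.sum_disjSum, Finset.sum_disjSum, ← Finset.sum_add_distrib,
    ← Finset.sum_add_distrib] at hS
  have h1 : ∀ e ∈ E, (1 / 4 : ℝ) = Sum.elim (fun _ => (1 : ℝ)) (fun _ => -1)
      (Sum.inl e : (V × V) ⊕ (V × V)) *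
      ∏ i ∈ (Sum.elim (fun e => {e.1}) fun e => {e.1, e.2}) (Sum.inl e : (V × V) ⊕ (V × V)),
        (1 / 2 : ℝ) + Sum.elim (fun _ => (1 : ℝ)) (fun _ => -1)
      (Sum.inr e : (V × V) ⊕ (V × V)) *
      ∏ i ∈ (Sum.elim (fun e => {e.1}) fun e => ({e.1, e.2} : Finset V))
        (Sum.inr e : (V × V) ⊕ (V × V)), (1 / 2 : ℝ) := by
    intro e he
    simp only [Sum.elim_inl, Sum.elim_inr, Finset.prod_const, Finset.card_singleton,
      Finset.card_pair (hE e he)]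
    norm_num
  rw [← Finset.sum_congr rfl h1] at hS
  have h2 : ∀ e ∈ E, Sum.elim (fun _ => (1 : ℝ)) (fun _ => -1)
      (Sum.inl e : (V × V) ⊕ (V × V)) *
      (if (Sum.elim (fun e => {e.1}) fun e => {e.1, e.2}) (Sum.inl e : (V × V) ⊕ (V × V)) ⊆ S
        then 1 else 0) + Sum.elim (fun _ => (1 : ℝ)) (fun _ => -1)
      (Sum.inr e : (V × V) ⊕ (V × V)) *
      (if (Sum.elim (fun e => {e.1}) fun e => {e.1, e.2}) (Sum.inr e : (V × V) ⊕ (V × V)) ⊆ S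
        then 1 else 0) = if e.1 ∈ S ∧ e.2 ∉ S then (1 : ℝ) else 0 := by
    intro e _
    by_cases h1 : e.1 ∈ S <;> by_cases h2 : e.2 ∈ S <;>
      simp [h1, h2, Finset.insert_subset_iff]
  rw [Finset.sum_congr rfl h2, Finset.sum_boole, Finset.sum_const, nsmul_eq_mul] at hS
  have : (E.card : ℝ) ≤ 4 * (E.filter fun e => e.1 ∈ S ∧ e.2 ∉ S).card := by linarith
  exact_mod_cast this

/-- The number of edges of `G` between `X` and `Y`. -/
noncomputable def edgesBetween {V : Type*} (G : SimpleGraph V) (X Y : Finset V) : ℕ :=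
  open Classical in ∑ x ∈ X, (Y.filter (G.Adj x)).card

theorem edgesBetween_comm {V : Type*} (G : SimpleGraph V) (X Y : Finset V) :
    edgesBetween G X Y = edgesBetween G Y X := by
  classical
  simp only [edgesBetween, Finset.card_filter]
  rw [Finset.sum_comm]
  simp only [G.adj_comm]

open Classical in
theorem exists_bipartite_minDegree {V : Type*} [Fintype V] (G : SimpleGraph V) (T : ℕ)
    (h : 4 * T < avgDeg G) :
    ∃ A B : Finset V, Disjoint A B ∧ A.Nonempty ∧ A.card ≤ B.card ∧
      ∀ u ∈ B, T ≤ (A.filter (G.Adj u)).card := by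
  obtain ⟨S, hS⟩ := exists_cut (Finset.univ.filter fun e : V × V => G.Adj e.1 e.2)
    fun e he => (Finset.mem_filter.mp he).2.ne
  have hcut : (((Finset.univ.filter fun e : V × V => G.Adj e.1 e.2).filter
      fun e => e.1 ∈ S ∧ e.2 ∉ S).card) = edgesBetween G S Sᶜ := by
    rw [edgesBetween, ← Finset.card_sigma]
    refine Finset.card_bij' (fun e _ => (⟨e.1, e.2⟩ : Σ _ : V, V)) (fun e _ => (e.1, e.2))
      ?_ ?_ (by simp) (by simp)
    · intro e he
      simp only [Finset.mem_filter, Finset.mem_univ, true_and] at he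
      simp [he]
    · intro e he
      simp only [Finset.mem_sigma, Finset.mem_filter, Finset.mem_compl] at he
      simp [he]
  rw [hcut, card_filter_adj_eq] at hS
  have hcard : S.card + Sᶜ.card = Fintype.card V := Finset.card_add_card_compl S
  have hbig : T * (S.card + Sᶜ.card) < edgesBetween G S Sᶜ := by
    rw [hcard]
    rcases Nat.eq_zero_or_pos (Fintype.card V) with h0 | h0
    · rw [avgDeg, h0, Nat.cast_zero, div_zero] at h
      exact absurd h (not_lt.mpr (by positivity))
    · rw [avgDeg, lt_div_iff₀ (by exact_mod_cast h0)] at h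
      have : 4 * T * Fintype.card V < 2 * edgeCount G := by exact_mod_cast h
      nlinarith
  let φ : Finset V × Finset V → ℤ := fun P =>
    (edgesBetween G P.1 P.2 : ℤ) - T * (P.1.card + P.2.card)
  obtain ⟨P, hP, hmax⟩ := Finset.exists_max_image
    (Finset.univ.filter fun P : Finset V × Finset V => Disjoint P.1 P.2) φ
    ⟨(S, Sᶜ), by simpa using disjoint_compl_right⟩
  have hdisj : Disjoint P.1 P.2 := (Finset.mem_filter.mp hP).2
  have hpos : T * (P.1.card + P.2.card) < edgesBetween G P.1 P.2 := by
    have h1 := hmax (S, Sᶜ) (by simpa using disjoint_compl_right)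
    simp only [φ] at h1
    zify at hbig ⊢
    linarith
  have key : ∀ X Y : Finset V, Disjoint X Y →
      (∀ X' Y', Disjoint X' Y' → φ (X', Y') ≤ φ (X, Y)) →
      ∀ x ∈ X, T ≤ (Y.filter (G.Adj x)).card := by
    intro X Y hXY hm x hx
    have h1 := hm (X.erase x) Y (Finset.disjoint_of_subset_left (Finset.erase_subset _ _) hXY)
    have h2 := Finset.card_erase_add_one hx
    have h3 : edgesBetween G (X.erase x) Y + (Y.filter (G.Adj x)).card = edgesBetween G X Y :=
      Finset.sum_erase_add _ _ hx
    simp only [φ, ← h3, ← h2] at h1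
    push_cast at h1
    zify
    nlinarith
  have hsymm : ∀ X Y, φ (X, Y) = φ (Y, X) := by
    intro X Y
    simp only [φ]
    rw [edgesBetween_comm, add_comm (X.card : ℤ)]
  have hm : ∀ X' Y', Disjoint X' Y' → φ (X', Y') ≤ φ (P.1, P.2) := fun X' Y' h =>
    hmax (X', Y') (by simpa using h)
  have hne : ∀ X Y : Finset V, T * (X.card + Y.card) < edgesBetween G X Y → X.Nonempty := by
    intro X Y h
    rw [Finset.nonempty_iff_ne_empty]
    rintro rfl
    simp [edgesBetween] at h
  rcases le_total P.1.card P.2.card with hle | hle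
  · exact ⟨P.1, P.2, hdisj, hne _ _ hpos, hle, key P.2 P.1 hdisj.symm fun X' Y' h => by
      rw [hsymm P.2 P.1]; exact hm X' Y' h⟩
  · exact ⟨P.2, P.1, hdisj.symm, hne P.2 P.1 (by rw [add_comm, edgesBetween_comm]; exact hpos),
      hle, key P.1 P.2 hdisj hm⟩

theorem exists_rpow_band {R η d L : ℝ} (hR : 2 ≤ R) (hη : 1 < η) (hd : R ≤ d) (hdL : d ≤ L) :
    ∃ n : ℕ, n ≤ Real.logb 2 (Real.logb 2 L) / Real.logb 2 η ∧ R ^ η ^ n ≤ d ∧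
      d ≤ R ^ η ^ (n + 1) := by
  have hR1 : 1 < R := by linarith
  have hd0 : 0 < d := by linarith
  have hx : 1 ≤ Real.logb R d := by
    rw [Real.le_logb_iff_rpow_le hR1 hd0, Real.rpow_one]
    exact hd
  obtain ⟨n, hn, hn'⟩ := exists_nat_pow_near hx hη
  refine ⟨n, ?_, ?_, ?_⟩
  · rw [le_div_iff₀ (Real.logb_pos one_lt_two hη)]
    have h1 : Real.logb R d ≤ Real.logb 2 L := by
      have h2 : Real.logb 2 R * Real.logb R d = Real.logb 2 d :=
        Real.mul_logb (by linarith) (by linarith) (by linarith)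
      have h3 : 1 ≤ Real.logb 2 R := by
        rw [Real.le_logb_iff_rpow_le one_lt_two (by linarith), Real.rpow_one]
        exact hR
      have h4 : Real.logb 2 d ≤ Real.logb 2 L := Real.logb_le_logb_of_le one_lt_two hd0 hdL
      nlinarith
    calc n * Real.logb 2 η = Real.logb 2 (η ^ n) := by rw [Real.logb_pow]
      _ ≤ Real.logb 2 (Real.logb 2 L) :=
          Real.logb_le_logb_of_le one_lt_two (by positivity) (hn.trans h1)
  · rwa [← Real.le_logb_iff_rpow_le hR1 hd0]
  · exact ((Real.logb_lt_iff_lt_rpow hR1 hd0).mp hn').le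

open Classical in
theorem exists_band {V : Type*} (A B : Finset V) (hA : A.Nonempty) (hAB : A.card ≤ B.card)
    (F : V → Finset V) (hF : ∀ u ∈ B, F u ⊆ A) (T : ℕ) (hT0 : 0 < T)
    (hT : ∀ u ∈ B, (F u).card = T) (N N₁ : ℕ) (D : ℕ → ℝ)
    (hD : ∀ v ∈ A, (T / 2 : ℝ) ≤ (B.filter fun u => v ∈ F u).card → ∃ n < N,
      D n ≤ (B.filter fun u => v ∈ F u).card ∧ (B.filter fun u => v ∈ F u).card ≤ D (n + 1)) :
    ∃ n < N, ∃ A' ⊆ A, A'.Nonempty ∧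
      (∀ v ∈ A', D n ≤ (B.filter fun u => v ∈ F u).card ∧
        (B.filter fun u => v ∈ F u).card ≤ D (n + 1)) ∧
      (if n ≤ N₁ then T * B.card / (4 * (N₁ + 1)) else T * B.card / (4 * N) : ℝ) ≤
        ∑ v ∈ A', ((B.filter fun u => v ∈ F u).card : ℝ) := by
  set δ : V → ℕ := fun v => (B.filter fun u => v ∈ F u).card with hδ
  have hB0 : 0 < B.card := hA.card_pos.trans_le hAB
  have hTB : (0 : ℝ) < T * B.card := by
    exact_mod_cast Nat.mul_pos hT0 hB0
  have hsum : ∑ v ∈ A, (δ v : ℝ) = T * B.card := by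
    have h1 : ∑ v ∈ A, δ v = ∑ u ∈ B, (F u).card := sum_card_filter_mem_eq A B F hF
    rw [Finset.sum_congr rfl hT, Finset.sum_const, smul_eq_mul, mul_comm] at h1
    exact_mod_cast h1
  set A₀ := A.filter fun v => (T / 2 : ℝ) ≤ δ v with hA₀
  have hsum₀ : (T * B.card / 2 : ℝ) ≤ ∑ v ∈ A₀, (δ v : ℝ) := by
    have h1 := Finset.sum_filter_add_sum_filter_not A (fun v => (T / 2 : ℝ) ≤ δ v)
      (fun v => (δ v : ℝ))
    have h2 : ∑ v ∈ A.filter (fun v => ¬ (T / 2 : ℝ) ≤ δ v), (δ v : ℝ) ≤ T * B.card / 2 := by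
      calc _ ≤ (A.filter (fun v => ¬ (T / 2 : ℝ) ≤ δ v)).card • (T / 2 : ℝ) :=
            Finset.sum_le_card_nsmul _ _ _ fun v hv =>
              (not_le.mp (Finset.mem_filter.mp hv).2).le
        _ ≤ B.card • (T / 2 : ℝ) :=
            nsmul_le_nsmul_left (by positivity) ((Finset.card_filter_le _ _).trans hAB)
        _ = _ := by rw [nsmul_eq_mul]; ring
    linarith
  have hb : ∀ v, ∃ n, v ∈ A₀ → n < N ∧ D n ≤ δ v ∧ δ v ≤ D (n + 1) := by
    intro v
    by_cases hv : v ∈ A₀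
    · obtain ⟨n, hn⟩ := hD v (Finset.mem_filter.mp hv).1 (Finset.mem_filter.mp hv).2
      exact ⟨n, fun _ => hn⟩
    · exact ⟨0, fun h => absurd h hv⟩
  choose b hb using hb
  have hfib : ∑ n ∈ Finset.range N, ∑ v ∈ A₀.filter (fun v => b v = n), (δ v : ℝ) =
      ∑ v ∈ A₀, (δ v : ℝ) :=
    Finset.sum_fiberwise_of_maps_to (fun v hv => Finset.mem_range.mpr (hb v hv).1) _
  have hN : 0 < N := by
    rw [Nat.pos_iff_ne_zero]
    rintro rfl
    rw [Finset.range_zero, Finset.sum_empty] at hfib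
    linarith
  have hN' : (0 : ℝ) < N := by exact_mod_cast hN
  have hthr : ∑ n ∈ Finset.range N,
      (if n ≤ N₁ then T * B.card / (4 * (N₁ + 1)) else T * B.card / (4 * N) : ℝ) ≤
      T * B.card / 2 := by
    calc _ ≤ ∑ n ∈ Finset.range N, ((if n ≤ N₁ then (T * B.card / (4 * (N₁ + 1)) : ℝ) else 0) +
            (T * B.card / (4 * N) : ℝ)) := by
          refine Finset.sum_le_sum fun n _ => ?_
          have : (0 : ℝ) ≤ T * B.card / (4 * N) := by positivity
          split_ifs <;> linarith
      _ = ((Finset.range N).filter fun n => n ≤ N₁).card * (T * B.card / (4 * (N₁ + 1)) : ℝ) +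
            N * (T * B.card / (4 * N)) := by
          rw [Finset.sum_add_distrib, ← Finset.sum_filter, Finset.sum_const, Finset.sum_const,
            nsmul_eq_mul, nsmul_eq_mul, Finset.card_range]
      _ ≤ (N₁ + 1 : ℕ) * (T * B.card / (4 * (N₁ + 1)) : ℝ) + N * (T * B.card / (4 * N)) := by
          gcongr
          rw [← Finset.card_range (N₁ + 1)]
          refine Finset.card_le_card fun n hn => ?_
          rw [Finset.mem_range]
          have := (Finset.mem_filter.mp hn).2
          omega
      _ = _ := by
          push_cast
          field_simp
          norm_num
  obtain ⟨n, hn, hle⟩ := Finset.exists_le_of_sum_le ⟨0, Finset.mem_range.mpr hN⟩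
    (hthr.trans (hsum₀.trans hfib.ge))
  refine ⟨n, Finset.mem_range.mp hn, A₀.filter fun v => b v = n,
    (Finset.filter_subset _ _).trans (Finset.filter_subset _ _), ?_, ?_, hle⟩
  · rw [Finset.nonempty_iff_ne_empty]
    intro h
    rw [h, Finset.sum_empty] at hle
    have : (0 : ℝ) < if n ≤ N₁ then (T * B.card / (4 * (N₁ + 1)) : ℝ) else T * B.card / (4 * N) := by
      split_ifs <;> positivity
    linarith
  · intro v hv
    obtain ⟨hv₀, rfl⟩ := Finset.mem_filter.mp hv
    exact (hb v hv₀).2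

theorem rpow_mul_le_of_le {R x ε s T : ℝ} (hR : 1 ≤ R) (hRT : R ≤ T) (hxs : x * ε ≤ s)
    (hs : 0 ≤ x * ε) : R ^ (x * (1 + ε)) ≤ R ^ x * T ^ s := by
  have hR0 : 0 < R := by linarith
  calc R ^ (x * (1 + ε)) = R ^ x * R ^ (x * ε) := by
        rw [← Real.rpow_add hR0]; congr 1; ring
    _ ≤ R ^ x * T ^ (x * ε) := by gcongr
    _ ≤ R ^ x * T ^ s := by
        gcongr
        linarith

open Classical in
theorem exists_subgraph_of_kkkFree {V : Type*} [Fintype V] (G : SimpleGraph V)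
    (t g k m d : ℕ) (ht : 0 < t) (hk : 0 < k) (hd : d = 2 * t * k)
    (hm : m = 4 + (3 * g + 4) * k) (hfree : KkkFree G k)
    (A B : Finset V) (hAB : Disjoint A B) (hA : A.Nonempty) (hcard : A.card ≤ B.card)
    (F : V → Finset V) (hF : ∀ u ∈ B, F u ⊆ A) (hadj : ∀ u ∈ B, ∀ v ∈ F u, G.Adj u v) (T : ℕ)
    (hT : ∀ u ∈ B, (F u).card = T) (Δ : ℕ) (hΔ : ∀ v ∈ A, (B.filter fun u => v ∈ F u).card ≤ Δ)
    (η : ℝ) (hη : η = 1 + 1 / (8 * (g + 1) * m)) (N N₁ : ℕ) (hN₁ : η ^ N₁ ≤ 2 * m)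
    (hN₁' : 2 * m < η ^ (N₁ + 1))
    (hN : Real.logb 2 (Real.logb 2 Δ) / Real.logb 2 η < N) (hT4 : 4 ≤ T)
    (hTd : (4 * t * (N₁ + 1) + 2 * (t + g)) ^ (4 * (g + 1)) ≤ T)
    (hTg : 4 * g * (8 * t) ^ g ≤ T) (hTk : 2 * k * d ^ k ≤ T) (hTN : 8 * d * N ≤ T) :
    ∃ H : G.Subgraph, (t : ℝ) ≤ subAvgDeg H ∧ (g : ℕ∞) ≤ H.coe.egirth := by
  have hT4' : (4 : ℝ) ≤ T := by exact_mod_cast hT4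
  have hm0 : (0 : ℝ) < m := by
    have : 0 < m := by omega
    exact_mod_cast this
  have hη1 : 1 < η := by
    rw [hη]
    have : (0 : ℝ) < 1 / (8 * (g + 1) * m) := by positivity
    linarith
  have hR : (2 : ℝ) ≤ T / 2 := by linarith
  have hR0 : (0 : ℝ) < T / 2 := by linarith
  obtain ⟨n, hnN, A', hA'A, hA', hdeg, hsum⟩ := exists_band A B hA hcard F hF T (by omega) hT N N₁
    (fun n => (T / 2 : ℝ) ^ η ^ n) (fun v hv hTv => by
      obtain ⟨n, hn, h1, h2⟩ := exists_rpow_band hR hη1 hTv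
        (by exact_mod_cast hΔ v hv : ((B.filter fun u => v ∈ F u).card : ℝ) ≤ Δ)
      exact ⟨n, by exact_mod_cast hn.trans_lt hN, h1, h2⟩)
  have hF'A' : ∀ u ∈ B, F u ∩ A' ⊆ A' := fun u _ => Finset.inter_subset_right
  have hfilter : ∀ v ∈ A', (B.filter fun u => v ∈ F u ∩ A') = B.filter fun u => v ∈ F u :=
    fun v hv => Finset.filter_congr fun u _ => by simp [hv]
  have hsum' : ∑ v ∈ A', (B.filter fun u => v ∈ F u).card = ∑ u ∈ B, (F u ∩ A').card := by
    rw [← sum_card_filter_mem_eq A' B (fun u => F u ∩ A') hF'A']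
    exact Finset.sum_congr rfl fun v hv => by rw [hfilter v hv]
  have hsum'' : ∑ v ∈ A', ((B.filter fun u => v ∈ F u).card : ℝ) =
      ∑ u ∈ B, ((F u ∩ A').card : ℝ) := by exact_mod_cast hsum'
  rw [hsum''] at hsum
  set D : ℝ := (T / 2 : ℝ) ^ η ^ n with hD
  set M : ℕ := ⌊(T / 2 : ℝ) ^ η ^ (n + 1)⌋₊ with hM
  have hMle : (M : ℝ) ≤ (T / 2 : ℝ) ^ η ^ (n + 1) := Nat.floor_le (Real.rpow_nonneg hR0.le _)
  have hMdeg : ∀ v ∈ A', (B.filter fun u => v ∈ F u ∩ A').card ≤ M := fun v hv => by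
    rw [hfilter v hv]
    exact Nat.le_floor (hdeg v hv).2
  have hDdeg : ∀ v ∈ A', D ≤ ((B.filter fun u => v ∈ F u ∩ A').card : ℝ) := fun v hv => by
    rw [hfilter v hv]
    exact (hdeg v hv).1
  have hF'T : ∀ u ∈ B, (F u ∩ A').card ≤ T := fun u hu =>
    (Finset.card_le_card Finset.inter_subset_left).trans (hT u hu).le
  have hdisj : Disjoint A' B := Finset.disjoint_of_subset_left hA'A hAB
  have hadj' : ∀ u ∈ B, ∀ v ∈ F u ∩ A', G.Adj u v := fun u hu v hv =>
    hadj u hu v (Finset.mem_inter.mp hv).1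
  have hηn : η ^ (n + 1) = η ^ n * (1 + 1 / (8 * (g + 1) * m)) := by rw [pow_succ, ← hη]
  have hηn1 : 1 ≤ η ^ n := one_le_pow₀ hη1.le
  split_ifs at hsum with hn
  · set z : ℝ := (T : ℝ) ^ (1 / (4 * (g + 1)) : ℝ) with hz
    have hzT : z ^ (4 * (g + 1)) = T := by
      rw [hz, ← Real.rpow_natCast, ← Real.rpow_mul (by positivity)]
      push_cast
      rw [one_div_mul_cancel (by positivity), Real.rpow_one]
    have hz0 : 0 ≤ z := by positivity
    have hzbig : 4 * t * (N₁ + 1) + 2 * (t + g) ≤ z := by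
      have h1 : (4 * t * (N₁ + 1) + 2 * (t + g) : ℝ) ^ (4 * (g + 1)) ≤ z ^ (4 * (g + 1)) := by
        rw [hzT]
        exact_mod_cast hTd
      exact le_of_pow_le_pow_left₀ (by omega) hz0 h1
    have ht1 : (1 : ℝ) ≤ t := by exact_mod_cast ht
    have hz1 : 1 ≤ z := by
      rw [hz]
      exact Real.one_le_rpow (by linarith) (by positivity)
    have hMD : (M : ℝ) ≤ D * z := by
      refine hMle.trans ?_
      rw [hηn]
      refine rpow_mul_le_of_le (by linarith) (by linarith) ?_ (by positivity)
      have : η ^ n ≤ 2 * m := (pow_le_pow_right₀ hη1.le hn).trans hN₁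
      calc η ^ n * (1 / (8 * (g + 1) * m)) ≤ 2 * m * (1 / (8 * (g + 1) * m)) := by gcongr
        _ = 1 / (4 * (g + 1)) := by field_simp; norm_num
    refine exists_subgraph_of_dense G t g A' B hdisj hA' (fun u => F u ∩ A') hF'A' hadj' M T hMdeg
      hF'T z D (1 / (4 * (N₁ + 1))) hz1 hzT ?_ ?_ hMD (by positivity) ?_ ?_
    · obtain ⟨v, hv⟩ := hA'
      have h1 : (D : ℝ) ≤ M := (hDdeg v hv).trans (by exact_mod_cast hMdeg v hv)
      have h2 : (T / 2 : ℝ) ≤ D := by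
        rw [hD]
        exact Real.self_le_rpow_of_one_le (by linarith) hηn1
      have : (T : ℝ) ≤ 2 * M := by linarith
      exact_mod_cast this
    · rw [← hsum'', ← nsmul_eq_mul]
      exact Finset.card_nsmul_le_sum _ _ _ fun v hv => (hdeg v hv).1
    · calc _ = (T * B.card / (4 * (N₁ + 1)) : ℝ) := by ring
        _ ≤ _ := hsum
    · rw [div_div_eq_mul_div, div_one]
      have hN₁0 : (0 : ℝ) ≤ 4 * t * (N₁ + 1) := by positivity
      calc (t : ℝ) * (4 * (N₁ + 1)) + 2 * (t + g) * z
          ≤ (t : ℝ) * (4 * (N₁ + 1)) * z + 2 * (t + g) * z :=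
            add_le_add (le_mul_of_one_le_right (by positivity) hz1) le_rfl
        _ = (4 * t * (N₁ + 1) + 2 * (t + g)) * z := by ring
        _ ≤ z * z := by gcongr
        _ = z ^ 2 := by ring
  · have hηm : 2 * m ≤ η ^ n :=
      hN₁'.le.trans (pow_le_pow_right₀ hη1.le (by omega))
    set y : ℝ := (T / 2 : ℝ) ^ (η ^ n / m) with hy
    have hym : y ^ m = D := by
      rw [hy, ← Real.rpow_natCast, ← Real.rpow_mul hR0.le, div_mul_cancel₀ _ hm0.ne']
    have hyT : (T : ℝ) ≤ y := by
      calc (T : ℝ) ≤ (T / 2) ^ 2 := by nlinarith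
        _ = (T / 2 : ℝ) ^ (2 : ℝ) := by rw [← Real.rpow_natCast]; norm_num
        _ ≤ y := by
            refine Real.rpow_le_rpow_of_exponent_le (by linarith) ?_
            rw [le_div_iff₀ hm0]
            exact hηm
    refine exists_subgraph_of_sparse G t g k m d ht hk hd hm hfree A' B hdisj hA'
      (fun u => F u ∩ A') hF'A' hadj' M T hMdeg hF'T y (hT4'.trans hyT)
      (le_trans (by exact_mod_cast hTg) hyT) (le_trans (by exact_mod_cast hTk) hyT) hyT
      (by rw [hym]; exact hDdeg) ?_ ?_
    · refine hMle.trans ?_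
      rw [hηn, pow_succ y m, hym, hy, hD, ← Real.rpow_add hR0]
      refine Real.rpow_le_rpow_of_exponent_le (by linarith) ?_
      rw [mul_add, mul_one, div_eq_mul_one_div (η ^ n) (m : ℝ)]
      gcongr
      have : (0 : ℝ) ≤ g := by positivity
      nlinarith
    · have hN0 : (0 : ℝ) < N := by
        have : 0 < N := by omega
        exact_mod_cast this
      have h1 : (2 * d * B.card : ℝ) ≤ T * B.card / (4 * N) := by
        rw [le_div_iff₀ (by positivity)]
        have : (8 * d * N : ℝ) ≤ T := by exact_mod_cast hTN
        calc (2 * d * B.card * (4 * N) : ℝ) = 8 * d * N * B.card := by ring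
          _ ≤ T * B.card := by gcongr
      exact_mod_cast h1.trans hsum

/-- Towards Thomassen's conjecture: for all `t, g` there is `C = C(t,g)` such that every
graph with maximum degree `Δ ≥ 4` and average degree at least `C·log₂ log₂ Δ` contains a
subgraph with average degree at least `t` and girth at least `g` (no cycle of length
less than `g`). -/
theorem large_girth_large_average_degree (t g : ℕ) (ht : 0 < t) (hg : 0 < g) :
    ∃ C : ℝ, ∀ (V : Type) [Fintype V] (G : SimpleGraph V) (Δ : ℕ),
      4 ≤ Δ → (∀ v, deg G v ≤ Δ) →
      C * Real.logb 2 (Real.logb 2 (Δ : ℝ)) ≤ avgDeg G →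
      ∃ H : G.Subgraph, (t : ℝ) ≤ subAvgDeg H ∧ (g : ℕ∞) ≤ H.coe.egirth := by
  classical
  obtain ⟨k, hk⟩ : ∃ k, k = (3 * t + 2 * g) ^ (4 * (g + 1)) := ⟨_, rfl⟩
  obtain ⟨d, hd⟩ : ∃ d, d = 2 * t * k := ⟨_, rfl⟩
  obtain ⟨m, hm⟩ : ∃ m, m = 4 + (3 * g + 4) * k := ⟨_, rfl⟩
  obtain ⟨η, hη⟩ : ∃ η : ℝ, η = 1 + 1 / (8 * (g + 1) * m) := ⟨_, rfl⟩
  have hk0 : 0 < k := hk ▸ pow_pos (by omega) _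
  have hm1 : (1 : ℝ) ≤ m := by
    have : 1 ≤ m := by omega
    exact_mod_cast this
  have hη1 : 1 < η := by
    rw [hη]
    have : (0 : ℝ) < 1 / (8 * (g + 1) * m) := by positivity
    linarith
  obtain ⟨N₁, hN₁, hN₁'⟩ := exists_nat_pow_near (by linarith : (1 : ℝ) ≤ 2 * m) hη1
  have hlog : 0 < Real.logb 2 η := Real.logb_pos (by norm_num) hη1
  obtain ⟨T₀, hT₀⟩ : ∃ T₀ : ℕ, T₀ = 4 + (4 * t * (N₁ + 1) + 2 * (t + g)) ^ (4 * (g + 1)) +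
    4 * g * (8 * t) ^ g + 2 * k * d ^ k := ⟨_, rfl⟩
  set κ : ℝ := 1 / Real.logb 2 η + 1 with hκ
  have hκ0 : 0 < κ := by positivity
  set C : ℝ := T₀ + 8 * d * κ with hC
  refine ⟨4 * C + 5, fun V _ G Δ hΔ hdeg havg => ?_⟩
  by_cases hfree : KkkFree G k
  swap
  · obtain ⟨S, T, hST, hS, hT, hadj⟩ := not_not.mp hfree
    exact exists_subgraph_of_complete_bipartite G t g ht S T hST (hS.trans hk) (hT.trans hk) hadj
  set l : ℝ := Real.logb 2 (Real.logb 2 Δ) with hl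
  have hl1 : 1 ≤ l := by
    have h4 : (4 : ℝ) ≤ Δ := by exact_mod_cast hΔ
    have h2 : (2 : ℝ) ≤ Real.logb 2 Δ := by
      rw [Real.le_logb_iff_rpow_le (by norm_num) (by linarith)]
      norm_num
      exact hΔ
    rw [hl, Real.le_logb_iff_rpow_le (by norm_num) (by linarith), Real.rpow_one]
    exact h2
  obtain ⟨T, hT⟩ : ∃ T, T = ⌈C * l⌉₊ := ⟨_, rfl⟩
  have hd0 : (0 : ℝ) ≤ d := Nat.cast_nonneg _
  have hT₀0 : (0 : ℝ) ≤ T₀ := Nat.cast_nonneg _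
  have hdκ : 0 ≤ 8 * d * κ := by positivity
  have hC0 : 0 ≤ C := by positivity
  have hCT : C * l ≤ T := hT ▸ Nat.le_ceil _
  have hTC : (T : ℝ) < C * l + 1 := hT ▸ Nat.ceil_lt_add_one (by positivity)
  have hT₀T : T₀ ≤ T := by
    have : (T₀ : ℝ) ≤ T := by nlinarith
    exact_mod_cast this
  obtain ⟨N, hN⟩ : ∃ N, N = ⌊l / Real.logb 2 η⌋₊ + 1 := ⟨_, rfl⟩
  have hNl : l / Real.logb 2 η < N := by
    rw [hN]
    exact_mod_cast Nat.lt_floor_add_one _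
  have hNκ : (N : ℝ) ≤ κ * l := by
    have : (⌊l / Real.logb 2 η⌋₊ : ℝ) ≤ l / Real.logb 2 η := Nat.floor_le (by positivity)
    rw [hN]
    push_cast
    calc (⌊l / Real.logb 2 η⌋₊ : ℝ) + 1 ≤ l / Real.logb 2 η + l := by linarith
      _ = κ * l := by rw [hκ]; ring
  have hTN : 8 * d * N ≤ T := by
    have : (8 * d * N : ℝ) ≤ T := by
      calc (8 * d * N : ℝ) ≤ 8 * d * (κ * l) := by gcongr
        _ ≤ C * l := by rw [hC]; nlinarith
        _ ≤ T := hCT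
    exact_mod_cast this
  obtain ⟨A, B, hAB, hA, hcard, hmin⟩ := exists_bipartite_minDegree G T (by linarith)
  have hex : ∀ u, ∃ s : Finset V, u ∈ B → s ⊆ A.filter (G.Adj u) ∧ s.card = T := fun u => by
    by_cases hu : u ∈ B
    · obtain ⟨s, hs⟩ := Finset.exists_subset_card_eq (hmin u hu)
      exact ⟨s, fun _ => hs⟩
    · exact ⟨∅, fun h => absurd h hu⟩
  choose F hF using hex
  refine exists_subgraph_of_kkkFree G t g k m d ht hk0 hd hm hfree A B hAB hA hcard F
    (fun u hu v hv => (Finset.mem_filter.mp ((hF u hu).1 hv)).1)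
    (fun u hu v hv => (Finset.mem_filter.mp ((hF u hu).1 hv)).2) T (fun u hu => (hF u hu).2) Δ
    (fun v _ => ?_) η hη N N₁ hN₁ hN₁' hNl (by omega) (by omega) (by omega) (by omega) hTN
  refine le_trans ?_ (hdeg v)
  rw [deg, ← Set.ncard_coe_finset]
  refine Set.ncard_le_ncard (fun u hu => ?_) (Set.toFinite _)
  obtain ⟨huB, hvu⟩ := Finset.mem_filter.mp (Finset.mem_coe.mp hu)
  exact ((Finset.mem_filter.mp ((hF u huB).1 hvu)).2).symm
end

section
/- There is a constant c > 0 such that for every integer n ≥ 4 there exists a graph on n vertices with at least c·n·log₂ log₂ n edges which contains no nonempty k-regular subgraph for any integer k ≥ 3. -/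
variable {V : Type*}

section

open Finset

/-- The bipartite graph joining each `b : β` to exactly one vertex `f (b, i)` of every
layer `α i`. -/
def layeredGraph {β ι : Type*} {α : ι → Type*} (f : ∀ p : β × ι, α p.2) :
    SimpleGraph (β ⊕ Σ i, α i) where
  Adj u v := ∃ p : β × ι, (u = .inl p.1 ∧ v = .inr ⟨p.2, f p⟩) ∨
    (v = .inl p.1 ∧ u = .inr ⟨p.2, f p⟩)
  symm := ⟨fun _ _ ⟨p, hp⟩ => ⟨p, hp.symm⟩⟩
  loopless := ⟨fun u ⟨p, hp⟩ => by rcases hp with ⟨h, h'⟩ | ⟨h, h'⟩ <;> simp [h] at h'⟩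

theorem layeredGraph_adj_inl_inr {β ι : Type*} {α : ι → Type*} (f : ∀ p : β × ι, α p.2)
    (p : β × ι) : (layeredGraph f).Adj (.inl p.1) (.inr ⟨p.2, f p⟩) :=
  ⟨p, .inl ⟨rfl, rfl⟩⟩

theorem card_mul_card_le_edgeCount_layeredGraph {β ι : Type*} [Fintype β] [Fintype ι]
    {α : ι → Type*} [∀ i, Fintype (α i)] (f : ∀ p : β × ι, α p.2) :
    Fintype.card β * Fintype.card ι ≤ edgeCount (layeredGraph f) := by
  have hinj : Function.Injective
      (fun p : β × ι => s((.inl p.1 : β ⊕ Σ i, α i), .inr ⟨p.2, f p⟩)) := by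
    rintro ⟨b, i⟩ ⟨b', i'⟩ h
    simp only [Sym2.eq_iff, Sum.inl.injEq, Sum.inr.injEq, Sigma.mk.injEq, reduceCtorEq,
      and_false, or_false] at h
    exact Prod.ext h.1 h.2.1
  rw [edgeCount, ← Fintype.card_prod, ← Nat.card_eq_fintype_card, ← Set.ncard_univ,
    ← Set.ncard_image_of_injective _ hinj]
  refine Set.ncard_le_ncard ?_ (Set.toFinite _)
  rintro _ ⟨p, -, rfl⟩
  exact layeredGraph_adj_inl_inr f p

theorem edgeCount_comap_equiv {V W : Type*} (e : V ≃ W) (G : SimpleGraph W) :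
    edgeCount (G.comap e) = edgeCount G := by
  rw [edgeCount, edgeCount]
  exact Nat.card_congr (SimpleGraph.Iso.comap e G).mapEdgeSet

theorem HasRegularSubgraph.of_comap_equiv {V W : Type*} (e : V ≃ W) {G : SimpleGraph W} {k : ℕ}
    (h : HasRegularSubgraph (G.comap e) k) : HasRegularSubgraph G k := by
  obtain ⟨H, hne, hreg⟩ := h
  let φ : G.comap e →g G := ⟨e, fun h => h⟩
  refine ⟨H.map φ, hne.image _, ?_⟩
  rintro _ ⟨v, hv, rfl⟩
  rw [← hreg v hv, subDeg, subDeg, ← Set.ncard_image_of_injective (H.neighborSet v) e.injective]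
  congr 1
  ext w
  constructor
  · rintro ⟨v', w', hadj, hv', rfl⟩
    obtain rfl := e.injective hv'
    exact ⟨w', hadj, rfl⟩
  · rintro ⟨w', hadj, rfl⟩
    exact ⟨v, w', hadj, rfl, rfl⟩

/-- A `k`-regular subgraph of a layered graph as a set `E` of pairs `(b, i)`, each standing for
the edge from `b` to `f (b, i)`. -/
theorem exists_finsets_of_hasRegularSubgraph {β ι : Type*} [Fintype β] [Fintype ι]
    [DecidableEq β] [DecidableEq ι] {α : ι → Type*} [∀ i, Fintype (α i)] [∀ i, DecidableEq (α i)]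
    {f : ∀ p : β × ι, α p.2} {k : ℕ} (h : HasRegularSubgraph (layeredGraph f) k) :
    ∃ (S : Finset β) (T : Finset (Σ i, α i)) (E : Finset (β × ι)),
      (S.Nonempty ∨ T.Nonempty) ∧
      (∀ p ∈ E, p.1 ∈ S ∧ (⟨p.2, f p⟩ : Σ i, α i) ∈ T) ∧
      (∀ b ∈ S, #{p ∈ E | p.1 = b} = k) ∧
      ∀ x ∈ T, #{p ∈ E | (⟨p.2, f p⟩ : Σ i, α i) = x} = k := by
  classical
  obtain ⟨H, ⟨v, hv⟩, hreg⟩ := h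
  refine ⟨univ.filter fun b => .inl b ∈ H.verts, univ.filter fun x => .inr x ∈ H.verts,
    univ.filter fun p => H.Adj (.inl p.1) (.inr ⟨p.2, f p⟩), ?_, ?_, ?_, ?_⟩
  · rcases v with b | x
    · exact .inl ⟨b, by simpa using hv⟩
    · exact .inr ⟨x, by simpa using hv⟩
  · intro p hp
    simp only [mem_filter, mem_univ, true_and] at hp ⊢
    exact ⟨hp.fst_mem, hp.snd_mem⟩
  · intro b hb
    rw [mem_filter] at hb
    rw [← hreg _ hb.2, subDeg, ← Set.ncard_coe_finset]
    refine Set.ncard_congr (fun p _ => .inr ⟨p.2, f p⟩) ?_ ?_ ?_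
    · rintro ⟨b', i⟩ hp
      simp only [coe_filter, mem_filter, mem_univ, true_and, Set.mem_ofPred_eq] at hp
      obtain ⟨hp, rfl⟩ := hp
      exact hp
    · rintro ⟨b₁, i₁⟩ ⟨b₂, i₂⟩ h₁ h₂ heq
      simp only [coe_filter, mem_filter, mem_univ, true_and, Set.mem_ofPred_eq] at h₁ h₂
      simp only [Sum.inr.injEq, Sigma.mk.injEq] at heq
      exact Prod.ext (h₁.2.trans h₂.2.symm) heq.1
    · intro w hw
      obtain ⟨p, ⟨hp, rfl⟩ | ⟨-, hp⟩⟩ := H.adj_sub hw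
      · simp only [Sum.inl.injEq] at hp
        subst hp
        exact ⟨p, by simpa using hw, rfl⟩
      · simp at hp
  · intro x hx
    rw [mem_filter] at hx
    rw [← hreg _ hx.2, subDeg, ← Set.ncard_coe_finset]
    refine Set.ncard_congr (fun p _ => .inl p.1) ?_ ?_ ?_
    · intro p hp
      simp only [coe_filter, mem_filter, mem_univ, true_and, Set.mem_ofPred_eq] at hp
      obtain ⟨hp, rfl⟩ := hp
      exact hp.symm
    · rintro ⟨b₁, i₁⟩ ⟨b₂, i₂⟩ h₁ h₂ heq
      simp only [coe_filter, mem_filter, mem_univ, true_and, Set.mem_ofPred_eq] at h₁ h₂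
      simp only [Sum.inl.injEq] at heq
      exact Prod.ext heq (congrArg Sigma.fst (h₁.2.trans h₂.2.symm))
    · intro w hw
      obtain ⟨p, ⟨hp, -⟩ | ⟨rfl, hp⟩⟩ := H.adj_sub hw
      · simp at hp
      · simp only [Sum.inr.injEq] at hp
        subst hp
        exact ⟨p, by simpa using hw.symm, rfl⟩

/-- The local sparsity property of a random layered graph: fewer than `3 * #T` edges join `S`
to the vertices of `T` in layers below `j`, when `#S` is at most of the order of the size of
layer `j` and `T` is not much smaller than `S`. -/
def LocallySparse {β : Type*} {l : ℕ} {a : Fin l → ℕ}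
    (f : ∀ p : β × Fin l, Fin (a p.2)) : Prop :=
  ∀ (j : Fin l) (S : Finset β) (T : Finset (Σ i, Fin (a i))) (P : Finset (β × Fin l)),
    S.Nonempty → 3 * #S ≤ 5 * #T → #S ≤ 30 * a j → P ⊆ S ×ˢ Iio j → #P = 3 * #T →
    ¬ ∀ p ∈ P, (⟨p.2, f p⟩ : Σ i, Fin (a i)) ∈ T

theorem sum_le_two_mul_of_halving {l : ℕ} {a : Fin l → ℕ}
    (ha : ∀ i j, i < j → 2 * a j ≤ a i) (U : Finset (Fin l)) (x : ℕ) (hx : ∀ i ∈ U, a i ≤ x) :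
    ∑ i ∈ U, a i ≤ 2 * x := by
  induction U using Finset.induction_on_min generalizing x with
  | empty => simp
  | insert u U hu ih =>
    have h₁ := hx u (mem_insert_self _ _)
    have h₂ := ih (a u / 2) fun i hi => by have := ha u i (hu i hi); omega
    rw [sum_insert fun h => (hu u h).false]
    omega

theorem LocallySparse.not_hasRegularSubgraph {β : Type*} [Fintype β] {l : ℕ} {a : Fin l → ℕ}
    {f : ∀ p : β × Fin l, Fin (a p.2)} (hf : LocallySparse f)
    (ha : ∀ i j, i < j → 2 * a j ≤ a i) {k : ℕ} (hk : 3 ≤ k) :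
    ¬ HasRegularSubgraph (layeredGraph (α := fun i => Fin (a i)) f) k := by
  classical
  intro h
  obtain ⟨S, T, E, hne, hE, hS, hT⟩ := exists_finsets_of_hasRegularSubgraph h
  have hlayers (J : Finset (Fin l)) : #{p ∈ E | p.2 ∈ J} = #{x ∈ T | x.1 ∈ J} * k := by
    rw [card_eq_sum_card_fiberwise (f := fun p => (⟨p.2, f p⟩ : Σ i, Fin (a i)))
      (t := {x ∈ T | x.1 ∈ J}) fun p hp => ?_]
    · refine sum_const_nat fun x hx => ?_
      rw [mem_filter] at hx
      rw [← hT x hx.1, filter_filter]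
      congr 1
      refine filter_congr fun p _ => ⟨fun h => h.2, fun h => ⟨?_, h⟩⟩
      rw [show p.2 = x.1 from congrArg Sigma.fst h]
      exact hx.2
    · simp only [coe_filter, Set.mem_ofPred_eq] at hp ⊢
      exact ⟨(hE p hp.1).2, hp.2⟩
  have hES : #E = #S * k := by
    rw [card_eq_sum_card_fiberwise (f := Prod.fst) (t := S) fun p hp => (hE p hp).1]
    exact sum_const_nat hS
  have hcard : #S = #T := by
    have := hlayers univ
    simp only [mem_univ, filter_true] at this
    exact Nat.eq_of_mul_eq_mul_right (by omega) (hES.symm.trans this)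
  have hSpos : 0 < #S := by
    rcases hne with h | h
    · exact h.card_pos
    · exact hcard ▸ h.card_pos
  have hone (j : Fin l) : 3 * #{x ∈ T | x.1 ∈ ({j} : Finset (Fin l))} ≤ #S := by
    calc 3 * #{x ∈ T | x.1 ∈ ({j} : Finset (Fin l))}
        ≤ #{x ∈ T | x.1 ∈ ({j} : Finset (Fin l))} * k := by rw [mul_comm]; gcongr
      _ = #{p ∈ E | p.2 ∈ ({j} : Finset (Fin l))} := (hlayers _).symm
      _ ≤ #S := by
        refine card_le_card_of_injOn Prod.fst (fun p hp => (hE p (mem_filter.1 hp).1).1) ?_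
        intro p hp q hq hpq
        simp only [mem_singleton, coe_filter, Set.mem_ofPred_eq] at hp hq
        exact Prod.ext hpq (hp.2.trans hq.2.symm)
  let U : Finset (Fin l) := {i | 30 * a i < #S}
  have hU : 15 * #{x ∈ T | x.1 ∈ U} ≤ #S := by
    have h₁ : #{x ∈ T | x.1 ∈ U} ≤ ∑ i ∈ U, a i := by
      calc #{x ∈ T | x.1 ∈ U} ≤ #(U.sigma fun i => (univ : Finset (Fin (a i)))) :=
            card_le_card fun x hx => by simpa using (mem_filter.1 hx).2
        _ = ∑ i ∈ U, a i := by simp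
    have h₂ := sum_le_two_mul_of_halving ha U (#S / 30) fun i hi => by
      have := (mem_filter.1 hi).2
      omega
    omega
  have hUc : Uᶜ.Nonempty := by
    rw [nonempty_iff_ne_empty, Ne, compl_eq_empty_iff]
    intro h
    simp only [h, mem_univ, filter_true] at hU
    omega
  let j := Uᶜ.max' hUc
  have hj : j ∉ U := mem_compl.1 (Uᶜ.max'_mem hUc)
  have hcover : #T ≤ #{x ∈ T | x.1 ∈ Iio j} + #{x ∈ T | x.1 ∈ ({j} : Finset (Fin l))} +
      #{x ∈ T | x.1 ∈ U} := by
    refine (card_le_card fun x hx => ?_).trans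
      ((card_union_le _ _).trans (Nat.add_le_add_right (card_union_le _ _) _))
    simp only [mem_union, mem_filter, hx, true_and, mem_Iio, mem_singleton]
    by_cases hxU : x.1 ∈ U
    · exact .inr hxU
    · exact .inl (Uᶜ.le_max' _ (mem_compl.2 hxU)).lt_or_eq
  have hj₁ := hone j
  have hlow : 3 * #{x ∈ T | x.1 ∈ Iio j} ≤ #{p ∈ E | p.2 ∈ Iio j} := by
    rw [hlayers, mul_comm]
    gcongr
  obtain ⟨P, hP, hPcard⟩ := exists_subset_card_eq hlow
  refine hf j S {x ∈ T | x.1 ∈ Iio j} P (card_pos.1 hSpos) (by omega) ?_ ?_ hPcard ?_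
  · simpa [U] using hj
  · intro p hp
    obtain ⟨hpE, hpj⟩ := mem_filter.1 (hP hp)
    exact mem_product.2 ⟨(hE p hpE).1, hpj⟩
  · intro p hp
    obtain ⟨hpE, hpj⟩ := mem_filter.1 (hP hp)
    exact mem_filter.2 ⟨(hE p hpE).2, hpj⟩

theorem card_filter_forall_mem_le {κ : Type*} [Fintype κ] [DecidableEq κ] {π : κ → Type*}
    [∀ p, Fintype (π p)] [∀ p, DecidableEq (π p)] (P : Finset κ) (X : ∀ p, Finset (π p)) (ρ : ℝ)
    (h : ∀ p ∈ P, (#(X p) : ℝ) ≤ ρ * Fintype.card (π p)) :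
    (#{f : ∀ p, π p | ∀ p ∈ P, f p ∈ X p} : ℝ) ≤ ρ ^ #P * Fintype.card (∀ p, π p) := by
  have heq : ({f : ∀ p, π p | ∀ p ∈ P, f p ∈ X p} : Finset (∀ p, π p)) =
      Fintype.piFinset fun p => if p ∈ P then X p else univ := by
    ext f
    simp only [mem_filter, mem_univ, true_and, Fintype.mem_piFinset]
    refine forall_congr' fun p => ?_
    split_ifs with hp <;> simp [hp]
  rw [heq, Fintype.card_piFinset, Fintype.card_pi, Nat.cast_prod, Nat.cast_prod]
  have hconst : ρ ^ #P = ∏ p, if p ∈ P then ρ else 1 := by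
    simp [prod_ite_mem]
  rw [hconst, ← prod_mul_distrib]
  refine prod_le_prod (fun _ _ => Nat.cast_nonneg _) fun p _ => ?_
  split_ifs with hp
  · exact h p hp
  · simp

theorem cast_card_biUnion_le {ι γ : Type*} [DecidableEq γ] (s : Finset ι) (F : ι → Finset γ)
    {c : ℝ} (h : ∀ i ∈ s, (#(F i) : ℝ) ≤ c) : (#(s.biUnion F) : ℝ) ≤ #s * c := by
  calc (#(s.biUnion F) : ℝ) ≤ ∑ i ∈ s, (#(F i) : ℝ) := by exact_mod_cast card_biUnion_le
    _ ≤ #s * c := by simpa using sum_le_card_nsmul s _ c h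

theorem choose_le_three_mul_div_pow (n : ℕ) {r : ℕ} (hr : 0 < r) :
    (n.choose r : ℝ) ≤ (3 * n / r) ^ r := by
  have hr' : (0 : ℝ) < r := by exact_mod_cast hr
  have hexp : (r : ℝ) ^ r / r.factorial ≤ 3 ^ r := by
    calc (r : ℝ) ^ r / r.factorial ≤ Real.exp r := Real.pow_div_factorial_le_exp _ hr'.le r
      _ = Real.exp 1 ^ r := by rw [← Real.exp_nat_mul, mul_one]
      _ ≤ 3 ^ r := by gcongr; exact Real.exp_one_lt_three.le
  calc (n.choose r : ℝ) ≤ n ^ r / r.factorial := Nat.choose_le_pow_div r n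
    _ = (n / r) ^ r * (r ^ r / r.factorial) := by rw [div_pow]; field_simp
    _ ≤ (n / r) ^ r * 3 ^ r := by gcongr
    _ = (3 * n / r) ^ r := by rw [← mul_pow]; ring

theorem choose_mul_choose_mul_choose_mul_pow_le {N b M s t j q A : ℕ} (hb : b ≤ 4 * N)
    (hM : M ≤ 4 * N) (hs : 0 < s) (hsb : s ≤ b) (hst : 3 * s ≤ 5 * t) (hsA : s ≤ 30 * A)
    (hA : 2 ^ (3 * j + 54) * (j * q) ^ 9 * A ≤ N) :
    (b.choose s : ℝ) * (M.choose t * ((s * j).choose (3 * t) * (t * q / N : ℝ) ^ (3 * t))) ≤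
      (1 / 2) ^ (j + 1) * ((1 / 2) ^ (s + 1) * (1 / 2) ^ (t + 1)) := by
  have ht : 0 < t := by omega
  have hN : 0 < N := by omega
  have hN' : (0 : ℝ) < N := by exact_mod_cast hN
  have hs' : (0 : ℝ) < s := by exact_mod_cast hs
  have ht' : (0 : ℝ) < t := by exact_mod_cast ht
  have hb' : (b : ℝ) ≤ 4 * N := by exact_mod_cast hb
  have hM' : (M : ℝ) ≤ 4 * N := by exact_mod_cast hM
  have hsb' : (s : ℝ) ≤ b := by exact_mod_cast hsb
  have hst' : (3 : ℝ) * s ≤ 5 * t := by exact_mod_cast hst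
  have hsA' : (s : ℝ) ≤ 30 * A := by exact_mod_cast hsA
  have hA' : (2 : ℝ) ^ (3 * j + 54) * (j * q) ^ 9 * A ≤ N := by exact_mod_cast hA
  obtain ⟨x, hx⟩ : ∃ x : ℝ, x = s / N := ⟨_, rfl⟩
  obtain ⟨y, hy⟩ : ∃ y : ℝ, y = j * q := ⟨_, rfl⟩
  have hx0 : 0 < x := by rw [hx]; positivity
  have hy0 : 0 ≤ y := by rw [hy]; positivity
  have hx12 : 1 ≤ 12 / x := by
    rw [one_le_div hx0, hx, div_le_iff₀ hN']
    linarith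
  have h₁ : (b.choose s : ℝ) ≤ (12 / x) ^ s := by
    refine (choose_le_three_mul_div_pow b hs).trans (pow_le_pow_left₀ (by positivity) ?_ s)
    rw [hx, div_div_eq_mul_div]
    exact div_le_div_of_nonneg_right (by linarith) hs'.le
  have h₂ : (M.choose t : ℝ) ≤ (20 / x) ^ t := by
    refine (choose_le_three_mul_div_pow M ht).trans (pow_le_pow_left₀ (by positivity) ?_ t)
    rw [hx, div_div_eq_mul_div, div_le_div_iff₀ ht' hs']
    nlinarith
  have h₃ : ((s * j).choose (3 * t) : ℝ) * (t * q / N : ℝ) ^ (3 * t) ≤ (x * y) ^ (3 * t) := by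
    calc ((s * j).choose (3 * t) : ℝ) * (t * q / N : ℝ) ^ (3 * t)
        ≤ (3 * (s * j : ℕ) / (3 * t : ℕ)) ^ (3 * t) * (t * q / N : ℝ) ^ (3 * t) := by
          gcongr
          exact choose_le_three_mul_div_pow _ (by omega)
      _ = (x * y) ^ (3 * t) := by
          rw [← mul_pow, hx, hy]
          congr 1
          push_cast
          field_simp
  have hbase : (12 / x) ^ 5 * ((20 / x) ^ 3 * (x * y) ^ 9) ≤ ((1 / 2) ^ (j + 6)) ^ 3 := by
    calc (12 / x) ^ 5 * ((20 / x) ^ 3 * (x * y) ^ 9) = 12 ^ 5 * 20 ^ 3 * y ^ 9 * x := by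
          field_simp
      _ ≤ 12 ^ 5 * 20 ^ 3 * y ^ 9 * (30 * A / N) := by rw [hx]; gcongr
      _ ≤ 2 ^ 36 * y ^ 9 * A / N := by
          rw [← mul_div_assoc]
          refine div_le_div_of_nonneg_right ?_ hN'.le
          have : 0 ≤ y ^ 9 * A := by positivity
          linarith
      _ ≤ ((1 / 2) ^ (j + 6)) ^ 3 := by
          rw [div_le_iff₀ hN', ← pow_mul, one_div, inv_pow, inv_mul_eq_div,
            le_div_iff₀ (by positivity)]
          refine le_trans (le_of_eq ?_) hA'
          rw [hy]
          ring
  refine (pow_le_pow_iff_left₀ (by positivity) (by positivity) three_ne_zero).1 ?_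
  calc ((b.choose s : ℝ) *
        (M.choose t * ((s * j).choose (3 * t) * (t * q / N : ℝ) ^ (3 * t)))) ^ 3
      ≤ ((12 / x) ^ s * ((20 / x) ^ t * (x * y) ^ (3 * t))) ^ 3 := by gcongr
    _ = (12 / x) ^ (3 * s) * ((20 / x) ^ t * (x * y) ^ (3 * t)) ^ 3 := by
        rw [mul_pow, ← pow_mul, mul_comm s]
    _ ≤ (12 / x) ^ (5 * t) * ((20 / x) ^ t * (x * y) ^ (3 * t)) ^ 3 := by gcongr
    _ = ((12 / x) ^ 5 * ((20 / x) ^ 3 * (x * y) ^ 9)) ^ t := by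
        simp only [mul_pow _ _ t, mul_pow _ _ 3, ← pow_mul]
        congr 3 <;> ring
    _ ≤ (((1 / 2) ^ (j + 6)) ^ 3) ^ t := by gcongr
    _ = ((1 / 2) ^ ((j + 6) * t)) ^ 3 := by rw [← pow_mul, ← pow_mul, ← pow_mul]; ring
    _ ≤ ((1 / 2) ^ (j + 1) * ((1 / 2) ^ (s + 1) * (1 / 2) ^ (t + 1))) ^ 3 := by
        rw [← pow_add, ← pow_add]
        refine pow_le_pow_left₀ (by positivity)
          (pow_le_pow_of_le_one (by norm_num) (by norm_num) ?_) 3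
        nlinarith

theorem sum_range_half_pow_succ_lt (n : ℕ) : ∑ k ∈ range n, (1 / 2 : ℝ) ^ (k + 1) < 1 := by
  have h : ∑ k ∈ range n, (1 / 2 : ℝ) ^ (k + 1) = 1 - (1 / 2) ^ n := by
    induction n with
    | zero => simp
    | succ n ih => rw [sum_range_succ, ih, pow_succ]; ring
  rw [h]
  linarith [show (0 : ℝ) < (1 / 2) ^ n by positivity]

theorem card_le_of_forall_exists_dense {l N b : ℕ} {a : Fin l → ℕ} {q : ℕ} {j : Fin l} {s t : ℕ}
    (hb : b ≤ 4 * N) (hM : ∑ i, a i ≤ 4 * N) (hq : ∀ i < j, N ≤ q * a i)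
    (hj : 2 ^ (3 * (j : ℕ) + 54) * (j * q) ^ 9 * a j ≤ N)
    (hs : 0 < s) (hsb : s ≤ b) (hst : 3 * s ≤ 5 * t) (hsa : s ≤ 30 * a j)
    (B : Finset (∀ p : Fin b × Fin l, Fin (a p.2)))
    (hB : ∀ f ∈ B,
      ∃ (S : Finset (Fin b)) (T : Finset (Σ i, Fin (a i))) (P : Finset (Fin b × Fin l)),
        #S = s ∧ #T = t ∧ P ⊆ S ×ˢ Iio j ∧ #P = 3 * t ∧
        ∀ p ∈ P, (⟨p.2, f p⟩ : Σ i, Fin (a i)) ∈ T) :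
    (#B : ℝ) ≤ (1 / 2) ^ ((j : ℕ) + 1) * ((1 / 2) ^ (s + 1) * (1 / 2) ^ (t + 1)) *
      Fintype.card (∀ p : Fin b × Fin l, Fin (a p.2)) := by
  have hN : (0 : ℝ) < N := by exact_mod_cast (show 0 < N by omega)
  let X (T : Finset (Σ i, Fin (a i))) (p : Fin b × Fin l) : Finset (Fin (a p.2)) :=
    {y | (⟨p.2, y⟩ : Σ i, Fin (a i)) ∈ T}
  let F (T : Finset (Σ i, Fin (a i))) (P : Finset (Fin b × Fin l)) :
      Finset (∀ p : Fin b × Fin l, Fin (a p.2)) := {f | ∀ p ∈ P, f p ∈ X T p}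
  obtain ⟨ω, hω⟩ : ∃ ω : ℝ, ω = Fintype.card (∀ p : Fin b × Fin l, Fin (a p.2)) := ⟨_, rfl⟩
  have hX (T : Finset (Σ i, Fin (a i))) (p : Fin b × Fin l) : #(X T p) ≤ #T :=
    card_le_card_of_injOn (fun y => ⟨p.2, y⟩) (fun y hy => (mem_filter.1 hy).2)
      fun y _ z _ h => by simpa using h
  have hF (S : Finset (Fin b)) (T : Finset (Σ i, Fin (a i))) (hT : #T = t)
      (P : Finset (Fin b × Fin l)) (hP : P ⊆ S ×ˢ Iio j) (hPt : #P = 3 * t) :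
      (#(F T P) : ℝ) ≤ (t * q / N : ℝ) ^ (3 * t) * ω := by
    rw [← hPt, hω]
    refine card_filter_forall_mem_le P (X T) _ fun p hp => ?_
    have h₁ : (N : ℝ) ≤ q * a p.2 := by
      exact_mod_cast hq p.2 (mem_Iio.1 (mem_product.1 (hP hp)).2)
    calc (#(X T p) : ℝ) ≤ t := by exact_mod_cast hT ▸ hX T p
      _ = t / N * N := by field_simp
      _ ≤ t / N * (q * a p.2) := by gcongr
      _ = t * q / N * Fintype.card (Fin (a p.2)) := by rw [Fintype.card_fin]; ring
  have hP (S : Finset (Fin b)) (hS : #S = s) (T : Finset (Σ i, Fin (a i))) (hT : #T = t) :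
      (#((powersetCard (3 * t) (S ×ˢ Iio j)).biUnion fun P => F T P) : ℝ) ≤
        (s * j).choose (3 * t) * ((t * q / N : ℝ) ^ (3 * t) * ω) := by
    have h := cast_card_biUnion_le (powersetCard (3 * t) (S ×ˢ Iio j)) (F T) fun P hP =>
      hF S T hT P (mem_powersetCard.1 hP).1 (mem_powersetCard.1 hP).2
    rwa [card_powersetCard, card_product, Fin.card_Iio, hS] at h
  have hT (S : Finset (Fin b)) (hS : #S = s) :
      (#((powersetCard t univ).biUnion fun T =>
        (powersetCard (3 * t) (S ×ˢ Iio j)).biUnion fun P => F T P) : ℝ) ≤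
        (∑ i, a i).choose t * ((s * j).choose (3 * t) * ((t * q / N : ℝ) ^ (3 * t) * ω)) := by
    have h := cast_card_biUnion_le (powersetCard t univ)
      (fun T => (powersetCard (3 * t) (S ×ˢ Iio j)).biUnion fun P => F T P) fun T hT =>
      hP S hS T (mem_powersetCard.1 hT).2
    rwa [card_powersetCard, card_univ, Fintype.card_sigma,
      sum_congr rfl fun i _ => Fintype.card_fin (a i)] at h
  have hS := cast_card_biUnion_le (powersetCard s univ)
    (fun S : Finset (Fin b) => (powersetCard t univ).biUnion fun T =>
      (powersetCard (3 * t) (S ×ˢ Iio j)).biUnion fun P => F T P) fun S hS =>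
    hT S (mem_powersetCard.1 hS).2
  rw [card_powersetCard, card_univ, Fintype.card_fin] at hS
  refine le_trans (Nat.cast_le.2 (card_le_card fun f hf => ?_)) (hS.trans ?_)
  · obtain ⟨S, T, P, hS, hT, hP, hPt, hfP⟩ := hB f hf
    simp only [mem_biUnion, mem_powersetCard]
    exact ⟨S, ⟨subset_univ _, hS⟩, T, ⟨subset_univ _, hT⟩, P, ⟨hP, hPt⟩, by simpa [F, X] using hfP⟩
  · rw [← hω]
    refine le_trans (le_of_eq ?_) (mul_le_mul_of_nonneg_right
      (choose_mul_choose_mul_choose_mul_pow_le hb hM hs hsb hst hsa hj)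
      (hω ▸ Nat.cast_nonneg _))
    ring

theorem exists_locallySparse {l N b : ℕ} {a : Fin l → ℕ} (ha : ∀ i, 0 < a i) (q : Fin l → ℕ)
    (hb : b ≤ 4 * N) (hM : ∑ i, a i ≤ 4 * N) (hq : ∀ j, ∀ i < j, N ≤ q j * a i)
    (hj : ∀ j : Fin l, 2 ^ (3 * (j : ℕ) + 54) * (j * q j) ^ 9 * a j ≤ N) :
    ∃ f : ∀ p : Fin b × Fin l, Fin (a p.2), LocallySparse f := by
  classical
  by_contra! hbad
  have : ∀ i, NeZero (a i) := fun i => ⟨(ha i).ne'⟩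
  let M := ∑ i, a i
  let B (j : Fin l) (s t : ℕ) : Finset (∀ p : Fin b × Fin l, Fin (a p.2)) :=
    {f | ∃ (S : Finset (Fin b)) (T : Finset (Σ i, Fin (a i))) (P : Finset (Fin b × Fin l)),
      S.Nonempty ∧ 3 * #S ≤ 5 * #T ∧ #S ≤ 30 * a j ∧ #S = s ∧ #T = t ∧ P ⊆ S ×ˢ Iio j ∧
      #P = 3 * t ∧ ∀ p ∈ P, (⟨p.2, f p⟩ : Σ i, Fin (a i)) ∈ T}
  obtain ⟨ω, hω⟩ : ∃ ω : ℝ, ω = Fintype.card (∀ p : Fin b × Fin l, Fin (a p.2)) := ⟨_, rfl⟩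
  have hω0 : 0 < ω := by
    rw [hω]
    exact_mod_cast Fintype.card_pos
  have hB (j : Fin l) (s t : ℕ) :
      (#(B j s t) : ℝ) ≤ (1 / 2) ^ ((j : ℕ) + 1) * ((1 / 2) ^ (s + 1) * (1 / 2) ^ (t + 1)) * ω := by
    rcases (B j s t).eq_empty_or_nonempty with h | ⟨f, hf⟩
    · rw [h, card_empty, Nat.cast_zero]
      positivity
    · obtain ⟨S, T, P, hne, hST, hSa, rfl, rfl, -⟩ := (mem_filter.1 hf).2
      rw [hω]
      refine card_le_of_forall_exists_dense hb hM (hq j) (hj j) hne.card_pos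
        (by simpa using card_le_univ S) hST hSa _ fun f hf => ?_
      obtain ⟨S', T', P', -, -, -, h⟩ := (mem_filter.1 hf).2
      exact ⟨S', T', P', h⟩
  have hcover : (univ : Finset (∀ p : Fin b × Fin l, Fin (a p.2))) ⊆
      univ.biUnion fun j => (range (b + 1)).biUnion fun s => (range (M + 1)).biUnion (B j s) := by
    intro f _
    have hf := hbad f
    simp only [LocallySparse, not_forall] at hf
    obtain ⟨j, S, T, P, hne, hST, hSa, hP, hPT, hfP⟩ := hf
    have hS : #S ≤ b := by simpa using card_le_univ S
    have hT : #T ≤ M := by simpa [M] using card_le_univ T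
    simp only [mem_biUnion, mem_univ, true_and, mem_range, Nat.lt_succ_iff]
    exact ⟨j, #S, hS, #T, hT, mem_filter.2
      ⟨mem_univ _, S, T, P, hne, hST, hSa, rfl, rfl, hP, hPT,
        fun p hp => by_contra fun h => hfP ⟨p, hp, h⟩⟩⟩
  have hsum : (ω : ℝ) ≤ ∑ j : Fin l, ∑ s ∈ range (b + 1), ∑ t ∈ range (M + 1),
      (#(B j s t) : ℝ) := by
    rw [hω]
    exact_mod_cast (card_le_card hcover).trans <| card_biUnion_le.trans <| sum_le_sum fun j _ =>
      card_biUnion_le.trans <| sum_le_sum fun s _ => card_biUnion_le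
  refine absurd hsum (not_le.2 ?_)
  calc ∑ j : Fin l, ∑ s ∈ range (b + 1), ∑ t ∈ range (M + 1), (#(B j s t) : ℝ)
      ≤ ∑ j : Fin l, ∑ s ∈ range (b + 1), ∑ t ∈ range (M + 1),
          (1 / 2 : ℝ) ^ ((j : ℕ) + 1) * ((1 / 2) ^ (s + 1) * (1 / 2) ^ (t + 1)) * ω := by
        gcongr
        exact hB _ _ _
    _ = (∑ j ∈ range l, (1 / 2 : ℝ) ^ (j + 1)) * ((∑ s ∈ range (b + 1), (1 / 2 : ℝ) ^ (s + 1)) *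
          ∑ t ∈ range (M + 1), (1 / 2 : ℝ) ^ (t + 1)) * ω := by
        rw [← Fin.sum_univ_eq_sum_range (fun j => (1 / 2 : ℝ) ^ (j + 1))]
        simp only [← sum_mul, ← mul_sum]
    _ < 1 * ω := by
        refine mul_lt_mul_of_pos_right ?_ hω0
        refine mul_lt_one_of_nonneg_of_lt_one_left (by positivity)
          (sum_range_half_pow_succ_lt l) ?_
        exact mul_le_one₀ (sum_range_half_pow_succ_lt _).le (by positivity)
          (sum_range_half_pow_succ_lt _).le
    _ = ω := one_mul ω

theorem hundred_pow_recurrence (j : ℕ) :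
    3 * (j + 1) + 54 + 9 * (j + 1 + 100 ^ j) ≤ 100 ^ (j + 1) := by
  have h : j + 1 ≤ 100 ^ j := j.lt_pow_self (by norm_num)
  have h₁ : 1 ≤ 100 ^ j := Nat.one_le_pow _ _ (by norm_num)
  induction j with
  | zero => norm_num
  | succ j ih =>
    have := ih (j.lt_pow_self (by norm_num)) (Nat.one_le_pow _ _ (by norm_num))
    rw [pow_succ _ (j + 1)]
    rw [pow_succ _ j] at *
    omega

theorem logb_logb_le {n m l : ℕ} (hm : 1 ≤ m) (hn : n < 2 ^ (m + 2)) (hn4 : 4 ≤ n)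
    (hl : m < 100 ^ l) : Real.logb 2 (Real.logb 2 n) ≤ 8 * l := by
  have hl0 : l ≠ 0 := by rintro rfl; simp at hl; omega
  have h₁ : Real.logb 2 n ≤ (m + 2 : ℕ) := by
    rw [Real.logb_le_iff_le_rpow (by norm_num) (by positivity), Real.rpow_natCast]
    exact_mod_cast hn.le
  have h₂ : m + 2 ≤ 2 ^ (8 * l) := by
    have : 100 ^ l ≤ 2 ^ (7 * l) := by
      rw [pow_mul]
      exact Nat.pow_le_pow_left (by norm_num) l
    have h2 : 2 ≤ 2 ^ l := Nat.le_self_pow hl0 2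
    have h3 : 2 ^ (8 * l) = 2 ^ (7 * l) * 2 ^ l := by rw [← pow_add]; ring_nf
    nlinarith
  have hpos : 0 < Real.logb 2 n :=
    Real.logb_pos (by norm_num) (by exact_mod_cast (show 1 < n by omega))
  rw [Real.logb_le_iff_le_rpow (by norm_num) hpos]
  refine h₁.trans ?_
  rw [show (8 * l : ℝ) = (8 * l : ℕ) by push_cast; rfl, Real.rpow_natCast]
  exact_mod_cast h₂

theorem exists_locallySparse_of_layers {m l b : ℕ} (hl : ∀ i < l, 100 ^ i ≤ m)
    (hb : b ≤ 4 * 2 ^ m) (hM : ∑ i : Fin l, 2 ^ (m - 100 ^ (i : ℕ)) ≤ 4 * 2 ^ m) :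
    ∃ f : ∀ p : Fin b × Fin l, Fin (2 ^ (m - 100 ^ (p.2 : ℕ))),
      LocallySparse (a := fun i : Fin l => 2 ^ (m - 100 ^ (i : ℕ))) f := by
  refine exists_locallySparse (a := fun i : Fin l => 2 ^ (m - 100 ^ (i : ℕ))) (N := 2 ^ m)
    (fun i => by positivity) (fun j => 2 ^ 100 ^ ((j : ℕ) - 1)) hb hM ?_ ?_
  · intro j i hij
    have hij' : (i : ℕ) ≤ j - 1 := Nat.le_sub_one_of_lt hij
    have := Nat.pow_le_pow_right (show 0 < 100 by norm_num) hij'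
    rw [← pow_add]
    exact Nat.pow_le_pow_right (by norm_num) (by omega)
  · rintro ⟨j, hj⟩
    rcases j with _ | j
    · simp
    · have h₁ := hundred_pow_recurrence j
      have h₂ := hl _ hj
      have h₃ : j + 1 ≤ 2 ^ (j + 1) := Nat.lt_two_pow_self.le
      calc 2 ^ (3 * (j + 1) + 54) * ((j + 1) * 2 ^ 100 ^ (j + 1 - 1)) ^ 9 * 2 ^ (m - 100 ^ (j + 1))
          ≤ 2 ^ (3 * (j + 1) + 54) * (2 ^ (j + 1) * 2 ^ 100 ^ (j + 1 - 1)) ^ 9 *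
            2 ^ (m - 100 ^ (j + 1)) := by gcongr
        _ = 2 ^ (3 * (j + 1) + 54 + 9 * (j + 1 + 100 ^ j) + (m - 100 ^ (j + 1))) := by
            rw [Nat.add_sub_cancel, ← pow_add, ← pow_mul, ← pow_add, ← pow_add]
            congr 1
            ring
        _ ≤ 2 ^ m := Nat.pow_le_pow_right (by norm_num) (by omega)

end

/-- Pyber–Rödl–Szemerédi lower bound: there is `c > 0` such that for every `n ≥ 4` there
is an `n`-vertex graph with at least `c·n·log₂ log₂ n` edges containing no nonempty
`k`-regular subgraph for any `k ≥ 3`. -/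
theorem pyber_rodl_szemeredi_lower_bound :
    ∃ c : ℝ, 0 < c ∧ ∀ n : ℕ, 4 ≤ n →
      ∃ G : SimpleGraph (Fin n),
        c * (n : ℝ) * Real.logb 2 (Real.logb 2 (n : ℝ)) ≤ (edgeCount G : ℝ) ∧
        ∀ k : ℕ, 3 ≤ k → ¬ HasRegularSubgraph G k := by
  refine ⟨1 / 16, by norm_num, fun n hn => ?_⟩
  obtain ⟨m, hm⟩ : ∃ m, m + 1 = Nat.log 2 n :=
    ⟨Nat.log 2 n - 1, Nat.sub_add_cancel (Nat.log_pos (by norm_num) (by omega))⟩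
  have hmn : 2 ^ (m + 1) ≤ n := hm ▸ Nat.pow_log_le_self 2 (by omega)
  have hnm : n < 2 ^ (m + 2) := by
    have := Nat.lt_pow_succ_log_self (show 1 < 2 by norm_num) n
    rwa [← hm] at this
  have hm1 : 1 ≤ m := by
    by_contra h
    obtain rfl : m = 0 := by omega
    omega
  obtain ⟨l, hl⟩ : ∃ l, l = Nat.log 100 m + 1 := ⟨_, rfl⟩
  have hlm : ∀ i < l, 100 ^ i ≤ m := fun i hi =>
    Nat.pow_le_of_le_log (by omega) (by omega)
  have hml : m < 100 ^ l := hl ▸ Nat.lt_pow_succ_log_self (by norm_num) m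
  have hhalf : ∀ i j : Fin l, i < j → 2 * 2 ^ (m - 100 ^ (j : ℕ)) ≤ 2 ^ (m - 100 ^ (i : ℕ)) := by
    intro i j hij
    have h₁ : 100 ^ (i : ℕ) < 100 ^ (j : ℕ) := Nat.pow_lt_pow_right (by norm_num) hij
    have h₂ := hlm j j.2
    rw [← pow_succ']
    exact Nat.pow_le_pow_right (by norm_num) (by omega)
  have hsum : ∑ i : Fin l, 2 ^ (m - 100 ^ (i : ℕ)) ≤ 2 ^ m := by
    have h := sum_le_two_mul_of_halving hhalf Finset.univ (2 ^ (m - 1)) fun i _ => by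
      have := Nat.one_le_pow (i : ℕ) 100 (by norm_num)
      exact Nat.pow_le_pow_right (by norm_num) (by omega)
    rwa [← pow_succ', Nat.sub_add_cancel hm1] at h
  rw [pow_succ] at hmn
  rw [pow_add] at hnm
  obtain ⟨b, hb⟩ : ∃ b, b + ∑ i : Fin l, 2 ^ (m - 100 ^ (i : ℕ)) = n :=
    ⟨_, Nat.sub_add_cancel (by omega)⟩
  obtain ⟨f, hf⟩ := exists_locallySparse_of_layers (b := b) hlm (by omega) (by omega)
  let e : Fin n ≃ Fin b ⊕ Σ i : Fin l, Fin (2 ^ (m - 100 ^ (i : ℕ))) :=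
    Fintype.equivOfCardEq (by simp [hb])
  let G := layeredGraph (α := fun i : Fin l => Fin (2 ^ (m - 100 ^ (i : ℕ)))) f
  refine ⟨G.comap e, ?_, fun k hk h => hf.not_hasRegularSubgraph hhalf hk (h.of_comap_equiv e)⟩
  rw [edgeCount_comap_equiv]
  have hedge : ((b * l : ℕ) : ℝ) ≤ edgeCount G := by
    have := card_mul_card_le_edgeCount_layeredGraph
      (α := fun i : Fin l => Fin (2 ^ (m - 100 ^ (i : ℕ)))) f
    rw [Fintype.card_fin, Fintype.card_fin] at this
    exact_mod_cast this
  have hlog := logb_logb_le hm1 (by rwa [pow_add]) hn hml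
  have hbn : (n : ℝ) ≤ 2 * b := by exact_mod_cast (show n ≤ 2 * b by omega)
  calc 1 / 16 * (n : ℝ) * Real.logb 2 (Real.logb 2 (n : ℝ)) ≤ 1 / 16 * n * (8 * l) := by gcongr
    _ ≤ 1 / 16 * (2 * b) * (8 * l) := by gcongr
    _ = (b * l : ℕ) := by push_cast; ring
    _ ≤ edgeCount G := hedge
end

section
/- For every positive integer k there is a constant C = C(k) such that every finite simple graph G with maximum degree Δ ≥ 2 whose average degree is at least C·log₂ Δ contains a nonempty k-regular subgraph. -/
variable {V : Type*}

open Finset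

section

variable {α β : Type*}

/-- The number of pairs of `E` with first coordinate `a`. -/
def leftDeg [DecidableEq α] (E : Finset (α × β)) (a : α) : ℕ := #{e ∈ E | e.1 = a}

/-- The number of pairs of `E` with second coordinate `b`. -/
def rightDeg [DecidableEq β] (E : Finset (α × β)) (b : β) : ℕ := #{e ∈ E | e.2 = b}

lemma sum_leftDeg [DecidableEq α] (E : Finset (α × β)) (A : Finset α) :
    ∑ a ∈ A, leftDeg E a = #{e ∈ E | e.1 ∈ A} := by
  rw [card_eq_sum_card_fiberwise (f := Prod.fst) (t := A) (by intro e he; simp_all)]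
  refine sum_congr rfl fun a ha => ?_
  unfold leftDeg
  congr 1
  ext e
  simp only [mem_filter]
  constructor
  · rintro ⟨h, rfl⟩; exact ⟨⟨h, ha⟩, rfl⟩
  · rintro ⟨⟨h, -⟩, h'⟩; exact ⟨h, h'⟩

lemma sum_rightDeg [DecidableEq β] (E : Finset (α × β)) (B : Finset β) :
    ∑ b ∈ B, rightDeg E b = #{e ∈ E | e.2 ∈ B} := by
  rw [card_eq_sum_card_fiberwise (f := Prod.snd) (t := B) (by intro e he; simp_all)]
  refine sum_congr rfl fun a ha => ?_
  unfold rightDeg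
  congr 1
  ext e
  simp only [mem_filter]
  constructor
  · rintro ⟨h, rfl⟩; exact ⟨⟨h, ha⟩, rfl⟩
  · rintro ⟨⟨h, -⟩, h'⟩; exact ⟨h, h'⟩

variable [DecidableEq α] [DecidableEq β]

/-- Every edge set can be trimmed so that left degrees are cut off at `m`. -/
lemma exists_subset_leftDeg_eq_min (E : Finset (α × β)) (m : ℕ) :
    ∃ F ⊆ E, ∀ a, leftDeg F a = min m (leftDeg E a) := by
  have h (a : α) : ∃ T ⊆ E.filter (fun e => e.1 = a), #T = min m (leftDeg E a) :=
    exists_subset_card_eq (min_le_right _ _)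
  choose T hT hc using h
  refine ⟨E.filter fun e => e ∈ T e.1, filter_subset _ _, fun a => ?_⟩
  rw [← hc a, leftDeg]
  congr 1
  ext e
  simp only [mem_filter]
  constructor
  · rintro ⟨⟨-, h⟩, rfl⟩; exact h
  · intro h
    have := hT a h
    simp only [mem_filter] at this
    obtain ⟨h1, rfl⟩ := this
    exact ⟨⟨h1, h⟩, rfl⟩

/-- A bipartite degree-constrained subgraph theorem with deficiency `z`. -/
lemma exists_degree_constrained_subset (E : Finset (α × β)) (A : Finset α) (m t z : ℕ)
    (hEA : ∀ e ∈ E, e.1 ∈ A) (hdeg : ∀ a ∈ A, m ≤ leftDeg E a)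
    (hcut : ∀ Z ⊆ A, ∀ Y : Finset β,
      m * #Z ≤ z + t * #Y + #{e ∈ E | e.1 ∈ Z ∧ e.2 ∉ Y}) :
    ∃ F ⊆ E, (∀ a, leftDeg F a ≤ m) ∧ (∀ b, rightDeg F b ≤ t) ∧ m * #A ≤ #F + z := by
  let slots : {e // e ∈ E} → Finset ((α × ℕ) ⊕ ((β × ℕ) ⊕ ℕ)) := fun e =>
    ({e.1.1} ×ˢ range (leftDeg E e.1.1 - m)).disjSum
      (({e.1.2} ×ˢ range t).disjSum (range z))
  have hall : ∀ s : Finset {e // e ∈ E}, #s ≤ #(s.biUnion slots) := by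
    intro s
    rcases s.eq_empty_or_nonempty with rfl | ⟨e₀, he₀⟩
    · simp
    let Z := s.image fun e => e.1.1
    let Y := s.image fun e => e.1.2
    have hsub : (Z.sigma fun a => range (leftDeg E a - m)).card + (t * #Y + z)
        ≤ #(s.biUnion slots) := by
      have : (((Z.sigma fun a => range (leftDeg E a - m)).map
          (Equiv.sigmaEquivProd α ℕ).toEmbedding).disjSum
          ((Y ×ˢ range t).disjSum (range z))) ⊆ s.biUnion slots := by
        rintro (⟨a, i⟩ | ⟨b, i⟩ | i) hx
        · simp only [inl_mem_disjSum, mem_map, mem_sigma, Z, mem_image] at hx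
          obtain ⟨⟨a', i'⟩, ⟨⟨e, he, he'⟩, hi⟩, hx⟩ := hx
          simp only [Equiv.toEmbedding_apply, Equiv.sigmaEquivProd_apply, Prod.mk.injEq] at hx he'
          obtain ⟨rfl, rfl⟩ := hx
          subst he'
          exact mem_biUnion.2 ⟨e, he, by simpa [slots] using hi⟩
        · simp only [inr_mem_disjSum, inl_mem_disjSum, mem_product, Y, mem_image] at hx
          obtain ⟨⟨e, he, rfl⟩, hi⟩ := hx
          exact mem_biUnion.2 ⟨e, he, by simpa [slots] using hi⟩
        · simp only [inr_mem_disjSum] at hx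
          exact mem_biUnion.2 ⟨e₀, he₀, by simpa [slots] using hx⟩
      have := card_le_card this
      simpa [card_disjSum, mul_comm t] using this
    refine le_trans ?_ hsub
    have hZA : Z ⊆ A := by
      intro a ha
      obtain ⟨e, -, rfl⟩ := mem_image.1 ha
      exact hEA _ e.2
    have h1 : #s ≤ #{e ∈ E | e.1 ∈ Z ∧ e.2 ∈ Y} := by
      rw [← card_map (Function.Embedding.subtype _)]
      refine card_le_card fun e he => ?_
      obtain ⟨e', he', rfl⟩ := mem_map.1 he
      exact mem_filter.2 ⟨e'.2, mem_image_of_mem _ he', mem_image_of_mem _ he'⟩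
    have h2 : #{e ∈ E | e.1 ∈ Z ∧ e.2 ∈ Y} + #{e ∈ E | e.1 ∈ Z ∧ e.2 ∉ Y}
        = ∑ a ∈ Z, leftDeg E a := by
      rw [sum_leftDeg, ← card_filter_add_card_filter_not (s := {e ∈ E | e.1 ∈ Z})
        (fun e => e.2 ∈ Y), filter_filter, filter_filter]
    have h3 : ∑ a ∈ Z, leftDeg E a = ∑ a ∈ Z, (leftDeg E a - m) + m * #Z := by
      rw [mul_comm, ← smul_eq_mul, ← sum_const, ← sum_add_distrib]
      exact sum_congr rfl fun a ha => by have := hdeg a (hZA ha); omega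
    have h4 := hcut Z hZA Y
    simp only [card_sigma, card_range]
    omega
  obtain ⟨f, hf, hmem⟩ := (all_card_le_biUnion_card_iff_exists_injective slots).1 hall
  classical
  let g : α × β → (α × ℕ) ⊕ ((β × ℕ) ⊕ ℕ) := fun e =>
    if h : e ∈ E then f ⟨e, h⟩ else .inr (.inr 0)
  have hgE (e) (he : e ∈ E) : g e = f ⟨e, he⟩ := dif_pos he
  have hginj : ∀ e ∈ E, ∀ e' ∈ E, g e = g e' → e = e' := by
    intro e he e' he' h
    rw [hgE e he, hgE e' he'] at h
    simpa using hf h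
  have hg : ∀ e ∈ E, (∃ i < leftDeg E e.1 - m, g e = .inl (e.1, i)) ∨
      (∃ i < t, g e = .inr (.inl (e.2, i))) ∨ ∃ i < z, g e = .inr (.inr i) := by
    intro e he
    have := hmem ⟨e, he⟩
    rw [← hgE e he] at this
    rcases hx : g e with ⟨a, i⟩ | ⟨b, i⟩ | i
    · left
      simp only [hx, slots, inl_mem_disjSum, mem_product, mem_singleton, mem_range] at this
      exact ⟨i, this.2, by rw [this.1]⟩
    · right; left
      simp only [hx, slots, inl_mem_disjSum, inr_mem_disjSum, mem_product, mem_singleton,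
        mem_range] at this
      exact ⟨i, this.2, by rw [this.1]⟩
    · right; right
      simp only [hx, slots, inr_mem_disjSum, mem_range] at this
      exact ⟨i, this, rfl⟩
  let P := E.filter fun e => ∃ x, g e = .inl x
  let F₀ := E.filter fun e => ∃ x, g e = .inr (.inl x)
  let R := E.filter fun e => ∃ x, g e = .inr (.inr x)
  have hP (a : α) : leftDeg P a ≤ leftDeg E a - m := by
    have : ({e ∈ P | e.1 = a}).image g ⊆ (range (leftDeg E a - m)).image fun i => .inl (a, i) := by
      intro y hy
      obtain ⟨e, he, rfl⟩ := mem_image.1 hy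
      obtain ⟨he₁, rfl⟩ := mem_filter.1 he
      obtain ⟨he, x, hx⟩ := mem_filter.1 he₁
      rcases hg e he with ⟨i, hi, h⟩ | ⟨i, hi, h⟩ | ⟨i, hi, h⟩
      · exact mem_image.2 ⟨i, mem_range.2 hi, h.symm⟩
      all_goals simp [hx] at h
    have h2 := (card_le_card this).trans card_image_le
    rwa [card_range, card_image_of_injOn] at h2
    intro e he e' he' h
    simp only [coe_filter, Set.mem_ofPred_eq, P, mem_filter] at he he'
    exact hginj e he.1.1 e' he'.1.1 h
  have hF₀ (b : β) : rightDeg F₀ b ≤ t := by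
    have : ({e ∈ F₀ | e.2 = b}).image g ⊆ (range t).image fun i => .inr (.inl (b, i)) := by
      intro y hy
      obtain ⟨e, he, rfl⟩ := mem_image.1 hy
      obtain ⟨he₁, rfl⟩ := mem_filter.1 he
      obtain ⟨he, x, hx⟩ := mem_filter.1 he₁
      rcases hg e he with ⟨i, hi, h⟩ | ⟨i, hi, h⟩ | ⟨i, hi, h⟩
      · simp [hx] at h
      · exact mem_image.2 ⟨i, mem_range.2 hi, h.symm⟩
      · simp [hx] at h
    have h2 := (card_le_card this).trans card_image_le
    rwa [card_range, card_image_of_injOn] at h2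
    intro e he e' he' h
    simp only [coe_filter, Set.mem_ofPred_eq, F₀, mem_filter] at he he'
    exact hginj e he.1.1 e' he'.1.1 h
  have hR : #R ≤ z := by
    have : R.image g ⊆ (range z).image fun i => .inr (.inr i) := by
      intro y hy
      obtain ⟨e, he, rfl⟩ := mem_image.1 hy
      obtain ⟨he, x, hx⟩ := mem_filter.1 he
      rcases hg e he with ⟨i, hi, h⟩ | ⟨i, hi, h⟩ | ⟨i, hi, h⟩
      · simp [hx] at h
      · simp [hx] at h
      · exact mem_image.2 ⟨i, mem_range.2 hi, h.symm⟩
    have h2 := (card_le_card this).trans card_image_le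
    rwa [card_range, card_image_of_injOn] at h2
    intro e he e' he' h
    exact hginj e (mem_filter.1 he).1 e' (mem_filter.1 he').1 h
  have hsplit (a : α) : leftDeg E a ≤ leftDeg P a + leftDeg F₀ a + leftDeg R a := by
    refine (card_le_card ?_).trans
      ((card_union_le ({e ∈ P | e.1 = a} ∪ {e ∈ F₀ | e.1 = a}) {e ∈ R | e.1 = a}).trans
        (Nat.add_le_add_right (card_union_le _ _) _))
    intro e hea
    obtain ⟨he, rfl⟩ := mem_filter.1 hea
    simp only [mem_union, mem_filter, P, F₀, R, he, true_and, and_true]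
    rcases hg e he with ⟨i, -, h⟩ | ⟨i, -, h⟩ | ⟨i, -, h⟩ <;> simp [h]
  have hF₀E : F₀ ⊆ E := filter_subset _ _
  obtain ⟨F, hF, hFd⟩ := exists_subset_leftDeg_eq_min F₀ m
  refine ⟨F, hF.trans hF₀E, fun a => by simp [hFd], fun b => ?_, ?_⟩
  · exact (card_le_card (filter_subset_filter _ hF)).trans (hF₀ b)
  · have h1 : ∑ a ∈ A, m ≤ ∑ a ∈ A, (leftDeg F a + leftDeg R a) := by
      refine sum_le_sum fun a ha => ?_
      have h1 := hsplit a
      have h2 := hP a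
      have h3 := hdeg a ha
      rw [hFd]
      omega
    rw [sum_const, smul_eq_mul, sum_add_distrib, sum_leftDeg, sum_leftDeg] at h1
    have h2 := card_filter_le F fun e => e.1 ∈ A
    have h3 := card_filter_le R fun e => e.1 ∈ A
    rw [mul_comm]
    omega

/-- Alon-Friedland-Kalai: a bipartite graph with degrees at most `2p - 1` and more than
`(p - 1)` times as many edges as vertices contains a `p`-regular subgraph. -/
lemma exists_prime_regular_subset (p : ℕ) [Fact p.Prime] (E : Finset (α × β))
    (A : Finset α) (B : Finset β) (hA : ∀ e ∈ E, e.1 ∈ A) (hB : ∀ e ∈ E, e.2 ∈ B)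
    (hl : ∀ a, leftDeg E a < 2 * p) (hr : ∀ b, rightDeg E b < 2 * p)
    (hcard : (p - 1) * (#A + #B) < #E) :
    ∃ F ⊆ E, F.Nonempty ∧ (∀ a, leftDeg F a = 0 ∨ leftDeg F a = p) ∧
      ∀ b, rightDeg F b = 0 ∨ rightDeg F b = p := by
  classical
  have hp : p.Prime := Fact.out
  let inc : α ⊕ β → Finset {e // e ∈ E} := Sum.elim
    (fun a => univ.filter fun e => e.1.1 = a) (fun b => univ.filter fun e => e.1.2 = b)
  let f : α ⊕ β → MvPolynomial {e // e ∈ E} (ZMod p) := fun v =>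
    ∑ e ∈ inc v, MvPolynomial.X e ^ (p - 1)
  have hdeg (v) : (f v).totalDegree ≤ p - 1 := by
    refine MvPolynomial.totalDegree_finsetSum_le fun e _ => ?_
    refine (MvPolynomial.totalDegree_pow _ _).trans ?_
    simp
  have hsum : ∑ v ∈ A.disjSum B, (f v).totalDegree < Fintype.card {e // e ∈ E} := by
    refine lt_of_le_of_lt (sum_le_card_nsmul _ _ (p - 1) fun v _ => hdeg v) ?_
    rw [card_disjSum, smul_eq_mul, mul_comm]
    simpa using hcard
  have hdvd := char_dvd_card_solutions_of_sum_lt p hsum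
  have h0 : ∀ v ∈ A.disjSum B, MvPolynomial.eval (0 : {e // e ∈ E} → ZMod p) (f v) = 0 := by
    intro v _
    simp [f, hp.one_lt, Nat.sub_eq_zero_iff_le]
  have : Nontrivial {x : {e // e ∈ E} → ZMod p //
      ∀ v ∈ A.disjSum B, MvPolynomial.eval x (f v) = 0} := by
    rw [← Fintype.one_lt_card_iff_nontrivial]
    have hpos := Fintype.card_pos_iff.2 (⟨⟨0, h0⟩⟩ : Nonempty {x : {e // e ∈ E} → ZMod p //
      ∀ v ∈ A.disjSum B, MvPolynomial.eval x (f v) = 0})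
    exact lt_of_lt_of_le hp.one_lt (Nat.le_of_dvd hpos hdvd)
  obtain ⟨⟨x, hx⟩, hne⟩ := exists_ne (⟨0, h0⟩ : {x : {e // e ∈ E} → ZMod p //
      ∀ v ∈ A.disjSum B, MvPolynomial.eval x (f v) = 0})
  replace hne : x ≠ 0 := fun h => hne (Subtype.ext h)
  let F : Finset (α × β) :=
    (univ.filter fun e => x e ≠ 0).map (Function.Embedding.subtype _)
  have hFE : F ⊆ E := by
    intro e he
    obtain ⟨e', -, rfl⟩ := mem_map.1 he
    exact e'.2
  have heval (v) (hv : v ∈ A.disjSum B) : p ∣ #{e ∈ inc v | x e ≠ 0} := by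
    rw [← ZMod.natCast_eq_zero_iff]
    refine Eq.trans ?_ (hx v hv)
    simp only [f, map_sum, map_pow, MvPolynomial.eval_X, card_filter, Nat.cast_sum]
    refine sum_congr rfl fun e _ => ?_
    by_cases h : x e = 0
    · simp [h, Nat.sub_eq_zero_iff_le, hp.one_lt]
    · simp [h, ZMod.pow_card_sub_one_eq_one h]
  have hmul (n : ℕ) (h1 : p ∣ n) (h2 : n < 2 * p) : n = 0 ∨ n = p := by
    obtain ⟨c, rfl⟩ := h1
    have : c < 2 := by
      by_contra! h
      nlinarith [hp.pos]
    interval_cases c <;> simp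
  refine ⟨F, hFE, ?_, fun a => ?_, fun b => ?_⟩
  · obtain ⟨e, he⟩ := Function.ne_iff.1 hne
    exact ⟨e.1, mem_map_of_mem _ (by simpa using he)⟩
  · refine hmul _ ?_ ((card_le_card (filter_subset_filter _ hFE)).trans_lt (hl a))
    by_cases ha : a ∈ A
    · convert heval (.inl a) (by simpa using ha) using 1
      rw [leftDeg, ← card_map (Function.Embedding.subtype _)]
      congr 1
      ext e
      simp [F, inc]
      tauto
    · have : leftDeg F a = 0 := by
        rw [leftDeg, card_eq_zero, filter_eq_empty_iff]
        rintro e he rfl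
        exact ha (hA e (hFE he))
      simp [this]
  · refine hmul _ ?_ ((card_le_card (filter_subset_filter _ hFE)).trans_lt (hr b))
    by_cases hb : b ∈ B
    · convert heval (.inr b) (by simpa using hb) using 1
      rw [rightDeg, ← card_map (Function.Embedding.subtype _)]
      congr 1
      ext e
      simp [F, inc]
      tauto
    · have : rightDeg F b = 0 := by
        rw [rightDeg, card_eq_zero, filter_eq_empty_iff]
        rintro e he rfl
        exact hb (hB e (hFE he))
      simp [this]

/-- Derandomised second moment method. -/
lemma exists_subset_sum_sq_sub_le {ι : Type*} (S : Finset α) (Y : Finset ι) (h : α → ι → ℝ)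
    (c : ι → ℝ) (q w : ℝ) (hq : 0 ≤ q) (hq1 : q ≤ 1) :
    ∃ T ⊆ S, ∑ b ∈ Y, (∑ a ∈ T, h a b - c b) ^ 2 - w * #T ≤
      ∑ b ∈ Y, ((q * ∑ a ∈ S, h a b - c b) ^ 2 + q * (1 - q) * ∑ a ∈ S, h a b ^ 2)
        - w * (q * #S) := by
  induction S using Finset.induction_on generalizing c with
  | empty => exact ⟨∅, by simp⟩
  | insert a S ha ih =>
    obtain ⟨T₁, hT₁, h₁⟩ := ih (fun b => c b - h a b)
    obtain ⟨T₂, hT₂, h₂⟩ := ih c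
    have key : ∑ b ∈ Y, ((q * ∑ a ∈ insert a S, h a b - c b) ^ 2 +
          q * (1 - q) * ∑ a ∈ insert a S, h a b ^ 2) - w * (q * #(insert a S)) =
        q * (∑ b ∈ Y, ((q * ∑ a ∈ S, h a b - (c b - h a b)) ^ 2 +
          q * (1 - q) * ∑ a ∈ S, h a b ^ 2) - w * (q * #S) - w) +
        (1 - q) * (∑ b ∈ Y, ((q * ∑ a ∈ S, h a b - c b) ^ 2 +
          q * (1 - q) * ∑ a ∈ S, h a b ^ 2) - w * (q * #S)) := by
      have : ∑ b ∈ Y, ((q * ∑ a ∈ insert a S, h a b - c b) ^ 2 +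
          q * (1 - q) * ∑ a ∈ insert a S, h a b ^ 2) =
        q * (∑ b ∈ Y, ((q * ∑ a ∈ S, h a b - (c b - h a b)) ^ 2 +
          q * (1 - q) * ∑ a ∈ S, h a b ^ 2)) +
        (1 - q) * (∑ b ∈ Y, ((q * ∑ a ∈ S, h a b - c b) ^ 2 +
          q * (1 - q) * ∑ a ∈ S, h a b ^ 2)) := by
        rw [mul_sum, mul_sum, ← sum_add_distrib]
        refine sum_congr rfl fun b _ => ?_
        rw [sum_insert ha, sum_insert ha]
        ring
      rw [this, card_insert_of_notMem ha]
      push_cast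
      ring
    rw [key]
    set X := ∑ b ∈ Y, ((q * ∑ a ∈ S, h a b - (c b - h a b)) ^ 2 +
          q * (1 - q) * ∑ a ∈ S, h a b ^ 2) - w * (q * #S) - w with hX
    set X' := ∑ b ∈ Y, ((q * ∑ a ∈ S, h a b - c b) ^ 2 +
          q * (1 - q) * ∑ a ∈ S, h a b ^ 2) - w * (q * #S) with hX'
    rcases le_total X X' with hle | hle
    · refine ⟨insert a T₁, insert_subset_insert _ hT₁, ?_⟩
      have haT : a ∉ T₁ := fun h => ha (hT₁ h)
      have : ∑ b ∈ Y, (∑ a ∈ insert a T₁, h a b - c b) ^ 2 - w * #(insert a T₁) ≤ X := by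
        rw [card_insert_of_notMem haT]
        have h3 : ∑ b ∈ Y, (∑ a ∈ insert a T₁, h a b - c b) ^ 2 =
            ∑ b ∈ Y, (∑ a ∈ T₁, h a b - (c b - h a b)) ^ 2 := by
          refine sum_congr rfl fun b _ => ?_
          rw [sum_insert haT]; ring
        rw [h3]; push_cast; linarith
      nlinarith
    · refine ⟨T₂, hT₂.trans (subset_insert _ _), ?_⟩
      nlinarith

lemma card_filter_fst_mem (E : Finset (α × β)) (Z : Finset α) (Y : Finset β) :
    #{e ∈ E | e.1 ∈ Z} = #{e ∈ E | e.1 ∈ Z ∧ e.2 ∈ Y} + #{e ∈ E | e.1 ∈ Z ∧ e.2 ∉ Y} := by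
  rw [← card_filter_add_card_filter_not (s := {e ∈ E | e.1 ∈ Z})
    (fun e => e.2 ∈ Y), filter_filter, filter_filter]

/-- A `p`-regular bipartite graph contains a `k`-regular subgraph for every `k ≤ p`. -/
lemma exists_regular_subset_of_le (E : Finset (α × β)) (hE : E.Nonempty) (p k : ℕ) (hk : 0 < k)
    (hkp : k ≤ p) (hl : ∀ a, leftDeg E a = 0 ∨ leftDeg E a = p)
    (hr : ∀ b, rightDeg E b = 0 ∨ rightDeg E b = p) :
    ∃ F ⊆ E, F.Nonempty ∧ (∀ a, leftDeg F a = 0 ∨ leftDeg F a = k) ∧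
      ∀ b, rightDeg F b = 0 ∨ rightDeg F b = k := by
  let A := E.image Prod.fst
  let B := E.image Prod.snd
  have hA (e) (he : e ∈ E) : e.1 ∈ A := mem_image_of_mem _ he
  have hB (e) (he : e ∈ E) : e.2 ∈ B := mem_image_of_mem _ he
  have hlA (a) (ha : a ∈ A) : leftDeg E a = p := by
    obtain ⟨e, he, rfl⟩ := mem_image.1 ha
    exact (hl e.1).resolve_left (card_ne_zero_of_mem (mem_filter.2 ⟨he, rfl⟩))
  have hrB (b) (hb : b ∈ B) : rightDeg E b = p := by
    obtain ⟨e, he, rfl⟩ := mem_image.1 hb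
    exact (hr e.2).resolve_left (card_ne_zero_of_mem (mem_filter.2 ⟨he, rfl⟩))
  have hcardA : #A * p = #E := by
    rw [← smul_eq_mul, ← sum_const, ← sum_congr rfl hlA, sum_leftDeg, filter_true_of_mem hA]
  have hcardB : #B * p = #E := by
    rw [← smul_eq_mul, ← sum_const, ← sum_congr rfl hrB, sum_rightDeg, filter_true_of_mem hB]
  have hAB : #A = #B := Nat.eq_of_mul_eq_mul_right (hk.trans_le hkp) (hcardA.trans hcardB.symm)
  obtain ⟨F, hFE, hFl, hFr, hF⟩ := exists_degree_constrained_subset E A k k 0 hA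
    (fun a ha => by rw [hlA a ha]; exact hkp) (by
      intro Z hZ Y
      have h1 : #Z * p = #{e ∈ E | e.1 ∈ Z} := by
        rw [← smul_eq_mul, ← sum_const, ← sum_leftDeg]
        exact sum_congr rfl fun a ha => (hlA a (hZ ha)).symm
      have h2 : #{e ∈ E | e.1 ∈ Z ∧ e.2 ∈ Y} ≤ #Y * p := by
        rw [← smul_eq_mul, ← sum_const]
        calc _ ≤ #{e ∈ E | e.2 ∈ Y} := by
              refine card_le_card fun e he => ?_
              simp only [mem_filter] at he ⊢
              exact ⟨he.1, he.2.2⟩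
          _ = ∑ b ∈ Y, rightDeg E b := (sum_rightDeg _ _).symm
          _ ≤ _ := sum_le_sum fun b _ => by rcases hr b with h | h <;> simp [h]
      rw [card_filter_fst_mem E Z Y] at h1
      refine Nat.le_of_mul_le_mul_left ?_ (hk.trans_le hkp)
      have h3 : k * (#Z * p) ≤ k * (#Y * p + #{e ∈ E | e.1 ∈ Z ∧ e.2 ∉ Y}) :=
        Nat.mul_le_mul_left _ (by omega)
      have h4 := Nat.mul_le_mul_right #{e ∈ E | e.1 ∈ Z ∧ e.2 ∉ Y} hkp
      nlinarith)
  have hlsum : ∑ a ∈ A, leftDeg F a = #F := by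
    rw [sum_leftDeg, filter_true_of_mem fun e he => hA e (hFE he)]
  have hrsum : ∑ b ∈ B, rightDeg F b = #F := by
    rw [sum_rightDeg, filter_true_of_mem fun e he => hB e (hFE he)]
  have hle : #F ≤ #A * k := by
    rw [← hlsum, ← smul_eq_mul, ← sum_const]; exact sum_le_sum fun a _ => hFl a
  have heq : #F = #A * k := le_antisymm hle (by linarith)
  refine ⟨F, hFE, ?_, fun a => ?_, fun b => ?_⟩
  · rw [← card_pos, heq]
    exact Nat.mul_pos (card_pos.2 (hE.image _)) hk
  · by_cases ha : a ∈ A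
    · right
      refine (sum_eq_sum_iff_of_le fun a _ => hFl a).1 ?_ a ha
      rw [hlsum, heq, sum_const, smul_eq_mul]
    · left
      rw [leftDeg, card_eq_zero, filter_eq_empty_iff]
      rintro e he rfl
      exact ha (hA e (hFE he))
  · by_cases hb : b ∈ B
    · right
      refine (sum_eq_sum_iff_of_le fun b _ => hFr b).1 ?_ b hb
      rw [hrsum, heq, sum_const, smul_eq_mul, hAB]
    · left
      rw [rightDeg, card_eq_zero, filter_eq_empty_iff]
      rintro e he rfl
      exact hb (hB e (hFE he))

/-- An almost biregular bipartite graph of suitable constant degree on its larger side contains a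
`p`-regular subgraph. -/
lemma exists_prime_regular_subset_of_biregular (p m : ℕ) [Fact p.Prime] (hm : m + 1 = 2 * p)
    (E : Finset (α × β)) (S : Finset α) (Y : Finset β) (hY : Y.Nonempty) (hYS : #Y ≤ #S)
    (hES : ∀ e ∈ E, e.1 ∈ S) (hEY : ∀ e ∈ E, e.2 ∈ Y)
    (hl : ∀ a ∈ S, leftDeg E a = 16 * m ^ 2)
    (hr : ∀ b ∈ Y, (rightDeg E b : ℝ) * #Y ≤ (16 * m ^ 2 + 2 * m) * #S) :
    ∃ F ⊆ E, F.Nonempty ∧ (∀ a, leftDeg F a = 0 ∨ leftDeg F a = p) ∧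
      ∀ b, rightDeg F b = 0 ∨ rightDeg F b = p := by
  have hp : p.Prime := Fact.out
  have hm1 : 1 ≤ m := by have := hp.two_le; omega
  have hmR : (1 : ℝ) ≤ m := by exact_mod_cast hm1
  have hpR : (m : ℝ) + 1 = 2 * p := by exact_mod_cast hm
  have hYpos : (0 : ℝ) < #Y := by exact_mod_cast hY.card_pos
  have hYSR : (#Y : ℝ) ≤ #S := by exact_mod_cast hYS
  have hSpos : (0 : ℝ) < #S := hYpos.trans_le hYSR
  set q : ℝ := #Y / #S with hq
  have hq0 : 0 ≤ q := by positivity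
  have hq1 : q ≤ 1 := by rw [hq, div_le_one hSpos]; exact hYSR
  have hqS : q * #S = #Y := by rw [hq]; field_simp
  let h : α → β → ℝ := fun a b => if (a, b) ∈ E then 1 else 0
  have hh (T : Finset α) (b : β) :
      ∑ a ∈ T, h a b = rightDeg (E.filter fun e => e.1 ∈ T) b := by
    simp only [h, sum_boole, rightDeg, Nat.cast_inj]
    refine card_bij (fun a _ => (a, b)) ?_ ?_ ?_
    · intro a ha
      simp only [mem_filter] at ha ⊢
      exact ⟨⟨ha.2, ha.1⟩, trivial⟩
    · intro a _ a' _ h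
      exact (Prod.mk.inj h).1
    · rintro ⟨a, b'⟩ he
      simp only [mem_filter] at he
      obtain ⟨⟨h1, h2⟩, rfl⟩ := he
      exact ⟨a, by simp [h1, h2], rfl⟩
  have hsq (a b) : h a b ^ 2 = h a b := by
    by_cases hab : (a, b) ∈ E <;> simp [h, hab]
  have hcard : (#E : ℝ) = 16 * m ^ 2 * #S := by
    have : ∑ a ∈ S, leftDeg E a = #E := by
      rw [sum_leftDeg, filter_true_of_mem hES]
    rw [sum_congr rfl hl, sum_const, smul_eq_mul] at this
    rw [← this]; push_cast; ring
  have hcardr : ∑ b ∈ Y, (rightDeg E b : ℝ) = #E := by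
    rw [← Nat.cast_sum, sum_rightDeg, filter_true_of_mem hEY]
  have hqr (b) (hb : b ∈ Y) : q * rightDeg E b ≤ 16 * m ^ 2 + 2 * m := by
    rw [hq, div_mul_eq_mul_div, div_le_iff₀ hSpos]
    linarith [hr b hb]
  set M : ℝ := 16 * m + 3 with hM
  obtain ⟨T, hTS, hT⟩ := exists_subset_sum_sq_sub_le S Y h (fun b => q * rightDeg E b) q
    (4 * m * (16 * m ^ 2 - M * (m - 1) / 2)) hq0 hq1
  simp only [hsq, hh, filter_true_of_mem hES, sub_self, hqS] at hT
  set E₂ := E.filter fun e => e.1 ∈ T with hE₂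
  set Q : ℝ := ∑ b ∈ Y, ((rightDeg E₂ b : ℝ) - q * rightDeg E b) ^ 2 with hQ
  have hQ0 : 0 ≤ Q := sum_nonneg fun _ _ => sq_nonneg _
  have hvar : ∑ b ∈ Y, ((0 : ℝ) ^ 2 + q * (1 - q) * rightDeg E b) ≤ 16 * (m : ℝ) ^ 2 * (#Y : ℝ) := by
    simp only [ne_eq, OfNat.ofNat_ne_zero, not_false_eq_true, zero_pow, zero_add]
    rw [← mul_sum, hcardr, hcard, ← hqS]
    have : 0 ≤ q ^ 2 * (16 * (m : ℝ) ^ 2 * #S) := by positivity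
    nlinarith
  have hMpos : 1 ≤ M := by rw [hM]; linarith
  have hl₂ (a) (ha : a ∈ T) : leftDeg E₂ a = 16 * m ^ 2 := by
    rw [← hl a (hTS ha), leftDeg, leftDeg]
    congr 1
    ext e
    simp only [hE₂, mem_filter]
    constructor
    · rintro ⟨⟨h, -⟩, h'⟩; exact ⟨h, h'⟩
    · rintro ⟨h, rfl⟩; exact ⟨⟨h, ha⟩, rfl⟩
  set z : ℝ := (Q / (4 * m) + 3 * m * #T) / M with hz
  have hz0 : 0 ≤ z := by positivity
  have hcut : ∀ Z ⊆ T, ∀ Y₁ : Finset β,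
      m * #Z ≤ ⌊z⌋₊ + m * #Y₁ + #{e ∈ E₂ | e.1 ∈ Z ∧ e.2 ∉ Y₁} := by
    intro Z hZ Y₁
    have h1 : 16 * (m : ℝ) ^ 2 * #Z =
        #{e ∈ E₂ | e.1 ∈ Z ∧ e.2 ∈ Y₁} + #{e ∈ E₂ | e.1 ∈ Z ∧ e.2 ∉ Y₁} := by
      rw [← Nat.cast_add, ← card_filter_fst_mem, ← sum_leftDeg,
        sum_congr rfl fun a ha => hl₂ a (hZ ha), sum_const, smul_eq_mul]
      push_cast; ring
    have h2 : (#{e ∈ E₂ | e.1 ∈ Z ∧ e.2 ∈ Y₁} : ℝ) ≤ m * M * #Y₁ + Q / (4 * m) := by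
      calc (#{e ∈ E₂ | e.1 ∈ Z ∧ e.2 ∈ Y₁} : ℝ) ≤ #{e ∈ E₂ | e.2 ∈ Y ∩ Y₁} := by
            refine Nat.cast_le.2 (card_le_card fun e he => ?_)
            simp only [mem_filter, mem_inter] at he ⊢
            exact ⟨he.1, hEY e (filter_subset _ _ he.1), he.2.2⟩
        _ = ∑ b ∈ Y ∩ Y₁, (rightDeg E₂ b : ℝ) := by
            rw [← sum_rightDeg, Nat.cast_sum]
        _ ≤ ∑ b ∈ Y ∩ Y₁, (m * M + ((rightDeg E₂ b : ℝ) - q * rightDeg E b) ^ 2 / (4 * m)) := by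
            refine sum_le_sum fun b hb => ?_
            have h3 := hqr b (mem_inter.1 hb).1
            set x := (rightDeg E₂ b : ℝ) - q * rightDeg E b with hx
            have h4 : x ≤ m + x ^ 2 / (4 * m) := by
              have : m + x ^ 2 / (4 * m) - x = (x - 2 * m) ^ 2 / (4 * m) := by
                field_simp; ring
              have : 0 ≤ (x - 2 * m) ^ 2 / (4 * m) := by positivity
              linarith
            rw [hM]
            nlinarith
        _ = m * M * #(Y ∩ Y₁) +
            (∑ b ∈ Y ∩ Y₁, ((rightDeg E₂ b : ℝ) - q * rightDeg E b) ^ 2) / (4 * m) := by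
            rw [sum_add_distrib, sum_const, nsmul_eq_mul, sum_div]; ring
        _ ≤ m * M * #Y₁ + Q / (4 * m) := by
            gcongr
            · exact inter_subset_right
            · exact sum_le_sum_of_subset_of_nonneg inter_subset_left fun _ _ _ => sq_nonneg _
    have h3 : (#Z : ℝ) ≤ #T := by exact_mod_cast card_le_card hZ
    have h4 : (m : ℝ) * #Z ≤ z + m * #Y₁ + #{e ∈ E₂ | e.1 ∈ Z ∧ e.2 ∉ Y₁} := by
      set x : ℝ := ((#{e ∈ E₂ | e.1 ∈ Z ∧ e.2 ∉ Y₁} : ℕ) : ℝ) with hx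
      have hx0 : 0 ≤ x := by positivity
      have hzM : z * M = Q / (4 * m) + 3 * m * #T := by rw [hz]; field_simp
      have h5 : (m : ℝ) * #Z * M ≤ (z + m * #Y₁ + x) * M := by
        have h6 : x ≤ x * M := le_mul_of_one_le_right hx0 hMpos
        have h7 : (m : ℝ) * #Z * M = 16 * m ^ 2 * #Z + 3 * m * #Z := by rw [hM]; ring
        have h8 : 3 * (m : ℝ) * #Z ≤ 3 * m * #T := by gcongr
        rw [add_mul, add_mul, hzM, h7]
        linarith
      exact le_of_mul_le_mul_right h5 (by linarith)
    have h5 : m * #Z - m * #Y₁ - #{e ∈ E₂ | e.1 ∈ Z ∧ e.2 ∉ Y₁} ≤ ⌊z⌋₊ := by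
      by_cases h6 : m * #Z ≤ m * #Y₁ + #{e ∈ E₂ | e.1 ∈ Z ∧ e.2 ∉ Y₁}
      · omega
      refine Nat.le_floor ?_
      rw [Nat.sub_sub, Nat.cast_sub (by omega)]
      push_cast
      linarith
    omega
  obtain ⟨F, hFE, hFl, hFr, hF⟩ := exists_degree_constrained_subset E₂ T m m ⌊z⌋₊
    (fun e he => (mem_filter.1 he).2) (fun a ha => by rw [hl₂ a ha]; nlinarith) hcut
  have hFE' : F ⊆ E := hFE.trans (filter_subset _ _)
  have hFR : (m : ℝ) * #T ≤ #F + z := by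
    have h1 : (m : ℝ) * #T ≤ #F + ⌊z⌋₊ := by exact_mod_cast hF
    linarith [Nat.floor_le hz0]
  have hlt : (p - 1) * (#T + #Y) < #F := by
    have h1 : ((p - 1 : ℕ) : ℝ) = (m - 1) / 2 := by
      rw [Nat.cast_sub hp.one_le]; push_cast; linarith
    have h2 : ((m : ℝ) - 1) / 2 * (#T + #Y) < #F := by
      have hzM : z * M * (4 * m) = Q + 12 * m ^ 2 * #T := by
        rw [hz]; field_simp; ring
      have h3 : (m : ℝ) * #T * (M * (4 * m)) ≤ (#F + z) * (M * (4 * m)) := by gcongr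
      have h4 : ((m : ℝ) - 1) / 2 * (#T + #Y) * (M * (4 * m)) < #F * (M * (4 * m)) := by
        have h5 : 0 < (36 * (m : ℝ) ^ 2 + 12 * m) * #Y := by positivity
        have h6 := hT.trans (sub_le_sub_right hvar _)
        rw [hM] at h3 h6 hzM ⊢
        nlinarith
      exact lt_of_mul_lt_mul_right h4 (by positivity)
    rw [← Nat.cast_lt (α := ℝ)]
    push_cast [h1]
    exact h2
  obtain ⟨F', hF'F, hF'⟩ := exists_prime_regular_subset p F T Y
    (fun e he => (mem_filter.1 (hFE he)).2) (fun e he => hEY e (hFE' he))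
    (fun a => (hFl a).trans_lt (by omega)) (fun b => (hFr b).trans_lt (by omega)) hlt
  exact ⟨F', hF'F.trans hFE', hF'⟩

lemma leftDeg_filter_fst_mem (E : Finset (α × β)) (S : Finset α) (Y : Finset β) (a : α)
    (ha : a ∈ S) :
    leftDeg (E.filter fun e => e.1 ∈ S ∧ e.2 ∈ Y) a = leftDeg (E.filter fun e => e.2 ∈ Y) a := by
  unfold leftDeg
  congr 1
  ext e
  simp only [mem_filter]
  constructor
  · rintro ⟨⟨h, -, h'⟩, rfl⟩; exact ⟨⟨h, h'⟩, rfl⟩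
  · rintro ⟨⟨h, h'⟩, rfl⟩; exact ⟨⟨h, ha, h'⟩, rfl⟩

/-- One step of the density increment: either `E` restricted to `S × Y` contains an almost
biregular subgraph, or there are `S' ⊆ S` and `Y' ⊆ Y` with a larger ratio `#S' / #Y'` such that
the vertices of `S'` lose few neighbours when passing from `Y` to `Y'`. -/
lemma biregular_or_ratio_increment (E : Finset (α × β)) (S : Finset α) (Y : Finset β)
    (W K : ℕ) (hK : 2 ≤ K) (hW : 0 < W) (hY : Y.Nonempty)
    (hl : ∀ a ∈ S, W ≤ leftDeg (E.filter fun e => e.2 ∈ Y) a) :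
    (∃ F ⊆ E, (∀ e ∈ F, e.1 ∈ S) ∧ (∀ e ∈ F, e.2 ∈ Y) ∧ (∀ a ∈ S, leftDeg F a = W) ∧
      ∀ b, (rightDeg F b : ℝ) ≤ (1 + 1 / K) * W * #S / #Y + 1) ∨
    ∃ S' ⊆ S, ∃ Y' ⊆ Y, S'.Nonempty ∧ (1 + 1 / (4 * K) : ℝ) * #S * #Y' ≤ #S' * #Y ∧
      ∀ a ∈ S', leftDeg (E.filter fun e => e.2 ∈ Y) a ≤
        leftDeg (E.filter fun e => e.2 ∈ Y') a + 2 * K * W := by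
  have hYpos : (0 : ℝ) < #Y := by exact_mod_cast hY.card_pos
  have hKR : (2 : ℝ) ≤ K := by exact_mod_cast hK
  have hWR : (0 : ℝ) < W := by exact_mod_cast hW
  set E' := E.filter fun e => e.1 ∈ S ∧ e.2 ∈ Y with hE'
  set x : ℝ := (1 + 1 / K) * W * #S / #Y with hx
  have hx0 : 0 ≤ x := by positivity
  have hl' (a) (ha : a ∈ S) : leftDeg E' a = leftDeg (E.filter fun e => e.2 ∈ Y) a :=
    leftDeg_filter_fst_mem E S Y a ha
  by_cases hcut : ∀ Z ⊆ S, ∀ Y₁ : Finset β,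
      W * #Z ≤ 0 + ⌈x⌉₊ * #Y₁ + #{e ∈ E' | e.1 ∈ Z ∧ e.2 ∉ Y₁}
  · left
    obtain ⟨F, hFE, hFl, hFr, hF⟩ := exists_degree_constrained_subset E' S W ⌈x⌉₊ 0
      (fun e he => (mem_filter.1 he).2.1) (fun a ha => by rw [hl' a ha]; exact hl a ha) hcut
    have hS (e) (he : e ∈ F) : e.1 ∈ S := (mem_filter.1 (hFE he)).2.1
    refine ⟨F, hFE.trans (filter_subset _ _), hS, fun e he => (mem_filter.1 (hFE he)).2.2, ?_, ?_⟩
    · refine (sum_eq_sum_iff_of_le fun a _ => hFl a).1 (le_antisymm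
        (sum_le_sum fun a _ => hFl a) ?_)
      rw [sum_leftDeg, filter_true_of_mem hS, sum_const, smul_eq_mul]
      linarith
    · intro b
      calc (rightDeg F b : ℝ) ≤ ⌈x⌉₊ := by exact_mod_cast hFr b
        _ ≤ x + 1 := (Nat.ceil_lt_add_one hx0).le
  · right
    push Not at hcut
    obtain ⟨Z, hZ, Y₁, hlt⟩ := hcut
    let bad : Finset (α × β) := {e ∈ E' | e.1 ∈ Z ∧ e.2 ∉ Y₁}
    change 0 + ⌈x⌉₊ * #Y₁ + #bad < W * #Z at hlt
    have hbad : #{a ∈ Z | 2 * K * W < leftDeg bad a} * (2 * K * W) ≤ #bad := by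
      rw [← smul_eq_mul]
      calc _ ≤ ∑ a ∈ Z with 2 * K * W < leftDeg bad a, leftDeg bad a :=
            card_nsmul_le_sum _ _ _ fun a ha => (mem_filter.1 ha).2.le
        _ ≤ #bad := by
            rw [sum_leftDeg]; exact card_filter_le _ _
    let S' := Z.filter fun a => leftDeg bad a ≤ 2 * K * W
    have hZS' : #S' + #{a ∈ Z | 2 * K * W < leftDeg bad a} = #Z := by
      rw [← card_filter_add_card_filter_not (s := Z) fun a => leftDeg bad a ≤ 2 * K * W]
      simp [S']
    set n := #{a ∈ Z | 2 * K * W < leftDeg bad a} with hn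
    have hnZ : 2 * K * n ≤ #Z := by
      refine Nat.le_of_mul_le_mul_left ?_ hW
      nlinarith
    have hZpos : 0 < #Z := by
      by_contra! h
      simp [Nat.le_zero.1 h] at hlt
    have hS'pos : 0 < #S' := by nlinarith
    refine ⟨S', (filter_subset _ _).trans hZ, Y₁ ∩ Y, inter_subset_right, card_pos.1 hS'pos, ?_, ?_⟩
    · have h1 : x * #(Y₁ ∩ Y) ≤ W * #Z := by
        calc x * #(Y₁ ∩ Y) ≤ ⌈x⌉₊ * #Y₁ := by
              gcongr
              · exact Nat.le_ceil x
              · exact inter_subset_left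
          _ ≤ W * #Z := by
              have : ⌈x⌉₊ * #Y₁ ≤ W * #Z := by omega
              exact_mod_cast this
      have h2 : (2 * K - 1 : ℝ) * #Z ≤ 2 * K * #S' := by
        have h3 : (#S' : ℝ) + n = #Z := by exact_mod_cast hZS'
        have h4 : 2 * (K : ℝ) * n ≤ #Z := by exact_mod_cast hnZ
        nlinarith
      have h5 : (1 + 1 / K : ℝ) * #S * #(Y₁ ∩ Y) ≤ #Z * #Y := by
        have h6 : x * #(Y₁ ∩ Y) * #Y = W * ((1 + 1 / K : ℝ) * #S * #(Y₁ ∩ Y)) := by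
          rw [hx]; field_simp
        refine le_of_mul_le_mul_left ?_ hWR
        rw [← h6]
        nlinarith
      have h7 : (1 + 1 / (4 * K) : ℝ) * (2 * K) ≤ (2 * K - 1) * (1 + 1 / K) := by
        have : (2 * K - 1) * (1 + 1 / K) - (1 + 1 / (4 * K) : ℝ) * (2 * K) = 1 / 2 - 1 / K := by
          field_simp; ring
        have : (1 : ℝ) / K ≤ 1 / 2 := by gcongr
        linarith
      set u : ℝ := #S * #(Y₁ ∩ Y) with hu
      have hu0 : 0 ≤ u := by positivity
      have h8 : (2 * K : ℝ) * ((1 + 1 / (4 * K) : ℝ) * u) ≤ (2 * K) * (#S' * #Y) := by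
        calc _ = (1 + 1 / (4 * K) : ℝ) * (2 * K) * u := by ring
          _ ≤ (2 * K - 1) * (1 + 1 / K) * u := by gcongr
          _ = (2 * K - 1) * ((1 + 1 / K) * #S * #(Y₁ ∩ Y)) := by rw [hu]; ring
          _ ≤ (2 * K - 1) * (#Z * #Y) := by
              gcongr
              linarith
          _ = (2 * K - 1) * #Z * #Y := by ring
          _ ≤ 2 * K * #S' * #Y := by gcongr
          _ = _ := by ring
      rw [mul_assoc]
      exact le_of_mul_le_mul_left h8 (by linarith)
    · intro a ha
      obtain ⟨haZ, ha⟩ := mem_filter.1 ha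
      refine le_trans ?_ (Nat.add_le_add_left ha _)
      refine (card_le_card ?_).trans (card_union_le _ _)
      intro e he
      simp only [mem_filter, mem_union, mem_inter, bad, hE'] at he ⊢
      obtain ⟨⟨he, heY⟩, rfl⟩ := he
      by_cases h : e.2 ∈ Y₁
      · exact .inl ⟨⟨he, h, heY⟩, rfl⟩
      · exact .inr ⟨⟨⟨he, hZ haZ, heY⟩, haZ, h⟩, rfl⟩

/-- A bipartite graph whose left degrees are large compared to the logarithm of its right degrees
contains an almost biregular subgraph. -/
lemma exists_biregular (E : Finset (α × β)) (A : Finset α) (B : Finset β)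
    (W K J Δ : ℕ) (hK : 2 ≤ K) (hKW : K ≤ W) (hJ : (Δ : ℝ) < (1 + 1 / (4 * K)) ^ J)
    (hA : A.Nonempty) (hBA : #B ≤ #A) (hEB : ∀ e ∈ E, e.2 ∈ B)
    (hl : ∀ a ∈ A, J * (2 * K * W) + W ≤ leftDeg E a) (hr : ∀ b, rightDeg E b ≤ Δ) :
    ∃ F ⊆ E, ∃ S : Finset α, ∃ Y : Finset β, Y.Nonempty ∧ #Y ≤ #S ∧ (∀ e ∈ F, e.1 ∈ S) ∧
      (∀ e ∈ F, e.2 ∈ Y) ∧ (∀ a ∈ S, leftDeg F a = W) ∧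
      ∀ b, (rightDeg F b : ℝ) * #Y ≤ (1 + 2 / K) * W * #S := by
  by_contra hno
  have hW : 0 < W := by omega
  have hKR : (2 : ℝ) ≤ K := by exact_mod_cast hK
  have hc : (1 : ℝ) ≤ 1 + 1 / (4 * K) := by
    have : (0 : ℝ) ≤ 1 / (4 * K) := by positivity
    linarith
  have hYne (S : Finset α) (Y : Finset β) (hS : S.Nonempty)
      (h : ∀ a ∈ S, W ≤ leftDeg (E.filter fun e => e.2 ∈ Y) a) : Y.Nonempty := by
    obtain ⟨a, ha⟩ := hS
    obtain ⟨e, he⟩ := card_pos.1 (hW.trans_le (h a ha))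
    exact ⟨e.2, (mem_filter.1 (mem_filter.1 he).1).2⟩
  have key : ∀ j ≤ J, ∃ S : Finset α, ∃ Y : Finset β, S.Nonempty ∧
      (1 + 1 / (4 * K) : ℝ) ^ j * #Y ≤ #S ∧
      ∀ a ∈ S, J * (2 * K * W) + W ≤
        leftDeg (E.filter fun e => e.2 ∈ Y) a + j * (2 * K * W) := by
    intro j
    induction j with
    | zero =>
      intro _
      refine ⟨A, B, hA, by simpa using hBA, fun a ha => ?_⟩
      rw [filter_true_of_mem hEB]
      simpa using hl a ha
    | succ j ih =>
      intro hj
      obtain ⟨S, Y, hS, hSY, hd⟩ := ih (by omega)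
      have hd' : ∀ a ∈ S, W ≤ leftDeg (E.filter fun e => e.2 ∈ Y) a := by
        intro a ha
        have := hd a ha
        have := Nat.mul_le_mul_right (2 * K * W) (show j ≤ J by omega)
        omega
      have hY := hYne S Y hS hd'
      have hYpos : (0 : ℝ) < #Y := by exact_mod_cast hY.card_pos
      have hYS : (#Y : ℝ) ≤ #S :=
        (le_mul_of_one_le_left hYpos.le (one_le_pow₀ hc)).trans hSY
      rcases biregular_or_ratio_increment E S Y W K hK hW hY hd' with
        ⟨F, hFE, hFS, hFY, hFl, hFr⟩ | ⟨S', hS', Y', hY', hne, hratio, hdeg⟩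
      · refine (hno ⟨F, hFE, S, Y, hY, by exact_mod_cast hYS, hFS, hFY, hFl, fun b => ?_⟩).elim
        have h1 : (rightDeg F b : ℝ) * #Y ≤ ((1 + 1 / K) * W * #S / #Y + 1) * #Y := by
          gcongr; exact hFr b
        have h2 : ((1 + 1 / K) * W * #S / #Y + 1) * #Y = (1 + 1 / K) * W * #S + (#Y : ℝ) := by
          field_simp
        have h3 : (1 : ℝ) ≤ W / K := by
          rw [one_le_div (by linarith)]; exact_mod_cast hKW
        have h4 : (1 + 2 / K) * W * #S = (1 + 1 / K) * W * #S + (W / K : ℝ) * #S := by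
          ring
        nlinarith
      · refine ⟨S', Y', hne, ?_, fun a ha => ?_⟩
        · have h1 : (1 + 1 / (4 * K) : ℝ) * ((1 + 1 / (4 * K) : ℝ) ^ j * #Y) * #Y' ≤ #S' * #Y :=
            le_trans (by gcongr) hratio
          refine le_of_mul_le_mul_right ?_ hYpos
          rw [pow_succ]
          linarith
        · have h1 := hd a (hS' ha)
          have h2 := hdeg a ha
          rw [add_mul]
          omega
  obtain ⟨S, Y, hS, hSY, hd⟩ := key J le_rfl
  have hd' : ∀ a ∈ S, W ≤ leftDeg (E.filter fun e => e.2 ∈ Y) a := by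
    intro a ha
    have := hd a ha
    omega
  have hY := hYne S Y hS hd'
  have hYpos : (0 : ℝ) < #Y := by exact_mod_cast hY.card_pos
  have h1 : #S ≤ Δ * #Y := by
    calc #S ≤ ∑ a ∈ S, leftDeg (E.filter fun e => e.2 ∈ Y) a := by
          rw [card_eq_sum_ones]
          exact sum_le_sum fun a ha => hW.trans_le (hd' a ha)
      _ ≤ #{e ∈ E | e.2 ∈ Y} := by rw [sum_leftDeg]; exact card_filter_le _ _
      _ = ∑ b ∈ Y, rightDeg E b := (sum_rightDeg _ _).symm
      _ ≤ ∑ b ∈ Y, Δ := sum_le_sum fun b _ => hr b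
      _ = Δ * #Y := by rw [sum_const, smul_eq_mul, mul_comm]
  have h2 : (#S : ℝ) ≤ Δ * #Y := by exact_mod_cast h1
  nlinarith

end

lemma sum_card_adj_comm {V : Type*} (G : SimpleGraph V) [DecidableRel G.Adj] (X Y : Finset V) :
    ∑ x ∈ X, #{y ∈ Y | G.Adj x y} = ∑ y ∈ Y, #{x ∈ X | G.Adj y x} := by
  simp only [card_filter]
  rw [sum_comm]
  exact sum_congr rfl fun y _ => sum_congr rfl fun x _ => by simp only [G.adj_comm x y]

/-- Every graph has a cut containing at least half of the edges. -/
lemma exists_large_cut {V : Type*} [DecidableEq V] (G : SimpleGraph V) [DecidableRel G.Adj]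
    (U : Finset V) :
    ∃ X Y : Finset V, Disjoint X Y ∧ X ∪ Y = U ∧
      ∑ u ∈ U, #{w ∈ U | G.Adj u w} ≤ 4 * ∑ x ∈ X, #{y ∈ Y | G.Adj x y} := by
  induction U using Finset.induction_on with
  | empty => exact ⟨∅, ∅, by simp⟩
  | insert v U hv ih =>
    obtain ⟨X, Y, hXY, hU, hle⟩ := ih
    have hvX : v ∉ X := fun h => hv (hU ▸ mem_union_left _ h)
    have hvY : v ∉ Y := fun h => hv (hU ▸ mem_union_right _ h)
    have hins (Z T : Finset V) (hvT : v ∉ T) : ∑ z ∈ Z, #{w ∈ insert v T | G.Adj z w} =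
        ∑ z ∈ Z, #{w ∈ T | G.Adj z w} + #{z ∈ Z | G.Adj v z} := by
      rw [sum_card_adj_comm, sum_insert hvT, ← sum_card_adj_comm G Z T, add_comm]
    have hUv : ∑ u ∈ insert v U, #{w ∈ insert v U | G.Adj u w} =
        ∑ u ∈ U, #{w ∈ U | G.Adj u w} + 2 * #{w ∈ U | G.Adj v w} := by
      rw [hins _ _ hv, sum_insert hv, filter_insert, if_neg G.irrefl]
      ring
    have hsplit : #{w ∈ U | G.Adj v w} = #{w ∈ X | G.Adj v w} + #{w ∈ Y | G.Adj v w} := by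
      rw [← hU, filter_union, card_union_of_disjoint (disjoint_filter_filter hXY)]
    rw [hUv]
    rcases le_total #{w ∈ X | G.Adj v w} #{w ∈ Y | G.Adj v w} with h | h
    · refine ⟨insert v X, Y, disjoint_insert_left.2 ⟨hvY, hXY⟩, by rw [insert_union, hU], ?_⟩
      rw [sum_insert hvX]
      omega
    · refine ⟨X, insert v Y, disjoint_insert_right.2 ⟨hvX, hXY⟩, by rw [union_insert, hU], ?_⟩
      rw [hins _ _ hvY]
      omega

lemma exists_subset_min_degree {V : Type*} [DecidableEq V] (G : SimpleGraph V)
    [DecidableRel G.Adj] (d n : ℕ) (X Y : Finset V) (hn : #X + #Y = n)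
    (h : d * n < ∑ x ∈ X, #{y ∈ Y | G.Adj x y}) :
    ∃ X' ⊆ X, ∃ Y' ⊆ Y, X'.Nonempty ∧ Y'.Nonempty ∧ (∀ x ∈ X', d ≤ #{y ∈ Y' | G.Adj x y}) ∧
      ∀ y ∈ Y', d ≤ #{x ∈ X' | G.Adj y x} := by
  induction n generalizing X Y with
  | zero =>
    have : X = ∅ := by rw [← card_eq_zero]; omega
    simp [this] at h
  | succ n ih =>
    by_cases hX : ∀ x ∈ X, d ≤ #{y ∈ Y | G.Adj x y}
    · by_cases hY : ∀ y ∈ Y, d ≤ #{x ∈ X | G.Adj y x}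
      · refine ⟨X, subset_rfl, Y, subset_rfl, ?_, ?_, hX, hY⟩
        · by_contra hne
          simp [not_nonempty_iff_eq_empty.1 hne] at h
        · by_contra hne
          simp [not_nonempty_iff_eq_empty.1 hne] at h
      · push Not at hY
        obtain ⟨y, hy, hlt⟩ := hY
        obtain ⟨X', hX', Y', hY', hres⟩ := ih X (Y.erase y)
          (by have := card_erase_add_one hy; omega) (by
            rw [sum_card_adj_comm] at h ⊢
            rw [← add_sum_erase _ _ hy] at h
            linarith)
        exact ⟨X', hX', Y', hY'.trans (erase_subset _ _), hres⟩
    · push Not at hX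
      obtain ⟨x, hx, hlt⟩ := hX
      obtain ⟨X', hX', Y', hY', hres⟩ := ih (X.erase x) Y
        (by have := card_erase_add_one hx; omega) (by
          rw [← add_sum_erase _ _ hx] at h
          linarith)
      exact ⟨X', hX'.trans (erase_subset _ _), Y', hY', hres⟩

/-- A graph of average degree more than `4 * d` has a bipartite subgraph in which the larger side
has minimum degree at least `d`. -/
lemma exists_bipartite_min_degree {V : Type*} [Fintype V] [DecidableEq V] (G : SimpleGraph V)
    [DecidableRel G.Adj] (d : ℕ) (h : 2 * d * Fintype.card V < edgeCount G) :
    ∃ A B : Finset V, Disjoint A B ∧ A.Nonempty ∧ #B ≤ #A ∧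
      ∀ a ∈ A, d ≤ #{b ∈ B | G.Adj a b} := by
  obtain ⟨X, Y, hXY, hU, hle⟩ := exists_large_cut G univ
  have hsum : ∑ u, #{w | G.Adj u w} = 2 * edgeCount G := by
    rw [edgeCount, ← SimpleGraph.coe_edgeFinset, Set.ncard_coe_finset,
      ← G.sum_degrees_eq_twice_card_edges]
    refine sum_congr rfl fun v _ => ?_
    rw [← G.card_neighborFinset_eq_degree, G.neighborFinset_eq_filter]
  have hcard : #X + #Y = Fintype.card V := by
    rw [← card_union_of_disjoint hXY, hU, card_univ]
  obtain ⟨X', hX', Y', hY', hXne, hYne, hXd, hYd⟩ := exists_subset_min_degree G d _ X Y hcard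
    (by rw [hsum] at hle; nlinarith)
  have hdisj : Disjoint X' Y' := disjoint_of_subset_left hX' (disjoint_of_subset_right hY' hXY)
  rcases le_total #Y' #X' with hc | hc
  · exact ⟨X', Y', hdisj, hXne, hc, hXd⟩
  · exact ⟨Y', X', hdisj.symm, hYne, hc, hYd⟩

lemma hasRegularSubgraph_of_finset {V : Type*} [DecidableEq V] (G : SimpleGraph V) (k : ℕ)
    (A B : Finset V) (hAB : Disjoint A B) (F : Finset (V × V)) (hF : F.Nonempty)
    (hG : ∀ e ∈ F, G.Adj e.1 e.2) (hA : ∀ e ∈ F, e.1 ∈ A) (hB : ∀ e ∈ F, e.2 ∈ B)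
    (hl : ∀ a, leftDeg F a = 0 ∨ leftDeg F a = k) (hr : ∀ b, rightDeg F b = 0 ∨ rightDeg F b = k) :
    HasRegularSubgraph G k := by
  let H : G.Subgraph :=
    { verts := {v | ∃ w, (v, w) ∈ F ∨ (w, v) ∈ F}
      Adj := fun v w => (v, w) ∈ F ∨ (w, v) ∈ F
      adj_sub := by
        rintro v w (h | h)
        · exact hG _ h
        · exact (hG _ h).symm
      edge_vert := fun {v w} h => ⟨w, h⟩
      symm := ⟨fun v w h => h.symm⟩ }
  refine ⟨H, ?_, ?_⟩
  · obtain ⟨e, he⟩ := hF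
    exact ⟨e.1, e.2, .inl he⟩
  · rintro v ⟨w, hw | hw⟩
    · have hvB : v ∉ B := disjoint_left.1 hAB (hA _ hw)
      have hN : H.neighborSet v = (({e ∈ F | e.1 = v}.image Prod.snd : Finset V) : Set V) := by
        ext u
        simp only [SimpleGraph.Subgraph.mem_neighborSet, coe_image, coe_filter, Set.mem_image,
          Set.mem_ofPred_eq, H]
        constructor
        · rintro (h | h)
          · exact ⟨(v, u), ⟨h, rfl⟩, rfl⟩
          · exact (hvB (hB _ h)).elim
        · rintro ⟨⟨v', u'⟩, ⟨h, rfl⟩, rfl⟩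
          exact .inl h
      rw [subDeg, hN, Set.ncard_coe_finset, card_image_of_injOn]
      · exact (hl v).resolve_left (card_ne_zero_of_mem (mem_filter.2 ⟨hw, rfl⟩))
      · intro e he e' he' h
        simp only [coe_filter, Set.mem_ofPred_eq] at he he'
        exact Prod.ext (he.2.trans he'.2.symm) h
    · have hvA : v ∉ A := disjoint_right.1 hAB (hB _ hw)
      have hN : H.neighborSet v = (({e ∈ F | e.2 = v}.image Prod.fst : Finset V) : Set V) := by
        ext u
        simp only [SimpleGraph.Subgraph.mem_neighborSet, coe_image, coe_filter, Set.mem_image,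
          Set.mem_ofPred_eq, H]
        constructor
        · rintro (h | h)
          · exact (hvA (hA _ h)).elim
          · exact ⟨(u, v), ⟨h, rfl⟩, rfl⟩
        · rintro ⟨⟨u', v'⟩, ⟨h, rfl⟩, rfl⟩
          exact .inr h
      rw [subDeg, hN, Set.ncard_coe_finset, card_image_of_injOn]
      · exact (hr v).resolve_left (card_ne_zero_of_mem (mem_filter.2 ⟨hw, rfl⟩))
      · intro e he e' he' h
        simp only [coe_filter, Set.mem_ofPred_eq] at he he'
        exact Prod.ext h (he.2.trans he'.2.symm)

lemma hasRegularSubgraph_of_bipartite {V : Type*} [Fintype V] [DecidableEq V] (G : SimpleGraph V)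
    [DecidableRel G.Adj] (k p m J Δ : ℕ) [Fact p.Prime] (hk : 0 < k) (hkp : k ≤ p)
    (hm : m + 1 = 2 * p) (hJ : (Δ : ℝ) < (1 + 1 / (4 * (16 * m : ℕ))) ^ J)
    (hΔ : ∀ v, deg G v ≤ Δ) (A B : Finset V) (hAB : Disjoint A B) (hA : A.Nonempty)
    (hBA : #B ≤ #A)
    (hd : ∀ a ∈ A, J * (2 * (16 * m) * (16 * m ^ 2)) + 16 * m ^ 2 ≤ #{b ∈ B | G.Adj a b}) :
    HasRegularSubgraph G k := by
  have hp : p.Prime := Fact.out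
  have hm1 : 1 ≤ m := by have := hp.two_le; omega
  let E : Finset (V × V) := {e ∈ A ×ˢ B | G.Adj e.1 e.2}
  have hE (e) (he : e ∈ E) : (e.1 ∈ A ∧ e.2 ∈ B) ∧ G.Adj e.1 e.2 := by
    simpa [E] using he
  have hl (a) (ha : a ∈ A) : leftDeg E a = #{b ∈ B | G.Adj a b} := by
    refine card_bij (fun e _ => e.2) ?_ ?_ ?_
    · intro e hea
      obtain ⟨he, rfl⟩ := mem_filter.1 hea
      exact mem_filter.2 ⟨(hE e he).1.2, (hE e he).2⟩
    · intro e he e' he' h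
      exact Prod.ext ((mem_filter.1 he).2.trans (mem_filter.1 he').2.symm) h
    · intro b hb
      obtain ⟨hb, hab⟩ := mem_filter.1 hb
      exact ⟨(a, b), by simp [E, ha, hb, hab], rfl⟩
  have hr (b) : rightDeg E b ≤ Δ := by
    refine le_trans ?_ (hΔ b)
    rw [deg, ← G.coe_neighborFinset, Set.ncard_coe_finset]
    refine card_le_card_of_injOn Prod.fst ?_ ?_
    · intro e heb
      obtain ⟨he, rfl⟩ := mem_filter.1 (mem_coe.1 heb)
      simpa using (hE e he).2.symm
    · intro e he e' he' h
      exact Prod.ext h ((mem_filter.1 he).2.trans (mem_filter.1 he').2.symm)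
  obtain ⟨F, hFE, S, Y, hY, hYS, hFS, hFY, hFl, hFr⟩ := exists_biregular E A B (16 * m ^ 2)
    (16 * m) J Δ (by omega) (by nlinarith) hJ hA hBA (fun e he => (hE e he).1.2)
    (fun a ha => by rw [hl a ha]; exact hd a ha) hr
  have hmR : (0 : ℝ) < m := by exact_mod_cast hm1
  obtain ⟨F₁, hF₁, hne₁, hl₁, hr₁⟩ := exists_prime_regular_subset_of_biregular p m hm F S Y hY hYS
    hFS hFY hFl (fun b _ => (hFr b).trans_eq (by push_cast; field_simp))
  obtain ⟨F₂, hF₂, hne₂, hl₂, hr₂⟩ := exists_regular_subset_of_le F₁ hne₁ p k hk hkp hl₁ hr₁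
  have hF₂E : F₂ ⊆ E := hF₂.trans (hF₁.trans hFE)
  exact hasRegularSubgraph_of_finset G k A B hAB F₂ hne₂ (fun e he => (hE e (hF₂E he)).2)
    (fun e he => (hE e (hF₂E he)).1.1) (fun e he => (hE e (hF₂E he)).1.2) hl₂ hr₂

/-- Pyber–Rödl–Szemerédi: for every positive integer `k` there is `C = C(k)` such that
every graph with maximum degree `Δ ≥ 2` and average degree at least `C·log₂ Δ` contains a
nonempty `k`-regular subgraph. -/
theorem pyber_rodl_szemeredi (k : ℕ) (hk : 0 < k) :
    ∃ C : ℝ, ∀ (V : Type) [Fintype V] (G : SimpleGraph V) (Δ : ℕ),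
      2 ≤ Δ → (∀ v, deg G v ≤ Δ) →
      C * Real.logb 2 (Δ : ℝ) ≤ avgDeg G →
      HasRegularSubgraph G k := by
  classical
  obtain ⟨p, hkp, hp⟩ := Nat.exists_infinite_primes k
  have : Fact p.Prime := ⟨hp⟩
  obtain ⟨m, hm⟩ : ∃ m, m + 1 = 2 * p := ⟨2 * p - 1, by have := hp.two_le; omega⟩
  have hm1 : 1 ≤ m := by have := hp.two_le; omega
  have hbase : (1 : ℝ) < 1 + 1 / (4 * (16 * m : ℕ)) := by
    have : (0 : ℝ) < 1 / (4 * (16 * m : ℕ)) := by positivity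
    linarith
  obtain ⟨n, hn⟩ := pow_unbounded_of_one_lt 2 hbase
  let c : ℕ := 2 * n * (2 * (16 * m) * (16 * m ^ 2)) + 16 * m ^ 2
  have hc : 0 < c := by positivity
  refine ⟨8 * c, fun V _ G Δ hΔ hdeg hC => ?_⟩
  let l := Nat.log 2 Δ
  have hl : 1 ≤ l := Nat.log_pos (by norm_num) hΔ
  let d := n * (l + 1) * (2 * (16 * m) * (16 * m ^ 2)) + 16 * m ^ 2
  have hdc : d ≤ c * l := by
    have h1 : n * (l + 1) * (2 * (16 * m) * (16 * m ^ 2)) ≤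
        n * (2 * l) * (2 * (16 * m) * (16 * m ^ 2)) := by gcongr; omega
    have h2 : 16 * m ^ 2 * 1 ≤ 16 * m ^ 2 * l := Nat.mul_le_mul_left _ hl
    simp only [d, c]
    linarith
  have hd : 0 < d := by positivity
  have hJ : (Δ : ℝ) < (1 + 1 / (4 * (16 * m : ℕ))) ^ (n * (l + 1)) := by
    calc (Δ : ℝ) < 2 ^ (l + 1) := by
          exact_mod_cast Nat.lt_pow_succ_log_self (by norm_num) Δ
      _ ≤ _ := by rw [pow_mul]; gcongr
  have havg : (8 * d : ℝ) ≤ avgDeg G := by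
    refine le_trans ?_ hC
    have h1 : (l : ℝ) ≤ Real.logb 2 Δ := by exact_mod_cast Real.natLog_le_logb Δ 2
    have h2 : (d : ℝ) ≤ c * l := by exact_mod_cast hdc
    have h3 : (c * l : ℝ) ≤ c * Real.logb 2 Δ := by gcongr
    linarith
  have hdR : (0 : ℝ) < d := by exact_mod_cast hd
  have hV : (0 : ℝ) < Fintype.card V := by
    rcases (Nat.cast_nonneg (α := ℝ) (Fintype.card V)).eq_or_lt with h | h
    · rw [avgDeg, ← h, div_zero] at havg
      linarith
    · exact h
  have hedge : 2 * d * Fintype.card V < edgeCount G := by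
    rw [avgDeg, le_div_iff₀ hV] at havg
    have : (2 * d * Fintype.card V : ℝ) < edgeCount G := by
      have := mul_pos hdR hV
      linarith
    exact_mod_cast this
  obtain ⟨A, B, hAB, hA, hBA, hmin⟩ := exists_bipartite_min_degree G d hedge
  exact hasRegularSubgraph_of_bipartite G k p m _ Δ hk hkp hm hJ hdeg A B hAB hA hBA hmin
end
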